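/- There exist constants C, c > 0 depending only on Ω such that for all ε ∈ (0, 1]: sup_{θ⋆ ∈ D} P( sup_{λ ∈ [λ_min, λ_max]} | τ̂(λ) − τ⋆(λ) | ≥ ε ) ≤ C ε^{−6} N^q exp(−cNε⁶), where τ̂(λ) = √n ‖y − Xθ̂_λ‖ / (n − ‖θ̂_λ‖₀). -/

import Mathlib

open MeasureTheory ProbabilityTheory
open scoped ENNReal NNReal

noncomputable section

/-- Standard Gaussian density φ. -/
def gphi (x : ℝ) : ℝ := Real.exp (-x ^ 2 / 2) / Real.sqrt (2 * Real.pi)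

/-- Standard Gaussian CDF Φ. -/
def gPhi (x : ℝ) : ℝ := ∫ t in Set.Iic x, gphi t

/-- Soft thresholding η(x; b) = sign(x)(|x| − b)₊. -/
def eta (x b : ℝ) : ℝ := Real.sign x * max (|x| - b) 0

/-- Derivative in x of soft thresholding: η′(x; b) = 1_{|x| > b}. -/
def eta' (x b : ℝ) : ℝ := if b < |x| then 1 else 0

/-- The ℓ_p ball F_p(ξ) = {x : (1/N) ∑ |xᵢ|^p ≤ ξ^p}. -/
def Fball (N : ℕ) (p ξ : ℝ) : Set (Fin N → ℝ) :=
  {x | (1 / (N : ℝ)) * ∑ i, |x i| ^ p ≤ ξ ^ p}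

/-- Number of nonzero entries ‖x‖₀. -/
def l0 {N : ℕ} (x : Fin N → ℝ) : ℕ := (Finset.univ.filter fun i => x i ≠ 0).card

/-- The ℓ₀ ball F_0(s) = {x : ‖x‖₀ ≤ sN}. -/
def F0ball (N : ℕ) (s : ℝ) : Set (Fin N → ℝ) := {x | (l0 x : ℝ) ≤ s * N}

/-- The critical sparsity s_max(δ). -/
def smax (δ : ℝ) : ℝ :=
  δ * sSup ((fun α : ℝ =>
      (1 - (2 / δ) * ((1 + α ^ 2) * gPhi (-α) - α * gphi α)) /
      (1 + α ^ 2 - 2 * ((1 + α ^ 2) * gPhi (-α) - α * gphi α))) '' Set.Ici 0)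

/-- Empirical distribution of the entries of a vector. -/
def empDist {N : ℕ} (θ : Fin N → ℝ) : Measure ℝ :=
  ((N : ℝ≥0∞))⁻¹ • ∑ i : Fin N, Measure.dirac (θ i)

/-- Empirical distribution of pairs of entries of two vectors. -/
def empDist2 {N : ℕ} (u v : Fin N → ℝ) : Measure (ℝ × ℝ) :=
  ((N : ℝ≥0∞))⁻¹ • ∑ i : Fin N, Measure.dirac (u i, v i)

/-- Squared order-2 Wasserstein distance between measures on ℝ². -/
def W2sq (μ ν : Measure (ℝ × ℝ)) : ℝ :=
  sInf {r : ℝ | ∃ γ : Measure ((ℝ × ℝ) × (ℝ × ℝ)),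
    γ.map Prod.fst = μ ∧ γ.map Prod.snd = ν ∧
    r = ∫ q, ((q.1.1 - q.2.1) ^ 2 + (q.1.2 - q.2.2) ^ 2) ∂γ}

/-- Order-2 Wasserstein distance. -/
def W2 (μ ν : Measure (ℝ × ℝ)) : ℝ := Real.sqrt (W2sq μ ν)

/-- Standard Gaussian measure on ℝ. -/
def stdG : Measure ℝ := gaussianReal 0 1

/-- The state-evolution fixed point equations (for (Θ,Z) ∼ μ ⊗ N(0,1)),
together with positivity of (β, τ). -/
def StateEvo (δ σ : ℝ) (μ : Measure ℝ) (lam β τ : ℝ) : Prop :=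
  0 < β ∧ 0 < τ ∧
  τ ^ 2 = σ ^ 2 + (1 / δ) *
    ∫ q : ℝ × ℝ, (eta (q.1 + τ * q.2) (τ * lam / β) - q.1) ^ 2 ∂(μ.prod stdG) ∧
  β = τ * (1 - (1 / δ) *
    ∫ q : ℝ × ℝ, eta' (q.1 + τ * q.2) (τ * lam / β) ∂(μ.prod stdG))

/-- s⋆ = P(|Θ + τZ| ≥ ατ) for (Θ,Z) ∼ μ ⊗ N(0,1). -/
def sStar (μ : Measure ℝ) (τ α : ℝ) : ℝ :=
  ((μ.prod stdG) {q : ℝ × ℝ | α * τ ≤ |q.1 + τ * q.2|}).toReal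

/-- The limit law μ⋆: law of (η(Θ + τZ; ατ), Θ) for (Θ,Z) ∼ μ ⊗ N(0,1). -/
def muStar (μ : Measure ℝ) (τ α : ℝ) : Measure (ℝ × ℝ) :=
  (μ.prod stdG).map (fun q => (eta (q.1 + τ * q.2) (α * τ), q.1))

/-- The limit law for the debiased Lasso: law of (Θ + τZ, Θ). -/
def muStarD (μ : Measure ℝ) (τ : ℝ) : Measure (ℝ × ℝ) :=
  (μ.prod stdG).map (fun q => (q.1 + τ * q.2, q.1))

/-- Law of the design matrix: i.i.d. N(0, 1/n) entries. -/
def PX (n N : ℕ) : Measure (Fin n → Fin N → ℝ) :=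
  Measure.pi fun _ => Measure.pi fun _ => gaussianReal 0 ((n : ℝ≥0))⁻¹

/-- Law of the noise: i.i.d. standard Gaussian entries. -/
def Pz (n : ℕ) : Measure (Fin n → ℝ) :=
  Measure.pi fun _ => gaussianReal 0 1

/-- Joint law of (X, z). -/
def Pmodel (n N : ℕ) : Measure ((Fin n → Fin N → ℝ) × (Fin n → ℝ)) :=
  (PX n N).prod (Pz n)

/-- The response y = Xθ⋆ + σz. -/
def yvec {n N : ℕ} (σ : ℝ) (θstar : Fin N → ℝ) (X : Fin n → Fin N → ℝ)
    (z : Fin n → ℝ) : Fin n → ℝ :=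
  fun i => (∑ j, X i j * θstar j) + σ * z i

/-- The Lasso cost (1/(2n))‖y − Xθ‖² + (λ/n)‖θ‖₁. -/
def lassoCost {n N : ℕ} (X : Fin n → Fin N → ℝ) (y : Fin n → ℝ) (lam : ℝ)
    (θ : Fin N → ℝ) : ℝ :=
  (1 / (2 * (n : ℝ))) * ∑ i, (y i - ∑ j, X i j * θ j) ^ 2
    + (lam / (n : ℝ)) * ∑ j, |θ j|

/-- The uniformity class: D is either an ℓ_p ball F_p(ξ) or an ℓ₀ ball F_0(s) with
s below the critical sparsity, with the corresponding exponent q. -/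
def DFamSpec (δ : ℝ) (Dfam : (M : ℕ) → Set (Fin M → ℝ)) (q : ℝ) : Prop :=
  (∃ p ξ : ℝ, 0 < p ∧ 0 < ξ ∧ (∀ M, Dfam M = Fball M p ξ) ∧ q = max (1 / p - 1) 0) ∨
  (∃ s : ℝ, 0 ≤ s ∧ s < smax δ ∧ (∀ M, Dfam M = F0ball M s) ∧ q = 0)

/-- The estimator τ̂(λ) = √n ‖y − Xθ̂_λ‖ / (n − ‖θ̂_λ‖₀). -/
def tauHat {n N : ℕ} (X : Fin n → Fin N → ℝ) (y : Fin n → ℝ) (θ : Fin N → ℝ) : ℝ :=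
  Real.sqrt (n : ℝ) * Real.sqrt (∑ i, (y i - ∑ j, X i j * θ j) ^ 2)
    / ((n : ℝ) - (l0 θ : ℝ))

instance stdG_isProbabilityMeasure : IsProbabilityMeasure stdG := by
  unfold stdG; infer_instance

theorem gaussianPDFReal_std (x : ℝ) :
    gaussianPDFReal 0 1 x = (√(2 * Real.pi))⁻¹ * Real.exp (-x ^ 2 / 2) := by
  simp [gaussianPDFReal]

theorem hasDerivAt_gaussianPDFReal_std (x : ℝ) :
    HasDerivAt (gaussianPDFReal 0 1) (-x * gaussianPDFReal 0 1 x) x := by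
  have h : gaussianPDFReal 0 1 = fun x => (√(2 * Real.pi))⁻¹ * Real.exp (-x ^ 2 / 2) := by
    funext y; exact gaussianPDFReal_std y
  rw [h]
  have h1 : HasDerivAt (fun x : ℝ => -x ^ 2 / 2) (-x) x :=
    (((hasDerivAt_pow 2 x).neg).div_const 2).congr_deriv (by norm_num; ring)
  exact ((h1.exp).const_mul ((√(2 * Real.pi))⁻¹)).congr_deriv (by ring)

theorem integral_stdG (f : ℝ → ℝ) :
    ∫ x, f x ∂stdG = ∫ x, gaussianPDFReal 0 1 x * f x := by
  unfold stdG
  rw [integral_gaussianReal_eq_integral_smul (by norm_num)]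
  simp

theorem integrable_stdG_iff (f : ℝ → ℝ) :
    Integrable f stdG ↔ Integrable (fun x => gaussianPDFReal 0 1 x * f x) := by
  unfold stdG
  rw [gaussianReal_of_var_ne_zero _ (by norm_num : (1 : ℝ≥0) ≠ 0)]
  rw [integrable_withDensity_iff_integrable_smul' (measurable_gaussianPDF 0 1)
    (Filter.Eventually.of_forall fun _ => gaussianPDF_lt_top)]
  simp [toReal_gaussianPDF]

theorem integrable_pow_stdG (k : ℕ) : Integrable (fun x : ℝ => x ^ k) stdG := by
  have := (memLp_id_gaussianReal (μ := 0) (v := 1) (k : ℝ≥0))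
  rcases Nat.eq_zero_or_pos k with rfl | hk
  · simp
  have h2 := this.integrable_norm_rpow (by simpa using hk.ne') (by simp)
  have : Integrable (fun x : ℝ => ‖x ^ k‖) stdG := by
    simpa [stdG] using h2
  exact (integrable_norm_iff (by fun_prop)).1 this

theorem integrable_id_stdG : Integrable (fun x : ℝ => x) stdG := by
  simpa using integrable_pow_stdG 1

/-- Gaussian integration by parts in one dimension. -/
theorem integral_id_mul_stdG {f f' : ℝ → ℝ} {C : ℝ} (hd : ∀ x, HasDerivAt f (f' x) x)
    (hf : ∀ x, |f x| ≤ C) (hf' : ∀ x, |f' x| ≤ C) :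
    ∫ x, x * f x ∂stdG = ∫ x, f' x ∂stdG := by
  have hfc : Continuous f := continuous_iff_continuousAt.2 fun x => (hd x).continuousAt
  have hfm : Measurable f' := by
    have : f' = deriv f := funext fun x => (hd x).deriv.symm
    rw [this]; exact measurable_deriv f
  have i1 : Integrable (fun x => x * f x) stdG :=
    integrable_id_stdG.mul_bdd (c := C) hfc.aestronglyMeasurable (Filter.Eventually.of_forall hf)
  have i2 : Integrable f' stdG :=
    Integrable.of_bound hfm.aestronglyMeasurable C (Filter.Eventually.of_forall hf')
  have i3 : Integrable f stdG :=
    Integrable.of_bound hfc.aestronglyMeasurable C (Filter.Eventually.of_forall hf)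
  rw [integral_stdG, integral_stdG]
  have j1 := (integrable_stdG_iff _).1 i1
  have j2 := (integrable_stdG_iff _).1 i2
  have j3 := (integrable_stdG_iff _).1 i3
  have key := integral_eq_zero_of_hasDerivAt_of_integrable
    (f := fun x => gaussianPDFReal 0 1 x * f x)
    (f' := fun x => gaussianPDFReal 0 1 x * f' x - gaussianPDFReal 0 1 x * (x * f x))
    (fun x => ((hasDerivAt_gaussianPDFReal_std x).mul (hd x)).congr_deriv (by ring))
    (j2.sub j1) j3
  rw [integral_sub j2 j1] at key
  linarith

/-- The standard Gaussian measure on `ι → ℝ`. -/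
def gpi (ι : Type*) [Fintype ι] : Measure (ι → ℝ) := Measure.pi fun _ => stdG

instance gpi_isProbabilityMeasure (ι : Type*) [Fintype ι] : IsProbabilityMeasure (gpi ι) := by
  unfold gpi; infer_instance

section Stein

variable {ι : Type*} [Fintype ι]

theorem measurePreserving_update_gpi [DecidableEq ι] (k : ι) :
    MeasurePreserving (fun p : (ι → ℝ) × ℝ => Function.update p.1 k p.2)
      ((gpi ι).prod stdG) (gpi ι) := by
  have hm : Measurable (fun p : (ι → ℝ) × ℝ => Function.update p.1 k p.2) :=
    measurable_pi_iff.2 fun a => by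
      by_cases h : a = k
      · subst h; simpa using measurable_snd
      · simp only [Function.update_of_ne h]; fun_prop
  refine ⟨hm, ?_⟩
  refine (Measure.pi_eq fun s hs => ?_).symm
  rw [Measure.map_apply hm (MeasurableSet.univ_pi hs)]
  have : (fun p : (ι → ℝ) × ℝ => Function.update p.1 k p.2) ⁻¹' (Set.univ.pi s) =
      (Set.univ.pi (Function.update s k Set.univ)) ×ˢ (s k) := by
    ext p
    simp only [Set.mem_preimage, Set.mem_pi, Set.mem_univ, true_imp_iff, Set.mem_prod]
    constructor
    · intro h
      refine ⟨fun i => ?_, by simpa using h k⟩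
      by_cases hi : i = k
      · subst hi; simp
      · simpa [Function.update_of_ne hi] using h i
    · rintro ⟨h1, h2⟩ i
      by_cases hi : i = k
      · subst hi; simpa using h2
      · simpa [Function.update_of_ne hi] using h1 i
  rw [this, Measure.prod_prod, gpi, Measure.pi_pi,
    ← Finset.mul_prod_erase _ _ (Finset.mem_univ k),
    ← Finset.mul_prod_erase Finset.univ (fun i => stdG (s i)) (Finset.mem_univ k)]
  rw [Finset.prod_congr rfl (g := fun i => stdG (s i))]
  · simp [mul_comm]
  · intro i hi
    rw [Function.update_of_ne (Finset.ne_of_mem_erase hi)]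

theorem measurePreserving_eval_gpi (k : ι) :
    MeasurePreserving (fun ξ : ι → ℝ => ξ k) (gpi ι) stdG :=
  measurePreserving_eval (fun _ : ι => stdG) k

theorem integrable_eval_gpi (k : ι) : Integrable (fun ξ : ι → ℝ => ξ k) (gpi ι) :=
  (measurePreserving_eval_gpi k).integrable_comp_of_integrable integrable_id_stdG

theorem integral_eval_mul_gpi [DecidableEq ι] (k : ι) {F F' : (ι → ℝ) → ℝ} {C : ℝ}
    (hF : Continuous F) (hFm : Measurable F') (hd : ∀ ξ x, HasDerivAt (fun x => F (Function.update ξ k x))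
      (F' (Function.update ξ k x)) x)
    (hb : ∀ ξ, |F ξ| ≤ C) (hb' : ∀ ξ, |F' ξ| ≤ C) :
    ∫ ξ, ξ k * F ξ ∂gpi ι = ∫ ξ, F' ξ ∂gpi ι := by
  have mp := measurePreserving_update_gpi k
  have i1 : Integrable (fun ξ => ξ k * F ξ) (gpi ι) :=
    (integrable_eval_gpi k).mul_bdd (c := C) hF.aestronglyMeasurable
      (Filter.Eventually.of_forall hb)
  have i2 : Integrable F' (gpi ι) :=
    Integrable.of_bound hFm.aestronglyMeasurable C (Filter.Eventually.of_forall hb')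
  have j1 := mp.integrable_comp_of_integrable i1
  have j2 := mp.integrable_comp_of_integrable i2
  rw [← mp.map_eq, integral_map mp.aemeasurable (by rw [mp.map_eq]; exact i1.aestronglyMeasurable),
    integral_map mp.aemeasurable (by rw [mp.map_eq]; exact i2.aestronglyMeasurable),
    integral_prod (fun p : (ι → ℝ) × ℝ => Function.update p.1 k p.2 k * F (Function.update p.1 k p.2)) j1,
    integral_prod (fun p : (ι → ℝ) × ℝ => F' (Function.update p.1 k p.2)) j2]
  refine integral_congr_ae (Filter.Eventually.of_forall fun ξ => ?_)
  simp only [Function.update_self]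
  exact integral_id_mul_stdG (fun x => hd ξ x) (fun x => hb _) (fun x => hb' _)

end Stein

/-- `f` is bounded and continuous, with bounded continuous partial derivatives `f1 k` that compute
its derivative along every componentwise differentiable path. -/
structure IsBddC1 {K : Type*} [Fintype K] (f : (K → ℝ) → ℝ) (f1 : K → (K → ℝ) → ℝ) : Prop where
  der : ∀ (z : ℝ → K → ℝ) (z' : K → ℝ) (t : ℝ), (∀ k, HasDerivAt (fun s => z s k) (z' k) t) →
    HasDerivAt (fun s => f (z s)) (∑ k, f1 k (z t) * z' k) t
  cont : Continuous f
  cont1 : ∀ k, Continuous (f1 k)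
  bdd : ∃ C, ∀ x, |f x| ≤ C
  bdd1 : ∃ C, ∀ k x, |f1 k x| ≤ C

namespace IsBddC1

variable {K : Type*} [Fintype K]

theorem const (c : ℝ) : IsBddC1 (K := K) (fun _ => c) (fun _ _ => 0) where
  der z z' t _ := by simpa using hasDerivAt_const t c
  cont := continuous_const
  cont1 _ := continuous_const
  bdd := ⟨|c|, fun _ => le_rfl⟩
  bdd1 := ⟨0, fun _ _ => by simp⟩

theorem mul {f g : (K → ℝ) → ℝ} {f1 g1 : K → (K → ℝ) → ℝ} (hf : IsBddC1 f f1)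
    (hg : IsBddC1 g g1) :
    IsBddC1 (fun x => f x * g x) (fun k x => f1 k x * g x + f x * g1 k x) where
  der z z' t h := by
    refine ((hf.der z z' t h).mul (hg.der z z' t h)).congr_deriv ?_
    rw [Finset.sum_mul, Finset.mul_sum, ← Finset.sum_add_distrib]
    exact Finset.sum_congr rfl fun k _ => by ring
  cont := hf.cont.mul hg.cont
  cont1 k := ((hf.cont1 k).mul hg.cont).add (hf.cont.mul (hg.cont1 k))
  bdd := by
    obtain ⟨C, hC⟩ := hf.bdd
    obtain ⟨D, hD⟩ := hg.bdd
    refine ⟨C * D, fun x => ?_⟩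
    rw [abs_mul]
    exact mul_le_mul (hC x) (hD x) (abs_nonneg _) ((abs_nonneg _).trans (hC x))
  bdd1 := by
    obtain ⟨C, hC⟩ := hf.bdd
    obtain ⟨D, hD⟩ := hg.bdd
    obtain ⟨C1, hC1⟩ := hf.bdd1
    obtain ⟨D1, hD1⟩ := hg.bdd1
    refine ⟨C1 * D + C * D1, fun k x => (abs_add_le _ _).trans ?_⟩
    rw [abs_mul, abs_mul]
    exact add_le_add
      (mul_le_mul (hC1 k x) (hD x) (abs_nonneg _) ((abs_nonneg _).trans (hC1 k x)))
      (mul_le_mul (hC x) (hD1 k x) (abs_nonneg _) ((abs_nonneg _).trans (hC x)))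

theorem add {f g : (K → ℝ) → ℝ} {f1 g1 : K → (K → ℝ) → ℝ} (hf : IsBddC1 f f1)
    (hg : IsBddC1 g g1) :
    IsBddC1 (fun x => f x + g x) (fun k x => f1 k x + g1 k x) where
  der z z' t h := by
    refine ((hf.der z z' t h).add (hg.der z z' t h)).congr_deriv ?_
    rw [← Finset.sum_add_distrib]
    exact Finset.sum_congr rfl fun k _ => by ring
  cont := hf.cont.add hg.cont
  cont1 k := (hf.cont1 k).add (hg.cont1 k)
  bdd := by
    obtain ⟨C, hC⟩ := hf.bdd
    obtain ⟨D, hD⟩ := hg.bdd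
    exact ⟨C + D, fun x => (abs_add_le _ _).trans (add_le_add (hC x) (hD x))⟩
  bdd1 := by
    obtain ⟨C, hC⟩ := hf.bdd1
    obtain ⟨D, hD⟩ := hg.bdd1
    exact ⟨C + D, fun k x => (abs_add_le _ _).trans (add_le_add (hC k x) (hD k x))⟩

theorem sum {J : Type*} (u : Finset J) {f : J → (K → ℝ) → ℝ} {f1 : J → K → (K → ℝ) → ℝ}
    (hf : ∀ j, IsBddC1 (f j) (f1 j)) :
    IsBddC1 (fun x => ∑ j ∈ u, f j x) (fun k x => ∑ j ∈ u, f1 j k x) := by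
  classical
  induction u using Finset.induction_on with
  | empty => simpa using const 0
  | insert a s ha ih => simpa only [Finset.sum_insert ha] using (hf a).add ih

theorem prod {J : Type*} [DecidableEq J] (u : Finset J) {f : J → (K → ℝ) → ℝ}
    {f1 : J → K → (K → ℝ) → ℝ} (hf : ∀ j, IsBddC1 (f j) (f1 j)) :
    IsBddC1 (fun x => ∏ j ∈ u, f j x)
      (fun k x => ∑ j ∈ u, (∏ i ∈ u.erase j, f i x) * f1 j k x) := by
  induction u using Finset.induction_on with
  | empty => simpa using const 1
  | insert a s ha ih =>
    have h := (hf a).mul ih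
    convert h using 1
    · funext x; rw [Finset.prod_insert ha]
    · funext k x
      rw [Finset.sum_insert ha, Finset.erase_insert ha, mul_comm, Finset.mul_sum]
      congr 1
      refine Finset.sum_congr rfl fun j hj => ?_
      have hne : a ≠ j := fun h => ha (h ▸ hj)
      rw [Finset.erase_insert_of_ne hne, Finset.prod_insert (fun h => ha (Finset.mem_of_mem_erase h))]
      ring

theorem comp_eval [DecidableEq K] {φ φ' : ℝ → ℝ} (hd : ∀ x, HasDerivAt φ (φ' x) x)
    (hc : Continuous φ') {C : ℝ} (hb : ∀ x, |φ x| ≤ C) (hb' : ∀ x, |φ' x| ≤ C) (c : ℝ) (k : K) :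
    IsBddC1 (fun x => φ (x k + c)) (fun l x => if l = k then φ' (x k + c) else 0) where
  der z z' t h := by
    have h1 := (h k).add_const c
    have h2 := (hd (z t k + c)).comp t h1
    refine h2.congr_deriv ?_
    simp
  cont := by
    have : Continuous φ := continuous_iff_continuousAt.2 fun x => (hd x).continuousAt
    fun_prop
  cont1 l := by
    split_ifs
    · fun_prop
    · exact continuous_const
  bdd := ⟨C, fun _ => hb _⟩
  bdd1 := ⟨C, fun l x => by
    split_ifs
    · exact hb' _
    · simpa using (abs_nonneg _).trans (hb 0)⟩

end IsBddC1

/-- A bounded function with bounded continuous partial derivatives up to order two. -/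
structure IsBddC2 {K : Type*} [Fintype K] (f : (K → ℝ) → ℝ) (f1 : K → (K → ℝ) → ℝ)
    (f2 : K → K → (K → ℝ) → ℝ) : Prop where
  fst : IsBddC1 f f1
  snd : ∀ k, IsBddC1 (f1 k) (f2 k)

theorem IsBddC2.prod {K : Type*} [Fintype K] {J : Type*} [DecidableEq J] (u : Finset J)
    {f : J → (K → ℝ) → ℝ} {f1 : J → K → (K → ℝ) → ℝ} {f2 : J → K → K → (K → ℝ) → ℝ}
    (hf : ∀ j, IsBddC2 (f j) (f1 j) (f2 j)) :
    IsBddC2 (fun x => ∏ j ∈ u, f j x)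
      (fun k x => ∑ j ∈ u, (∏ i ∈ u.erase j, f i x) * f1 j k x)
      (fun k l x => ∑ j ∈ u,
        ((∑ i ∈ u.erase j, (∏ i' ∈ (u.erase j).erase i, f i' x) * f1 i l x) * f1 j k x
          + (∏ i ∈ u.erase j, f i x) * f2 j k l x)) where
  fst := IsBddC1.prod u fun j => (hf j).fst
  snd k := IsBddC1.sum u fun j => (IsBddC1.prod (u.erase j) fun i => (hf i).fst).mul ((hf j).snd k)

section Stein

variable {ι : Type*} [Fintype ι]

theorem integrable_linear_gpi (x : ι → ℝ) : Integrable (fun ξ : ι → ℝ => ∑ m, x m * ξ m) (gpi ι) :=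
  integrable_finsetSum _ fun m _ => (integrable_eval_gpi m).const_mul _

theorem integral_linear_mul_gpi {K : Type*} [Fintype K] {g : (K → ℝ) → ℝ} {g1 : K → (K → ℝ) → ℝ}
    (hg : IsBddC1 g g1) (A : K → ι → ℝ) (x : ι → ℝ) :
    ∫ ξ, (∑ m, x m * ξ m) * g (fun k => ∑ m, A k m * ξ m) ∂gpi ι =
      ∑ l, (∑ m, x m * A l m) * ∫ ξ, g1 l (fun k => ∑ m, A k m * ξ m) ∂gpi ι := by
  classical
  obtain ⟨C, hC⟩ := hg.bdd
  obtain ⟨D, hD⟩ := hg.bdd1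
  have hcg : Continuous (fun ξ : ι → ℝ => g (fun k => ∑ m, A k m * ξ m)) :=
    hg.cont.comp (by fun_prop)
  have hcg1 : ∀ l, Continuous (fun ξ : ι → ℝ => g1 l (fun k => ∑ m, A k m * ξ m)) := fun l =>
    (hg.cont1 l).comp (by fun_prop)
  have h_int : ∀ l, Integrable (fun ξ : ι → ℝ => g1 l (fun k => ∑ m, A k m * ξ m)) (gpi ι) :=
    fun l => Integrable.of_bound (hcg1 l).aestronglyMeasurable D
      (Filter.Eventually.of_forall fun ξ => hD l _)
  have stein : ∀ m, ∫ ξ, ξ m * g (fun k => ∑ m, A k m * ξ m) ∂gpi ι =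
      ∑ l, A l m * ∫ ξ, g1 l (fun k => ∑ m, A k m * ξ m) ∂gpi ι := by
    intro m
    rw [integral_eval_mul_gpi m
      (F' := fun ξ => ∑ l, g1 l (fun k => ∑ m, A k m * ξ m) * A l m)
      (C := max C (∑ l, D * |A l m|)) hcg (Finset.measurable_fun_sum _ fun l _ => ((hcg1 l).measurable).mul_const _)]
    · rw [integral_finsetSum _ fun l _ => (h_int l).mul_const _]
      refine Finset.sum_congr rfl fun l _ => ?_
      rw [integral_mul_const, mul_comm]
    · intro ξ x
      refine hg.der (fun s k => ∑ j, A k j * Function.update ξ m s j) (fun k => A k m) x fun k => ?_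
      have : (fun s => ∑ j, A k j * Function.update ξ m s j) =
          fun s => A k m * s + ∑ j ∈ Finset.univ.erase m, A k j * ξ j := by
        funext s
        rw [← Finset.add_sum_erase _ _ (Finset.mem_univ m), Function.update_self]
        congr 1
        exact Finset.sum_congr rfl fun j hj => by
          rw [Function.update_of_ne (Finset.ne_of_mem_erase hj)]
      rw [this]
      simpa using ((hasDerivAt_id x).const_mul (A k m)).add_const (∑ j ∈ Finset.univ.erase m, A k j * ξ j)
    · exact fun ξ => (hC _).trans (le_max_left _ _)
    · intro ξ
      refine (Finset.abs_sum_le_sum_abs _ _).trans (le_trans ?_ (le_max_right _ _))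
      refine Finset.sum_le_sum fun l _ => ?_
      rw [abs_mul]
      exact mul_le_mul_of_nonneg_right (hD l _) (abs_nonneg _)
  simp_rw [Finset.sum_mul, mul_assoc]
  rw [integral_finsetSum]
  · simp_rw [integral_const_mul, stein, Finset.mul_sum]
    rw [Finset.sum_comm]
  · intro m _
    exact ((integrable_eval_gpi m).mul_bdd (c := C) hcg.aestronglyMeasurable
      (Filter.Eventually.of_forall fun ξ => hC _)).const_mul _

/-- Gaussian comparison: if `X k = x k · ξ` and `Y k = y k · ξ` are independent centered Gaussian
vectors and the covariance differences weighted by second derivatives of `f` are nonnegative, then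
`E f(Y) ≤ E f(X)`. -/
theorem integral_le_integral_of_covariance {K : Type*} [Fintype K] {f : (K → ℝ) → ℝ}
    {f1 : K → (K → ℝ) → ℝ} {f2 : K → K → (K → ℝ) → ℝ} (hf : IsBddC2 f f1 f2)
    (x y : K → ι → ℝ) (hxy : ∀ k l, ∑ m, x k m * y l m = 0)
    (hsign : ∀ k l z, 0 ≤ (∑ m, x k m * x l m - ∑ m, y k m * y l m) * f2 k l z) :
    ∫ ξ, f (fun k => ∑ m, y k m * ξ m) ∂gpi ι ≤ ∫ ξ, f (fun k => ∑ m, x k m * ξ m) ∂gpi ι := by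
  set A : ℝ → K → ι → ℝ := fun ϑ k m => Real.cos ϑ * y k m + Real.sin ϑ * x k m with hA
  set B : ℝ → K → ι → ℝ := fun ϑ k m => -Real.sin ϑ * y k m + Real.cos ϑ * x k m with hB
  set G : ℝ → ℝ := fun ϑ => ∫ ξ, f (fun k => ∑ m, A ϑ k m * ξ m) ∂gpi ι with hG
  obtain ⟨C, hC⟩ := hf.fst.bdd
  obtain ⟨D, hD⟩ := hf.fst.bdd1
  have hcf : ∀ ϑ, Continuous (fun ξ : ι → ℝ => f (fun k => ∑ m, A ϑ k m * ξ m)) := fun ϑ =>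
    hf.fst.cont.comp (by fun_prop)
  have hcf1 : ∀ ϑ l, Continuous (fun ξ : ι → ℝ => f1 l (fun k => ∑ m, A ϑ k m * ξ m)) :=
    fun ϑ l => (hf.fst.cont1 l).comp (by fun_prop)
  have hder : ∀ ϑ, HasDerivAt G
      (∫ ξ, ∑ k, f1 k (fun k => ∑ m, A ϑ k m * ξ m) * (∑ m, B ϑ k m * ξ m) ∂gpi ι) ϑ := by
    intro ϑ
    refine (hasDerivAt_integral_of_dominated_loc_of_deriv_le (μ := gpi ι)
      (F := fun ϑ ξ => f (fun k => ∑ m, A ϑ k m * ξ m))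
      (F' := fun ϑ ξ => ∑ k, f1 k (fun k => ∑ m, A ϑ k m * ξ m) * (∑ m, B ϑ k m * ξ m))
      (bound := fun ξ => ∑ k, D * ∑ m, (|y k m| + |x k m|) * |ξ m|)
      (s := Set.univ) Filter.univ_mem ?_ ?_ ?_ ?_ ?_ ?_).2
    · exact Filter.Eventually.of_forall fun ϑ => (hcf ϑ).aestronglyMeasurable
    · exact Integrable.of_bound (hcf ϑ).aestronglyMeasurable C
        (Filter.Eventually.of_forall fun ξ => hC _)
    · refine Continuous.aestronglyMeasurable ?_
      exact continuous_finsetSum _ fun k _ => (hcf1 ϑ k).mul (by fun_prop)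
    · refine Filter.Eventually.of_forall fun ξ ϑ _ => ?_
      refine (Finset.abs_sum_le_sum_abs _ _).trans (Finset.sum_le_sum fun k _ => ?_)
      rw [abs_mul]
      refine mul_le_mul (hD k _) ?_ (abs_nonneg _) ((abs_nonneg _).trans (hD k 0))
      refine (Finset.abs_sum_le_sum_abs _ _).trans (Finset.sum_le_sum fun m _ => ?_)
      rw [abs_mul]
      refine mul_le_mul_of_nonneg_right ?_ (abs_nonneg _)
      refine (abs_add_le _ _).trans (add_le_add ?_ ?_)
      · rw [abs_mul, abs_neg]
        exact mul_le_of_le_one_left (abs_nonneg _) (Real.abs_sin_le_one _)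
      · rw [abs_mul]
        exact mul_le_of_le_one_left (abs_nonneg _) (Real.abs_cos_le_one _)
    · exact integrable_finsetSum _ fun k _ => (integrable_finsetSum _ fun m _ =>
        ((integrable_eval_gpi m).abs).const_mul _).const_mul _
    · refine Filter.Eventually.of_forall fun ξ ϑ _ => ?_
      refine hf.fst.der (fun ϑ k => ∑ m, A ϑ k m * ξ m) (fun k => ∑ m, B ϑ k m * ξ m) ϑ fun k => ?_
      refine HasDerivAt.fun_sum fun m _ => ?_
      refine HasDerivAt.mul_const ?_ _
      exact ((Real.hasDerivAt_cos ϑ).mul_const _).add ((Real.hasDerivAt_sin ϑ).mul_const _)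
  have hval : ∀ ϑ, ∫ ξ, ∑ k, f1 k (fun k => ∑ m, A ϑ k m * ξ m) * (∑ m, B ϑ k m * ξ m) ∂gpi ι =
      ∑ k, ∑ l, Real.sin ϑ * Real.cos ϑ * ∫ ξ, ((∑ m, x k m * x l m - ∑ m, y k m * y l m) *
        f2 k l (fun k => ∑ m, A ϑ k m * ξ m)) ∂gpi ι := by
    intro ϑ
    rw [integral_finsetSum]
    · refine Finset.sum_congr rfl fun k _ => ?_
      simp_rw [mul_comm (f1 k _)]
      rw [integral_linear_mul_gpi (hf.snd k)]
      refine Finset.sum_congr rfl fun l _ => ?_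
      rw [integral_const_mul, ← mul_assoc]
      congr 1
      have e1 := hxy k l
      have e2 : ∑ m, y k m * x l m = 0 := by
        rw [← hxy l k]; exact Finset.sum_congr rfl fun m _ => mul_comm _ _
      calc ∑ m, B ϑ k m * A ϑ l m = Real.cos ϑ * Real.cos ϑ * ∑ m, x k m * y l m
            - Real.sin ϑ * Real.sin ϑ * ∑ m, y k m * x l m
            + Real.sin ϑ * Real.cos ϑ * (∑ m, x k m * x l m - ∑ m, y k m * y l m) := by
            simp only [mul_sub, Finset.mul_sum]
            rw [← Finset.sum_sub_distrib, ← Finset.sum_sub_distrib, ← Finset.sum_add_distrib]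
            exact Finset.sum_congr rfl fun m _ => by simp only [hA, hB]; ring
        _ = _ := by rw [e1, e2]; ring
    · intro k _
      refine Integrable.bdd_mul (integrable_linear_gpi _) (c := D)
        (hcf1 ϑ k).aestronglyMeasurable (Filter.Eventually.of_forall fun ξ => hD k _)
  have hmono : MonotoneOn G (Set.Icc 0 (Real.pi / 2)) := by
    refine monotoneOn_of_deriv_nonneg (convex_Icc _ _)
      (fun ϑ _ => (hder ϑ).continuousAt.continuousWithinAt)
      (fun ϑ _ => (hder ϑ).differentiableAt.differentiableWithinAt) fun ϑ hϑ => ?_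
    rw [interior_Icc] at hϑ
    rw [(hder ϑ).deriv, hval]
    have hs : 0 ≤ Real.sin ϑ :=
      Real.sin_nonneg_of_nonneg_of_le_pi hϑ.1.le (by linarith [hϑ.2, Real.pi_pos])
    have hc : 0 ≤ Real.cos ϑ :=
      Real.cos_nonneg_of_neg_pi_div_two_le_of_le (by linarith [hϑ.1, Real.pi_pos]) hϑ.2.le
    exact Finset.sum_nonneg fun k _ => Finset.sum_nonneg fun l _ =>
      mul_nonneg (mul_nonneg hs hc) (integral_nonneg fun ξ => hsign k l _)
  have h := hmono (Set.left_mem_Icc.2 (by positivity)) (Set.right_mem_Icc.2 (by positivity))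
    (by positivity)
  simpa [hG, hA] using h

end Stein

/-- A smooth decreasing cutoff, equal to `1` on the negative axis and to `0` beyond `s`. -/
theorem exists_smooth_cutoff {s : ℝ} (hs : 0 < s) : ∃ φ φ' φ'' : ℝ → ℝ, ∃ C : ℝ,
    (∀ x, HasDerivAt φ (φ' x) x) ∧ (∀ x, HasDerivAt φ' (φ'' x) x) ∧ Continuous φ' ∧
    Continuous φ'' ∧ (∀ x, |φ x| ≤ C) ∧ (∀ x, |φ' x| ≤ C) ∧ (∀ x, |φ'' x| ≤ C) ∧
    (∀ x, 0 ≤ φ x) ∧ (∀ x, φ x ≤ 1) ∧ (∀ x, φ' x ≤ 0) ∧ (∀ x ≤ 0, φ x = 1) ∧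
    ∀ x, s ≤ x → φ x = 0 := by
  set φ : ℝ → ℝ := fun x => Real.smoothTransition (1 - x / s) with hφ
  have hsm : ContDiff ℝ 2 φ := Real.smoothTransition.contDiff.comp (by fun_prop)
  have hc1 : ContDiff ℝ 1 (deriv φ) := by
    have := (contDiff_succ_iff_deriv (𝕜 := ℝ) (n := 1) (f := φ)).1 (by rw [one_add_one_eq_two]; exact hsm)
    exact this.2.2
  have hd : ∀ x, HasDerivAt φ (deriv φ x) x := fun x =>
    (hsm.differentiable (by norm_num) x).hasDerivAt
  have hd' : ∀ x, HasDerivAt (deriv φ) (deriv (deriv φ) x) x := fun x =>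
    (hc1.differentiable (by norm_num) x).hasDerivAt
  have hc2 : Continuous (deriv (deriv φ)) := hc1.continuous_deriv le_rfl
  have hone : ∀ x ≤ 0, φ x = 1 := fun x hx =>
    Real.smoothTransition.one_of_one_le (by have := div_nonpos_of_nonpos_of_nonneg hx hs.le; linarith)
  have hzero : ∀ x, s ≤ x → φ x = 0 := fun x hx =>
    Real.smoothTransition.zero_of_nonpos (by have := (one_le_div hs).2 hx; linarith)
  have hd0 : ∀ x, x ∉ Set.Icc 0 s → deriv φ x = 0 := by
    intro x hx
    rw [Set.mem_Icc, not_and_or, not_le, not_le] at hx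
    rcases hx with hx | hx
    · have : φ =ᶠ[nhds x] fun _ => 1 := by
        filter_upwards [Iio_mem_nhds hx] with y hy using hone y (le_of_lt hy)
      rw [this.deriv_eq]; simp
    · have : φ =ᶠ[nhds x] fun _ => 0 := by
        filter_upwards [Ioi_mem_nhds hx] with y hy using hzero y (le_of_lt hy)
      rw [this.deriv_eq]; simp
  have hdd0 : ∀ x, x ∉ Set.Icc 0 s → deriv (deriv φ) x = 0 := by
    intro x hx
    have : deriv φ =ᶠ[nhds x] fun _ => 0 := by
      filter_upwards [isClosed_Icc.isOpen_compl.mem_nhds hx] with y hy using hd0 y hy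
    rw [this.deriv_eq]; simp
  have hbd : ∀ g : ℝ → ℝ, Continuous g → (∀ x, x ∉ Set.Icc 0 s → g x = 0) → ∃ C, ∀ x, |g x| ≤ C := by
    intro g hg h0
    obtain ⟨C, hC⟩ := isCompact_Icc.exists_bound_of_continuousOn (s := Set.Icc 0 s) hg.continuousOn
    refine ⟨C, fun x => ?_⟩
    by_cases hx : x ∈ Set.Icc 0 s
    · exact hC x hx
    · rw [h0 x hx, abs_zero]
      exact (norm_nonneg _).trans (hC 0 (Set.left_mem_Icc.2 hs.le))
  obtain ⟨C1, hC1⟩ := hbd _ hc1.continuous hd0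
  obtain ⟨C2, hC2⟩ := hbd _ hc2 hdd0
  have hanti : Antitone φ := fun x y hxy => Real.smoothTransition.monotone
    (by have := div_le_div_of_nonneg_right hxy hs.le; linarith)
  refine ⟨φ, deriv φ, deriv (deriv φ), max 1 (max C1 C2), hd, hd', hc1.continuous, hc2, fun x => ?_,
    fun x => (hC1 x).trans ((le_max_left _ _).trans (le_max_right _ _)),
    fun x => (hC2 x).trans ((le_max_right _ _).trans (le_max_right _ _)),
    fun x => Real.smoothTransition.nonneg _, fun x => Real.smoothTransition.le_one _,
    fun x => hanti.deriv_nonpos, hone, hzero⟩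
  rw [abs_of_nonneg (Real.smoothTransition.nonneg _)]
  exact (Real.smoothTransition.le_one _).trans (le_max_left _ _)

theorem IsBddC1.neg {K : Type*} [Fintype K] {f : (K → ℝ) → ℝ} {f1 : K → (K → ℝ) → ℝ}
    (hf : IsBddC1 f f1) : IsBddC1 (fun x => -f x) (fun k x => -f1 k x) := by
  simpa using (IsBddC1.const (-1)).mul hf

theorem IsBddC2.one_sub {K : Type*} [Fintype K] {f : (K → ℝ) → ℝ} {f1 : K → (K → ℝ) → ℝ}
    {f2 : K → K → (K → ℝ) → ℝ} (hf : IsBddC2 f f1 f2) :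
    IsBddC2 (fun x => 1 - f x) (fun k x => -f1 k x) (fun k l x => -f2 k l x) where
  fst := by simpa [sub_eq_add_neg] using (IsBddC1.const 1).add hf.fst.neg
  snd k := (hf.snd k).neg

/-- Gordon's comparison for a smoothed version of the event `∃ i, ∀ j, x i j + ψ i j ≤ 0`. -/
theorem gordon_smooth {I J ι : Type*} [Fintype I] [Fintype J] [Fintype ι]
    (x y : I × J → ι → ℝ) (hxy : ∀ k l, ∑ m, x k m * y l m = 0)
    (hrow : ∀ k l, k.1 = l.1 → ∑ m, x k m * x l m = ∑ m, y k m * y l m)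
    (hoff : ∀ k l, ∑ m, y k m * y l m ≤ ∑ m, x k m * x l m)
    (ψ : I × J → ℝ) {φ φ' φ'' : ℝ → ℝ} {C : ℝ}
    (hd : ∀ x, HasDerivAt φ (φ' x) x) (hd' : ∀ x, HasDerivAt φ' (φ'' x) x)
    (hc' : Continuous φ') (hc'' : Continuous φ'') (hb : ∀ x, |φ x| ≤ C) (hb' : ∀ x, |φ' x| ≤ C)
    (hb'' : ∀ x, |φ'' x| ≤ C) (h0 : ∀ x, 0 ≤ φ x) (h1 : ∀ x, φ x ≤ 1) (hneg : ∀ x, φ' x ≤ 0) :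
    ∫ ξ, ∏ i, (1 - ∏ j, φ (∑ m, y (i, j) m * ξ m + ψ (i, j))) ∂gpi ι ≤
      ∫ ξ, ∏ i, (1 - ∏ j, φ (∑ m, x (i, j) m * ξ m + ψ (i, j))) ∂gpi ι := by
  classical
  have hbase : ∀ k : I × J, IsBddC2 (fun z : I × J → ℝ => φ (z k + ψ k))
      (fun l z => if l = k then φ' (z k + ψ k) else 0)
      (fun l l' z => if l = k then (if l' = k then φ'' (z k + ψ k) else 0) else 0) := by
    intro k
    refine ⟨IsBddC1.comp_eval hd hc' hb hb' _ k, fun l => ?_⟩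
    by_cases h : l = k
    · simpa [h] using IsBddC1.comp_eval hd' hc'' hb' hb'' (ψ k) k
    · simpa [h] using IsBddC1.const (K := I × J) 0
  have hA : ∀ i : I, IsBddC2 _ _ _ := fun i =>
    (IsBddC2.prod (Finset.univ : Finset J) fun j => hbase (i, j)).one_sub
  have hf := IsBddC2.prod (Finset.univ : Finset I) hA
  refine integral_le_integral_of_covariance hf x y hxy ?_
  intro k l z
  by_cases hkl : k.1 = l.1
  · rw [hrow k l hkl]; simp
  refine mul_nonneg (sub_nonneg.2 (hoff k l)) (Finset.sum_nonneg fun i _ => ?_)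
  have hA0 : ∀ i, 0 ≤ 1 - ∏ j, φ (z (i, j) + ψ (i, j)) := fun i =>
    sub_nonneg.2 (Finset.prod_le_one (fun j _ => h0 _) fun j _ => h1 _)
  have hA1 : ∀ i (l : I × J), 0 ≤ -∑ j, (∏ j' ∈ Finset.univ.erase j, φ (z (i, j') + ψ (i, j'))) *
      (if l = (i, j) then φ' (z (i, j) + ψ (i, j)) else 0) := by
    intro i l
    refine neg_nonneg.2 (Finset.sum_nonpos fun j _ => mul_nonpos_of_nonneg_of_nonpos
      (Finset.prod_nonneg fun j' _ => h0 _) ?_)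
    split_ifs
    · exact hneg _
    · exact le_rfl
  refine add_nonneg (mul_nonneg (Finset.sum_nonneg fun i' _ => mul_nonneg
    (Finset.prod_nonneg fun _ _ => hA0 _) (hA1 _ _)) (hA1 _ _)) (le_of_eq ?_)
  refine (mul_eq_zero_of_right _ (neg_eq_zero.2 (Finset.sum_eq_zero fun j _ => ?_))).symm
  by_cases hk : k = (i, j)
  · have hl : ∀ j', l ≠ (i, j') := by
      rintro j' rfl
      exact hkl (by rw [hk])
    simp [hl]
  · simp [hk]

/-- Gordon's inequality for probabilities, for two independent families of linear forms of a
Gaussian vector. -/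
theorem gordon_linear {I J ι : Type*} [Fintype I] [Fintype J] [Fintype ι]
    (x y : I × J → ι → ℝ) (hxy : ∀ k l, ∑ m, x k m * y l m = 0)
    (hrow : ∀ k l, k.1 = l.1 → ∑ m, x k m * x l m = ∑ m, y k m * y l m)
    (hoff : ∀ k l, ∑ m, y k m * y l m ≤ ∑ m, x k m * x l m)
    (ψ : I × J → ℝ) {s : ℝ} (hs : 0 < s) :
    gpi ι {ξ | ∃ i, ∀ j, ∑ m, x (i, j) m * ξ m + ψ (i, j) ≤ 0} ≤
      gpi ι {ξ | ∃ i, ∀ j, ∑ m, y (i, j) m * ξ m + ψ (i, j) < s} := by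
  obtain ⟨φ, φ', φ'', C, hd, hd', hc', hc'', hb, hb', hb'', h0, h1, hneg, hone, hzero⟩ :=
    exists_smooth_cutoff hs
  have key := gordon_smooth x y hxy hrow hoff ψ hd hd' hc' hc'' hb hb' hb'' h0 h1 hneg
  have hφc : Continuous φ := continuous_iff_continuousAt.2 fun x => (hd x).continuousAt
  set A : Set (ι → ℝ) := {ξ | ∃ i, ∀ j, ∑ m, x (i, j) m * ξ m + ψ (i, j) ≤ 0} with hA
  set B : Set (ι → ℝ) := {ξ | ∃ i, ∀ j, ∑ m, y (i, j) m * ξ m + ψ (i, j) < s} with hB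
  have hAm : MeasurableSet A := by
    have : A = ⋃ i, ⋂ j, {ξ | ∑ m, x (i, j) m * ξ m + ψ (i, j) ≤ 0} := by ext; simp [hA]
    rw [this]
    exact MeasurableSet.iUnion fun i => MeasurableSet.iInter fun j =>
      measurableSet_le (by fun_prop) (by fun_prop)
  have hBm : MeasurableSet B := by
    have : B = ⋃ i, ⋂ j, {ξ | ∑ m, y (i, j) m * ξ m + ψ (i, j) < s} := by ext; simp [hB]
    rw [this]
    exact MeasurableSet.iUnion fun i => MeasurableSet.iInter fun j =>
      measurableSet_lt (by fun_prop) (by fun_prop)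
  have hfac : ∀ z : J → ℝ, 0 ≤ 1 - ∏ j, φ (z j) ∧ 1 - ∏ j, φ (z j) ≤ 1 := fun z =>
    ⟨sub_nonneg.2 (Finset.prod_le_one (fun j _ => h0 _) fun j _ => h1 _),
      sub_le_self _ (Finset.prod_nonneg fun j _ => h0 _)⟩
  have hf01 : ∀ z : I × J → ℝ, 0 ≤ ∏ i, (1 - ∏ j, φ (z (i, j))) ∧
      ∏ i, (1 - ∏ j, φ (z (i, j))) ≤ 1 := fun z =>
    ⟨Finset.prod_nonneg fun i _ => (hfac _).1,
      Finset.prod_le_one (fun i _ => (hfac _).1) fun i _ => (hfac _).2⟩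
  have h_int : ∀ x : I × J → ι → ℝ, Integrable
      (fun ξ => ∏ i, (1 - ∏ j, φ (∑ m, x (i, j) m * ξ m + ψ (i, j)))) (gpi ι) := by
    intro x
    refine Integrable.of_bound (C := 1) (Continuous.aestronglyMeasurable ?_)
      (Filter.Eventually.of_forall fun ξ => ?_)
    · refine continuous_finsetProd _ fun i _ => continuous_const.sub
        (continuous_finsetProd _ fun j _ => hφc.comp (by fun_prop))
    · have := hf01 fun k => ∑ m, x k m * ξ m + ψ k
      rw [Real.norm_eq_abs, abs_of_nonneg this.1]
      exact this.2
  have hX : ∫ ξ, ∏ i, (1 - ∏ j, φ (∑ m, x (i, j) m * ξ m + ψ (i, j))) ∂gpi ι ≤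
      1 - (gpi ι).real A := by
    rw [← probReal_compl_eq_one_sub hAm, ← integral_indicator_one hAm.compl]
    refine integral_mono (h_int x) ((integrable_const 1).indicator hAm.compl) fun ξ => ?_
    by_cases h : ξ ∈ A
    · obtain ⟨i, hi⟩ := id h
      rw [Set.indicator_of_notMem (by simpa using h)]
      refine le_of_eq (Finset.prod_eq_zero (Finset.mem_univ i) ?_)
      rw [Finset.prod_eq_one fun j _ => hone _ (hi j), sub_self]
    · rw [Set.indicator_of_mem (by simpa using h)]
      exact (hf01 fun k => ∑ m, x k m * ξ m + ψ k).2
  have hY : 1 - (gpi ι).real B ≤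
      ∫ ξ, ∏ i, (1 - ∏ j, φ (∑ m, y (i, j) m * ξ m + ψ (i, j))) ∂gpi ι := by
    rw [← probReal_compl_eq_one_sub hBm, ← integral_indicator_one hBm.compl]
    refine integral_mono ((integrable_const 1).indicator hBm.compl) (h_int y) fun ξ => ?_
    by_cases h : ξ ∈ B
    · rw [Set.indicator_of_notMem (by simpa using h)]
      exact (hf01 fun k => ∑ m, y k m * ξ m + ψ k).1
    · rw [Set.indicator_of_mem (by simpa using h)]
      simp only [hB, Set.mem_ofPred_eq, not_exists, not_forall, not_lt] at h
      refine le_of_eq (Finset.prod_eq_one fun i _ => ?_).symm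
      obtain ⟨j, hj⟩ := h i
      rw [Finset.prod_eq_zero (Finset.mem_univ j) (hzero _ hj), sub_zero]
  have : (gpi ι).real A ≤ (gpi ι).real B := by linarith
  exact (ENNReal.toReal_le_toReal (measure_ne_top _ _) (measure_ne_top _ _)).1 this

/-- The Euclidean norm of a real vector. -/
def l2 {ι : Type*} [Fintype ι] (a : ι → ℝ) : ℝ := √(∑ m, a m ^ 2)

section

variable {ι κ : Type*} [Fintype ι] [Fintype κ]

theorem l2_nonneg (a : ι → ℝ) : 0 ≤ l2 a := Real.sqrt_nonneg _

theorem l2_sq (a : ι → ℝ) : l2 a ^ 2 = ∑ m, a m ^ 2 :=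
  Real.sq_sqrt (Finset.sum_nonneg fun _ _ => sq_nonneg _)

theorem sum_mul_le_l2 (a b : ι → ℝ) : ∑ m, a m * b m ≤ l2 a * l2 b :=
  Real.sum_mul_le_sqrt_mul_sqrt _ _ _

theorem measurePreserving_gpi_sum (ι κ : Type*) [Fintype ι] [Fintype κ] :
    MeasurePreserving (fun ξ : ι ⊕ κ → ℝ => ((fun i => ξ (Sum.inl i)), fun k => ξ (Sum.inr k)))
      (gpi (ι ⊕ κ)) ((gpi ι).prod (gpi κ)) :=
  measurePreserving_sumPiEquivProdPi (fun _ : ι ⊕ κ => stdG)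

theorem stdG_Iic_zero : 1 ≤ 2 * stdG (Set.Iic 0) := by
  have h1 : stdG (Set.Ici 0) = stdG (Set.Iic 0) := by
    have h : stdG.map (fun x => -x) = stdG := by
      have := gaussianReal_map_neg (μ := 0) (v := 1)
      simpa [stdG] using this
    conv_lhs => rw [← h]
    rw [Measure.map_apply measurable_neg measurableSet_Ici]
    congr 1
    ext x; simp
  have h2 : (1 : ℝ≥0∞) = stdG (Set.Iic 0 ∪ Set.Ici 0) := by
    rw [Set.Iic_union_Ici, measure_univ]
  rw [h2]
  refine (measure_union_le _ _).trans ?_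
  rw [h1, two_mul]

/-- Gordon's min-max inequality for finitely many vectors. -/
theorem gordon_finite {I J : Type*} [Fintype I] [Fintype J] (a : I → ι → ℝ) (b : J → κ → ℝ)
    (ψ : I → J → ℝ) {s : ℝ} (hs : 0 < s) :
    gpi (κ × ι) {G | ∃ i, ∀ j, ∑ k, b j k * ∑ m, G (k, m) * a i m + ψ i j ≤ 0} ≤
      2 * ((gpi κ).prod (gpi ι)) {p | ∃ i, ∀ j,
        l2 (a i) * ∑ k, p.1 k * b j k + l2 (b j) * ∑ m, p.2 m * a i m + ψ i j < s} := by
  set x : I × J → (κ × ι) ⊕ (Unit ⊕ (κ ⊕ ι)) → ℝ := fun p => Sum.elim (fun q => b p.2 q.1 * a p.1 q.2)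
    (Sum.elim (fun _ => l2 (a p.1) * l2 (b p.2)) 0) with hx
  set y : I × J → (κ × ι) ⊕ (Unit ⊕ (κ ⊕ ι)) → ℝ := fun p => Sum.elim 0 (Sum.elim 0
    (Sum.elim (fun k => l2 (a p.1) * b p.2 k) (fun m => l2 (b p.2) * a p.1 m))) with hy
  have covx : ∀ k l, ∑ m, x k m * x l m = (∑ i, b k.2 i * b l.2 i) * (∑ i, a k.1 i * a l.1 i)
      + l2 (a k.1) * l2 (b k.2) * (l2 (a l.1) * l2 (b l.2)) := by
    intro k l
    simp only [hx, Fintype.sum_sum_type, Sum.elim_inl, Sum.elim_inr, Pi.zero_apply, mul_zero,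
      Finset.sum_const_zero, add_zero, Finset.univ_unique, Finset.sum_singleton]
    rw [Fintype.sum_prod_type, Finset.sum_mul_sum]
    congr 1
    exact Finset.sum_congr rfl fun i _ => Finset.sum_congr rfl fun j _ => by ring
  have covy : ∀ k l, ∑ m, y k m * y l m = l2 (a k.1) * l2 (a l.1) * (∑ i, b k.2 i * b l.2 i)
      + l2 (b k.2) * l2 (b l.2) * (∑ i, a k.1 i * a l.1 i) := by
    intro k l
    simp only [hy, Fintype.sum_sum_type, Sum.elim_inl, Sum.elim_inr, Pi.zero_apply, mul_zero,
      Finset.sum_const_zero, zero_add, Finset.mul_sum]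
    congr 1 <;> exact Finset.sum_congr rfl fun i _ => by ring
  have hsq : ∀ {ρ : Type _} [Fintype ρ] (v : ρ → ℝ), ∑ i, v i * v i = l2 v * l2 v := by
    intro ρ _ v
    rw [← sq, l2_sq]
    exact Finset.sum_congr rfl fun i _ => (sq _).symm
  have key := gordon_linear x y
    (by
      intro k l
      simp [hx, hy, Fintype.sum_sum_type])
    (by
      intro k l hkl
      rw [covx, covy, hkl]
      have := hsq (a l.1)
      simp only [this]
      ring)
    (by
      intro k l
      rw [covx, covy]
      have h1 := sum_mul_le_l2 (a k.1) (a l.1)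
      have h2 := sum_mul_le_l2 (b k.2) (b l.2)
      nlinarith [mul_nonneg (sub_nonneg.2 h1) (sub_nonneg.2 h2)])
    (fun p => ψ p.1 p.2) hs
  have mp1 := measurePreserving_gpi_sum (κ × ι) (Unit ⊕ (κ ⊕ ι))
  have mp2 := measurePreserving_gpi_sum Unit (κ ⊕ ι)
  have mp3 := measurePreserving_gpi_sum κ ι
  set A : Set (κ × ι → ℝ) := {G | ∃ i, ∀ j, ∑ k, b j k * ∑ m, G (k, m) * a i m + ψ i j ≤ 0} with hA
  set B : Set ((κ → ℝ) × (ι → ℝ)) := {p | ∃ i, ∀ j,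
        l2 (a i) * ∑ k, p.1 k * b j k + l2 (b j) * ∑ m, p.2 m * a i m + ψ i j < s} with hB
  have hAm : MeasurableSet A := by
    have : A = ⋃ i, ⋂ j, {G | ∑ k, b j k * ∑ m, G (k, m) * a i m + ψ i j ≤ 0} := by ext; simp [hA]
    rw [this]
    exact MeasurableSet.iUnion fun i => MeasurableSet.iInter fun j =>
      measurableSet_le (by fun_prop) (by fun_prop)
  have hBm : MeasurableSet B := by
    have : B = ⋃ i, ⋂ j, {p | l2 (a i) * ∑ k, p.1 k * b j k + l2 (b j) * ∑ m, p.2 m * a i m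
        + ψ i j < s} := by ext; simp [hB]
    rw [this]
    exact MeasurableSet.iUnion fun i => MeasurableSet.iInter fun j =>
      measurableSet_lt (by fun_prop) (by fun_prop)
  have hγ : MeasurableSet {η : Unit ⊕ (κ ⊕ ι) → ℝ | η (Sum.inl ()) ∈ Set.Iic (0 : ℝ)} :=
    measurableSet_Iic.preimage (measurable_pi_apply _)
  have hleft : gpi (κ × ι) A * stdG (Set.Iic 0) ≤
      gpi _ {ξ | ∃ i, ∀ j, ∑ m, x (i, j) m * ξ m + ψ i j ≤ 0} := by
    have e1 : stdG (Set.Iic 0) =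
        gpi (Unit ⊕ (κ ⊕ ι)) {η : Unit ⊕ (κ ⊕ ι) → ℝ | η (Sum.inl ()) ∈ Set.Iic (0 : ℝ)} :=
      ((measurePreserving_eval_gpi (Sum.inl ())).measure_preimage
        measurableSet_Iic.nullMeasurableSet).symm
    rw [e1, ← Measure.prod_prod, ← mp1.measure_preimage (hAm.prod hγ).nullMeasurableSet]
    refine measure_mono ?_
    rintro ξ ⟨⟨i, hi⟩, h2⟩
    refine ⟨i, fun j => le_trans (le_of_eq ?_) (add_nonpos (hi j)
      (mul_nonpos_of_nonneg_of_nonpos (mul_nonneg (l2_nonneg (a i)) (l2_nonneg (b j))) h2))⟩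
    simp only [hx, Fintype.sum_sum_type, Sum.elim_inl, Sum.elim_inr, Pi.zero_apply, zero_mul,
      Finset.sum_const_zero, add_zero, Finset.univ_unique, Finset.sum_singleton,
      Fintype.sum_prod_type, Finset.mul_sum, PUnit.default_eq_unit]
    have : ∀ k m, b j k * (ξ (Sum.inl (k, m)) * a i m) = b j k * a i m * ξ (Sum.inl (k, m)) :=
      fun k m => by ring
    simp only [this]
    ring
  have hright : gpi _ {ξ | ∃ i, ∀ j, ∑ m, y (i, j) m * ξ m + ψ i j < s} =
      ((gpi κ).prod (gpi ι)) B := by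
    rw [← mp3.measure_preimage hBm.nullMeasurableSet,
      ← (measurePreserving_snd.comp mp2).measure_preimage
        (mp3.measurable hBm).nullMeasurableSet,
      ← (measurePreserving_snd.comp mp1).measure_preimage
        (measurePreserving_snd.comp mp2 |>.measurable (mp3.measurable hBm)).nullMeasurableSet]
    congr 1
    ext ξ
    simp only [hB, hy, Set.mem_ofPred_eq, Set.mem_preimage, Function.comp, Fintype.sum_sum_type,
      Sum.elim_inl, Sum.elim_inr, Pi.zero_apply, zero_mul, Finset.sum_const_zero, zero_add,
      Finset.mul_sum]
    refine exists_congr fun i => forall_congr' fun j => ?_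
    simp only [mul_assoc, mul_comm (b j _), mul_comm (a i _)]
  calc gpi (κ × ι) A ≤ gpi (κ × ι) A * (2 * stdG (Set.Iic 0)) :=
        le_mul_of_one_le_right zero_le stdG_Iic_zero
    _ = 2 * (gpi (κ × ι) A * stdG (Set.Iic 0)) := by ring
    _ ≤ 2 * ((gpi κ).prod (gpi ι)) B := by
        rw [← hright]
        exact mul_le_mul_right (hleft.trans key) 2

end

theorem exists_finite_net {Ω A B : Type*} [MetricSpace Ω] [MetricSpace A] [MetricSpace B]
    [ProperSpace A] [ProperSpace B] {F : Ω → A → B → ℝ}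
    (hF : Continuous fun p : Ω × A × B => F p.1 p.2.1 p.2.2) {Q : Set Ω} (hQ : IsCompact Q)
    {S : Set A} {T : Set B} (hS : Bornology.IsBounded S) (hT : Bornology.IsBounded T)
    {r : ℝ} (hr : 0 < r) :
    ∃ S₀ : Finset A, (∀ s ∈ S₀, s ∈ S) ∧
      ∀ ω ∈ Q, ∀ s ∈ S, ∃ s' ∈ S₀, ∀ t ∈ T, |F ω s t - F ω s' t| ≤ r := by
  have hc : IsCompact (Q ×ˢ (closure S ×ˢ closure T)) :=
    hQ.prod (hS.isCompact_closure.prod hT.isCompact_closure)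
  have hu := hc.uniformContinuousOn_of_continuous hF.continuousOn
  obtain ⟨δ, hδ, hd⟩ := Metric.uniformContinuousOn_iff.1 hu r hr
  obtain ⟨N, hNS, hfin, hcov⟩ := Metric.finite_approx_of_totallyBounded
    (hS.isCompact_closure.totallyBounded.subset subset_closure) δ hδ
  refine ⟨hfin.toFinset, fun s hs => hNS (by simpa using hs), fun ω hω s hs => ?_⟩
  obtain ⟨s', hs', hss⟩ := Set.mem_iUnion₂.1 (hcov hs)
  refine ⟨s', by simpa using hs', fun t ht => ?_⟩
  have h := hd (ω, s, t) ⟨hω, subset_closure hs, subset_closure ht⟩ (ω, s', t)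
    ⟨hω, subset_closure (hNS hs'), subset_closure ht⟩
    (by simpa [Prod.dist_eq, hδ] using hss)
  rw [Real.dist_eq] at h
  exact h.le

section

variable {ι κ : Type*} [Fintype ι] [Fintype κ]

/-- The bilinear form in Gordon's inequality, with linear and constant perturbations. -/
def gordonPO (G : κ × ι → ℝ) (s : (ι → ℝ) × (κ → ℝ) × ℝ) (t : (κ → ℝ) × ℝ) : ℝ :=
  ∑ k, t.1 k * ∑ m, G (k, m) * s.1 m + (∑ k, s.2.1 k * t.1 k + s.2.2 + t.2)

/-- The decoupled form in Gordon's inequality. -/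
def gordonAO (p : (κ → ℝ) × (ι → ℝ)) (s : (ι → ℝ) × (κ → ℝ) × ℝ) (t : (κ → ℝ) × ℝ) : ℝ :=
  l2 s.1 * ∑ k, p.1 k * t.1 k + l2 t.1 * ∑ m, p.2 m * s.1 m
    + (∑ k, s.2.1 k * t.1 k + s.2.2 + t.2)

theorem continuous_l2 : Continuous (l2 : (ι → ℝ) → ℝ) := by unfold l2; fun_prop

theorem continuous_gordonPO : Continuous fun p : (κ × ι → ℝ) × ((ι → ℝ) × (κ → ℝ) × ℝ) × ((κ → ℝ) × ℝ) =>
    gordonPO p.1 p.2.1 p.2.2 := by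
  unfold gordonPO; fun_prop

theorem continuous_gordonAO :
    Continuous fun p : ((κ → ℝ) × (ι → ℝ)) × ((κ → ℝ) × ℝ) × ((ι → ℝ) × (κ → ℝ) × ℝ) =>
    gordonAO p.1 p.2.2 p.2.1 := by
  unfold gordonAO
  have := continuous_l2 (ι := ι)
  have := continuous_l2 (ι := κ)
  fun_prop

/-- Gordon's inequality for bounded sets of parameters. -/
theorem gordon_bounded (S : Set ((ι → ℝ) × (κ → ℝ) × ℝ)) (T : Set ((κ → ℝ) × ℝ))
    (hS : Bornology.IsBounded S) (hT : Bornology.IsBounded T) (E : Set ((κ → ℝ) × (ι → ℝ)))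
    {r : ℝ} (hr : 0 < r) (hE : ∀ p ∈ E, ∀ s ∈ S, ∃ t ∈ T, r ≤ gordonAO p s t) :
    gpi (κ × ι) {G | ∃ s ∈ S, ∀ t ∈ T, gordonPO G s t ≤ 0} ≤
      2 * ((gpi κ).prod (gpi ι)) Eᶜ := by
  set μ := (gpi κ).prod (gpi ι) with hμ
  set Q : ℕ → Set (κ × ι → ℝ) := fun K => Metric.closedBall 0 K
  set R : ℕ → Set ((κ → ℝ) × (ι → ℝ)) := fun K => Metric.closedBall 0 K
  have hR : Filter.Tendsto (fun K => 2 * (μ Eᶜ + μ (R K)ᶜ)) Filter.atTop (nhds (2 * μ Eᶜ)) := by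
    have h1 : Filter.Tendsto (fun K => μ (R K)ᶜ) Filter.atTop (nhds (μ (⋂ K, (R K)ᶜ))) := by
      refine tendsto_measure_iInter_atTop
        (fun K => Metric.isClosed_closedBall.measurableSet.compl.nullMeasurableSet) ?_
        ⟨0, measure_ne_top _ _⟩
      intro K L hKL
      exact Set.compl_subset_compl.2 (Metric.closedBall_subset_closedBall (by exact_mod_cast hKL))
    have h2 : ⋂ K, (R K)ᶜ = ∅ := by
      rw [← Set.compl_iUnion, Set.compl_empty_iff, Metric.iUnion_closedBall_nat]
    rw [h2, measure_empty] at h1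
    have h3 := ENNReal.Tendsto.const_mul (a := 2) (h1.const_add (μ Eᶜ)) (Or.inr (by simp))
    simpa using h3
  have hQ : {G : κ × ι → ℝ | ∃ s ∈ S, ∀ t ∈ T, gordonPO G s t ≤ 0} =
      ⋃ K, {G | G ∈ Q K ∧ ∃ s ∈ S, ∀ t ∈ T, gordonPO G s t ≤ 0} := by
    ext G
    simp only [Set.mem_ofPred_eq, Set.mem_iUnion]
    constructor
    · intro h
      have : G ∈ ⋃ K : ℕ, Metric.closedBall (0 : κ × ι → ℝ) K := by
        rw [Metric.iUnion_closedBall_nat]; trivial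
      obtain ⟨K, hK⟩ := Set.mem_iUnion.1 this
      exact ⟨K, hK, h⟩
    · rintro ⟨K, _, h⟩; exact h
  have hmono : Monotone fun K : ℕ =>
      {G : κ × ι → ℝ | G ∈ Q K ∧ ∃ s ∈ S, ∀ t ∈ T, gordonPO G s t ≤ 0} := by
    intro K L hKL G hG
    exact ⟨Metric.closedBall_subset_closedBall (by exact_mod_cast hKL) hG.1, hG.2⟩
  have hlim := tendsto_measure_iUnion_atTop (μ := gpi (κ × ι)) hmono
  rw [← hQ] at hlim
  refine le_of_tendsto_of_tendsto' hlim hR fun K => ?_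
  obtain ⟨S₀, hS₀, hSnet⟩ := exists_finite_net (continuous_gordonPO (ι := ι) (κ := κ))
    (isCompact_closedBall (0 : κ × ι → ℝ) K) hS hT (r := r / 4) (by linarith)
  obtain ⟨T₀, hT₀, hTnet⟩ := exists_finite_net (F := fun p t s => gordonAO p s t)
    (continuous_gordonAO (ι := ι) (κ := κ))
    (isCompact_closedBall (0 : (κ → ℝ) × (ι → ℝ)) K) hT hS (r := r / 4) (by linarith)
  have key := gordon_finite (I := S₀) (J := T₀) (fun s => s.1.1) (fun t => t.1.1)
    (fun s t => ∑ k, s.1.2.1 k * t.1.1 k + s.1.2.2 + t.1.2 - r / 4) (s := r / 2) (by linarith)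
  refine le_trans (measure_mono ?_) (key.trans ?_)
  · rintro G ⟨hG, s, hs, h⟩
    obtain ⟨s', hs', hnet⟩ := hSnet G hG s hs
    refine ⟨⟨s', hs'⟩, fun t => ?_⟩
    have h1 := hnet t.1 (hT₀ _ t.2)
    have h2 := h t.1 (hT₀ _ t.2)
    have h3 := (abs_le.1 h1).1
    have h4 : gordonPO G s' t.1 ≤ r / 4 := by linarith
    unfold gordonPO at h4
    linarith
  · refine mul_le_mul_right ((measure_mono ?_).trans (measure_union_le _ _)) 2
    rintro p ⟨s, h⟩
    by_contra hp
    rw [Set.mem_union, not_or, Set.mem_compl_iff, not_not, Set.mem_compl_iff, not_not] at hp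
    obtain ⟨t, ht, hst⟩ := hE p hp.1 s.1 (hS₀ _ s.2)
    obtain ⟨t', ht', hnet⟩ := hTnet p hp.2 t ht
    have h1 := (abs_le.1 (hnet s.1 (hS₀ _ s.2))).2
    have h2 := h ⟨t', ht'⟩
    have h3 : 3 * r / 4 ≤ gordonAO p s.1 t' := by linarith
    unfold gordonAO at h3
    linarith

end

theorem exp_le_one_add_add_sq_mul_exp (y : ℝ) :
    Real.exp y ≤ 1 + y + y ^ 2 * Real.exp |y| := by
  have h := Complex.norm_exp_sub_sum_le_norm_mul_exp y 2
  simp only [Finset.sum_range_succ, Finset.sum_range_zero, pow_zero, Nat.factorial_zero,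
    Nat.cast_one, div_one, zero_add, pow_one, Nat.factorial_one, Complex.norm_real] at h
  have h2 : Complex.exp (y : ℂ) - (1 + (y : ℂ)) = ((Real.exp y - (1 + y) : ℝ) : ℂ) := by
    push_cast; rfl
  rw [h2, Complex.norm_real, Real.norm_eq_abs, Real.norm_eq_abs, sq_abs] at h
  linarith [(abs_le.1 h).2]

theorem integrable_exp_mul_sq_stdG {a : ℝ} (ha : a < 1 / 2) :
    Integrable (fun x : ℝ => Real.exp (a * x ^ 2)) stdG := by
  rw [integrable_stdG_iff]
  have := (integrable_exp_neg_mul_sq (b := 1 / 2 - a) (by linarith)).const_mul ((√(2 * Real.pi))⁻¹)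
  refine this.congr (Filter.Eventually.of_forall fun x => ?_)
  simp only [gaussianPDFReal_std]
  rw [mul_assoc, ← Real.exp_add]
  congr 2; ring

theorem integrable_sq_stdG : Integrable (fun x : ℝ => x ^ 2) stdG := integrable_pow_stdG 2

theorem integral_sq_stdG : ∫ x, x ^ 2 ∂stdG = 1 := by
  have h := variance_id_gaussianReal (μ := 0) (v := 1)
  rw [variance_of_integral_eq_zero (by fun_prop) (by simp)] at h
  simpa [stdG] using h

theorem integrable_stdG_of_abs_le {f : ℝ → ℝ} (hf : Measurable f) {K : ℝ}
    (hb : ∀ x, |f x| ≤ K * (1 + x ^ 2)) : Integrable f stdG :=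
  Integrable.mono' (((integrable_const 1).add integrable_sq_stdG).const_mul K)
    hf.aestronglyMeasurable (Filter.Eventually.of_forall hb)

theorem integral_one_add_sq_stdG (K : ℝ) : Integrable (fun x : ℝ => K * (1 + x ^ 2)) stdG ∧
    ∫ x, K * (1 + x ^ 2) ∂stdG = 2 * K := by
  refine ⟨((integrable_const 1).add integrable_sq_stdG).const_mul K, ?_⟩
  rw [integral_const_mul, integral_add (integrable_const _) integrable_sq_stdG, integral_sq_stdG]
  simp; ring

theorem abs_integral_stdG_le {f : ℝ → ℝ} {K : ℝ}
    (hb : ∀ x, |f x| ≤ K * (1 + x ^ 2)) : |∫ x, f x ∂stdG| ≤ 2 * K := by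
  rw [← (integral_one_add_sq_stdG K).2]
  exact norm_integral_le_of_norm_le (f := f) (integral_one_add_sq_stdG K).1
    (Filter.Eventually.of_forall hb)

theorem bernstein_upper {K : ℝ} (hK : 0 < K) : ∃ c : ℝ, 0 < c ∧
    ∀ {ι : Type} [Fintype ι] (f : ι → ℝ → ℝ), (∀ j, Measurable (f j)) →
    (∀ j x, |f j x| ≤ K * (1 + x ^ 2)) → ∀ δ ∈ Set.Ioc (0 : ℝ) 1,
    (gpi ι).real {h | δ * Fintype.card ι ≤ ∑ j, (f j (h j) - ∫ x, f j x ∂stdG)} ≤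
      Real.exp (-(c * Fintype.card ι * δ ^ 2)) := by
  set t₀ : ℝ := 1 / (8 * K) with ht₀
  have ht₀pos : 0 < t₀ := by positivity
  set M : ℝ := 128 * K ^ 2 * ∫ x, Real.exp ((3 + x ^ 2) / 4) ∂stdG with hM
  have h_int : Integrable (fun x : ℝ => Real.exp ((3 + x ^ 2) / 4)) stdG := by
    refine ((integrable_exp_mul_sq_stdG (a := 1 / 4) (by norm_num)).const_mul
      (Real.exp (3 / 4))).congr (Filter.Eventually.of_forall fun x => ?_)
    simp only
    rw [← Real.exp_add]; congr 1; ring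
  have hMpos : 0 < M := by
    have : 1 ≤ ∫ x, Real.exp ((3 + x ^ 2) / 4) ∂stdG := by
      have h := integral_mono (integrable_const (1 : ℝ)) h_int fun x => Real.one_le_exp (by positivity)
      simpa using h
    positivity
  set t₁ : ℝ := min t₀ (1 / (2 * M)) with ht₁
  have ht₁pos : 0 < t₁ := lt_min ht₀pos (by positivity)
  refine ⟨t₁ / 2, by positivity, fun {ι} _ f hf hb δ hδ => ?_⟩
  set Y : ι → ℝ → ℝ := fun j x => f j x - ∫ x, f j x ∂stdG with hY
  have hYm : ∀ j, Measurable (Y j) := fun j => (hf j).sub_const _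
  have hfi : ∀ j, Integrable (f j) stdG := fun j => integrable_stdG_of_abs_le (hf j) (hb j)
  have hYi : ∀ j, Integrable (Y j) stdG := fun j => (hfi j).sub (integrable_const _)
  have hY0 : ∀ j, ∫ x, Y j x ∂stdG = 0 := fun j => by
    simp only [hY]
    rw [integral_sub (hfi j) (integrable_const _)]; simp
  have hYb : ∀ j x, |Y j x| ≤ K * (3 + x ^ 2) := fun j x => by
    have := (abs_sub (f j x) (∫ x, f j x ∂stdG)).trans
      (add_le_add (hb j x) (abs_integral_stdG_le (hb j)))
    linarith
  have hpt : ∀ t, 0 ≤ t → t ≤ t₀ → ∀ j x, Real.exp (t * Y j x) ≤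
      1 + t * Y j x + t ^ 2 * (128 * K ^ 2 * Real.exp ((3 + x ^ 2) / 4)) := by
    intro t ht htt j x
    refine (exp_le_one_add_add_sq_mul_exp _).trans ?_
    set u := (3 + x ^ 2) / 8 with hu
    have hu0 : 0 < u := by positivity
    have h1 : |Y j x| ≤ 8 * K * u := by rw [hu]; linarith [hYb j x]
    have h2 : |t * Y j x| ≤ u := by
      rw [abs_mul, abs_of_nonneg ht]
      calc t * |Y j x| ≤ t₀ * (8 * K * u) := mul_le_mul htt h1 (abs_nonneg _) ht₀pos.le
        _ = u := by rw [ht₀]; field_simp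
    have h3 : u ^ 2 ≤ 2 * Real.exp u := by
      have := Real.quadratic_le_exp_of_nonneg hu0.le
      nlinarith
    have h4 : Real.exp ((3 + x ^ 2) / 4) = Real.exp u * Real.exp u := by
      rw [← Real.exp_add]; congr 1; rw [hu]; ring
    have h5 : (t * Y j x) ^ 2 ≤ t ^ 2 * ((8 * K) ^ 2 * (2 * Real.exp u)) := by
      rw [mul_pow]
      refine mul_le_mul_of_nonneg_left ?_ (sq_nonneg t)
      calc Y j x ^ 2 = |Y j x| ^ 2 := (sq_abs _).symm
        _ ≤ (8 * K * u) ^ 2 := pow_le_pow_left₀ (abs_nonneg _) h1 2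
        _ = (8 * K) ^ 2 * u ^ 2 := by ring
        _ ≤ _ := mul_le_mul_of_nonneg_left h3 (by positivity)
    have h6 : (t * Y j x) ^ 2 * Real.exp |t * Y j x| ≤
        t ^ 2 * ((8 * K) ^ 2 * (2 * Real.exp u)) * Real.exp u :=
      mul_le_mul h5 (Real.exp_le_exp.2 h2) (Real.exp_pos _).le (by positivity)
    rw [h4]
    linarith
  have hexpi : ∀ t, 0 ≤ t → t ≤ t₀ → ∀ j, Integrable (fun x => Real.exp (t * Y j x)) stdG := by
    intro t ht htt j
    refine Integrable.mono' (((integrable_const 1).add ((hYi j).const_mul t)).add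
      ((h_int.const_mul (128 * K ^ 2)).const_mul (t ^ 2)))
      (Real.measurable_exp.comp ((hYm j).const_mul t)).aestronglyMeasurable
      (Filter.Eventually.of_forall fun x => ?_)
    rw [Real.norm_eq_abs, abs_of_pos (Real.exp_pos _)]
    exact hpt t ht htt j x
  have hexp : ∀ t, 0 ≤ t → t ≤ t₀ → ∀ j, ∫ x, Real.exp (t * Y j x) ∂stdG ≤ Real.exp (M * t ^ 2) := by
    intro t ht htt j
    have i1 : Integrable (fun x => 1 + t * Y j x) stdG := (integrable_const 1).add ((hYi j).const_mul t)
    have i2 : Integrable (fun x => t ^ 2 * (128 * K ^ 2 * Real.exp ((3 + x ^ 2) / 4))) stdG :=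
      (h_int.const_mul (128 * K ^ 2)).const_mul (t ^ 2)
    refine (integral_mono (hexpi t ht htt j) (i1.add i2) (hpt t ht htt j)).trans ?_
    simp only [Pi.add_apply]
    rw [integral_add i1 i2, integral_add (integrable_const _) ((hYi j).const_mul t),
      integral_const_mul, hY0, integral_const_mul, integral_const_mul]
    have := Real.add_one_le_exp (M * t ^ 2)
    simp only [integral_const, probReal_univ, smul_eq_mul]
    linarith
  set t := t₁ * δ with ht
  have htpos : 0 ≤ t := mul_nonneg ht₁pos.le hδ.1.le
  have htt : t ≤ t₀ := by
    have : t₁ * δ ≤ t₁ * 1 := mul_le_mul_of_nonneg_left hδ.2 ht₁pos.le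
    linarith [min_le_left t₀ (1 / (2 * M))]
  have hprod : ∀ h : ι → ℝ, Real.exp (t * ∑ j, Y j (h j)) = ∏ j, Real.exp (t * Y j (h j)) := by
    intro h; rw [Finset.mul_sum, Real.exp_sum]
  have hI : Integrable (fun h : ι → ℝ => Real.exp (t * ∑ j, Y j (h j))) (gpi ι) := by
    simp_rw [hprod]
    exact Integrable.fintype_prod (f := fun j x => Real.exp (t * Y j x)) fun j => hexpi t htpos htt j
  have hmgf : mgf (fun h : ι → ℝ => ∑ j, Y j (h j)) (gpi ι) t ≤
      Real.exp (M * t ^ 2 * Fintype.card ι) := by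
    unfold mgf
    simp_rw [hprod]
    rw [gpi, integral_fintype_prod_eq_prod (f := fun j x => Real.exp (t * Y j x))]
    refine (Finset.prod_le_prod (fun j _ => integral_nonneg fun x => (Real.exp_pos _).le)
      fun j _ => hexp t htpos htt j).trans (le_of_eq ?_)
    rw [Finset.prod_const, Finset.card_univ, ← Real.exp_nat_mul]
    congr 1; ring
  refine (measure_ge_le_exp_mul_mgf (X := fun h : ι → ℝ => ∑ j, Y j (h j)) _ htpos hI).trans ?_
  refine (mul_le_mul_of_nonneg_left hmgf (Real.exp_pos _).le).trans ?_
  rw [← Real.exp_add]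
  refine Real.exp_le_exp.2 ?_
  have h1 : M * t₁ ≤ 1 / 2 := by
    calc M * t₁ ≤ M * (1 / (2 * M)) := mul_le_mul_of_nonneg_left (min_le_right _ _) hMpos.le
      _ = 1 / 2 := by field_simp
  have h2 : 0 ≤ t₁ * δ ^ 2 * Fintype.card ι := by positivity
  have h3 := mul_le_mul_of_nonneg_right h1 h2
  rw [ht]
  linarith

/-- Bernstein's inequality for sums of functions of independent standard Gaussians with at most
quadratic growth. -/
theorem bernstein_stdG {K : ℝ} (hK : 0 < K) : ∃ c : ℝ, 0 < c ∧
    ∀ {ι : Type} [Fintype ι] (f : ι → ℝ → ℝ), (∀ j, Measurable (f j)) →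
    (∀ j x, |f j x| ≤ K * (1 + x ^ 2)) → ∀ δ ∈ Set.Ioc (0 : ℝ) 1,
    gpi ι {h | δ * Fintype.card ι ≤ |∑ j, (f j (h j) - ∫ x, f j x ∂stdG)|} ≤
      ENNReal.ofReal (2 * Real.exp (-(c * Fintype.card ι * δ ^ 2))) := by
  obtain ⟨c, hc, H⟩ := bernstein_upper hK
  refine ⟨c, hc, fun {ι} _ f hf hb δ hδ => ?_⟩
  have h1 := H f hf hb δ hδ
  have h2 := H (fun j x => -f j x) (fun j => (hf j).neg) (fun j x => by simpa using hb j x) δ hδ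
  have hsub : {h : ι → ℝ | δ * Fintype.card ι ≤ |∑ j, (f j (h j) - ∫ x, f j x ∂stdG)|} ⊆
      {h | δ * Fintype.card ι ≤ ∑ j, (f j (h j) - ∫ x, f j x ∂stdG)} ∪
      {h | δ * Fintype.card ι ≤ ∑ j, (-f j (h j) - ∫ x, -f j x ∂stdG)} := by
    intro h hh
    rcases le_abs'.1 (Set.mem_ofPred_eq ▸ hh : δ * Fintype.card ι ≤ |_|) with h3 | h3
    · refine Or.inr ?_
      simp only [Set.mem_ofPred_eq, integral_neg, Finset.sum_sub_distrib, Finset.sum_neg_distrib]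
        at h3 ⊢
      linarith
    · exact Or.inl h3
  have h4 := (measureReal_mono (μ := gpi ι) hsub).trans (measureReal_union_le _ _)
  rw [← ofReal_measureReal]
  exact ENNReal.ofReal_le_ofReal (by linarith)

/-- The mean squared soft-thresholded value of a standard Gaussian. -/
def tailMoment (α : ℝ) : ℝ := ∫ x, (max (|x| - α) 0) ^ 2 ∂stdG

theorem max_abs_sub_sq_le {α : ℝ} (hα : 0 ≤ α) (x : ℝ) : (max (|x| - α) 0) ^ 2 ≤ x ^ 2 := by
  rw [← sq_abs x]
  exact pow_le_pow_left₀ (le_max_right _ _) (max_le (by linarith) (abs_nonneg x)) 2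

theorem integrable_tail {α : ℝ} (hα : 0 ≤ α) :
    Integrable (fun x : ℝ => (max (|x| - α) 0) ^ 2) stdG := by
  refine integrable_sq_stdG.mono' (by fun_prop) (Filter.Eventually.of_forall fun x => ?_)
  rw [Real.norm_eq_abs, abs_of_nonneg (sq_nonneg _)]
  exact max_abs_sub_sq_le hα x

theorem tailMoment_nonneg (α : ℝ) : 0 ≤ tailMoment α := integral_nonneg fun _ => sq_nonneg _

theorem tailMoment_le_one {α : ℝ} (hα : 0 ≤ α) : tailMoment α ≤ 1 := by
  rw [← integral_sq_stdG]
  exact integral_mono (integrable_tail hα) integrable_sq_stdG (max_abs_sub_sq_le hα)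

theorem exists_tailMoment_lt {r : ℝ} (hr : 0 < r) : ∃ α : ℝ, 0 < α ∧ tailMoment α < r := by
  set K := ∫ x, x ^ 4 ∂stdG with hK
  have hK0 : 0 ≤ K := integral_nonneg fun x => by positivity
  set α := √((K + 1) / r) with hα
  have hα0 : 0 < α := Real.sqrt_pos.2 (by positivity)
  have hα2 : α ^ 2 = (K + 1) / r := Real.sq_sqrt (by positivity)
  refine ⟨α, hα0, ?_⟩
  have h : tailMoment α ≤ ∫ x, (1 / α ^ 2) * x ^ 4 ∂stdG := by
    refine integral_mono (integrable_tail hα0.le) ((integrable_pow_stdG 4).const_mul _) fun x => ?_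
    simp only
    rcases le_total |x| α with hx | hx
    · rw [max_eq_right (by linarith), zero_pow two_ne_zero]; positivity
    · refine (max_abs_sub_sq_le hα0.le x).trans ?_
      have h1 : α ^ 2 ≤ x ^ 2 := by rw [← sq_abs x]; exact pow_le_pow_left₀ hα0.le hx 2
      rw [div_mul_eq_mul_div, one_mul, le_div_iff₀ (by positivity)]
      nlinarith [sq_nonneg x]
  rw [integral_const_mul, ← hK, hα2] at h
  refine h.trans_lt ?_
  rw [one_div_div, div_mul_eq_mul_div, div_lt_iff₀ (by positivity)]
  nlinarith

theorem gphi_eq (x : ℝ) : gphi x = gaussianPDFReal 0 1 x := by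
  rw [gaussianPDFReal_std, gphi, div_eq_inv_mul]

theorem hasDerivAt_gphi (x : ℝ) : HasDerivAt gphi (-x * gphi x) x := by
  have h : gphi = gaussianPDFReal 0 1 := funext gphi_eq
  rw [h]
  exact hasDerivAt_gaussianPDFReal_std x

theorem gphi_neg (x : ℝ) : gphi (-x) = gphi x := by simp [gphi]

theorem tailMoment_eq {α : ℝ} (hα : 0 ≤ α) :
    tailMoment α = 2 * ((1 + α ^ 2) * gPhi (-α) - α * gphi α) := by
  have h_int : ∀ k : ℕ, Integrable (fun x : ℝ => x ^ k * gphi x) := fun k => by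
    have := (integrable_stdG_iff (f := fun x : ℝ => x ^ k)).1 (integrable_pow_stdG k)
    refine this.congr (Filter.Eventually.of_forall fun x => ?_)
    simp only [gphi_eq]; ring
  have h0 : Integrable gphi := by simpa using h_int 0
  have h1 : Integrable (fun x : ℝ => x * gphi x) := by simpa using h_int 1
  have hPhi : gPhi (-α) = ∫ x in Set.Ioi α, gphi x := by
    unfold gPhi
    rw [← integral_comp_neg_Ioi]
    simp_rw [gphi_neg]
  have hFTC : ∫ x in Set.Ioi α, (x ^ 2 - 2 * α * x - 1) * gphi x = -(α * gphi α) := by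
    have hder : ∀ x ∈ Set.Ici α, HasDerivAt (fun x => -(x - 2 * α) * gphi x)
        ((x ^ 2 - 2 * α * x - 1) * gphi x) x := fun x _ => by
      have : HasDerivAt (fun y : ℝ => -(y - 2 * α)) (-1) x :=
        ((hasDerivAt_id x).sub_const _).neg
      exact (this.mul (hasDerivAt_gphi x)).congr_deriv (by ring)
    have hi : Integrable (fun x : ℝ => (x ^ 2 - 2 * α * x - 1) * gphi x) := by
      refine (((h_int 2).sub (h1.const_mul (2 * α))).sub h0).congr
        (Filter.Eventually.of_forall fun x => ?_)
      simp only [Pi.sub_apply]; ring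
    have hi2 : Integrable (fun x : ℝ => -(x - 2 * α) * gphi x) := by
      refine (((h0.const_mul (2 * α))).sub h1).congr
        (Filter.Eventually.of_forall fun x => ?_)
      simp only [Pi.sub_apply]; ring
    have ht := tendsto_zero_of_hasDerivAt_of_integrableOn_Ioi
      (fun x hx => hder x (Set.mem_Ici_of_Ioi hx)) hi.integrableOn hi2.integrableOn
    rw [integral_Ioi_of_hasDerivAt_of_tendsto' hder hi.integrableOn ht]
    ring
  have hhalf : ∫ x in Set.Ioi α, (x - α) ^ 2 * gphi x = (1 + α ^ 2) * gPhi (-α) - α * gphi α := by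
    have hi : Integrable (fun x : ℝ => (x ^ 2 - 2 * α * x - 1) * gphi x) := by
      refine (((h_int 2).sub (h1.const_mul (2 * α))).sub h0).congr
        (Filter.Eventually.of_forall fun x => ?_)
      simp only [Pi.sub_apply]; ring
    rw [hPhi, sub_eq_add_neg _ (α * _), ← hFTC, ← integral_const_mul, ← integral_add
      (h0.const_mul _).integrableOn hi.integrableOn]
    refine integral_congr_ae (Filter.Eventually.of_forall fun x => ?_)
    simp only; ring
  set F : ℝ → ℝ := fun x => (max (x - α) 0) ^ 2 * gphi x with hF
  have heven : tailMoment α = ∫ x : ℝ, F |x| := by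
    unfold tailMoment
    rw [integral_stdG]
    refine integral_congr_ae (Filter.Eventually.of_forall fun x => ?_)
    have : gphi |x| = gphi x := by simp [gphi]
    simp only [hF, this, ← gphi_eq]
    ring
  rw [heven, integral_comp_abs, ← hhalf]
  congr 1
  rw [setIntegral_eq_of_subset_of_forall_sdiff_eq_zero measurableSet_Ioi
    (Set.Ioi_subset_Ioi hα) (f := F) fun x hx => ?_]
  · refine setIntegral_congr_fun measurableSet_Ioi fun x hx => ?_
    simp only [hF]
    rw [max_eq_left (by linarith [Set.mem_Ioi.1 hx])]
  · have : x ≤ α := not_lt.1 hx.2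
    simp only [hF]
    rw [max_eq_right (by linarith)]; simp

/-- Every uniformity class satisfies a sparsity bound at some threshold, quantitatively below the
critical level. -/
theorem DFamSpec.exists_threshold {δ q : ℝ} (hδ : 0 < δ) {Dfam : (M : ℕ) → Set (Fin M → ℝ)}
    (hD : DFamSpec δ Dfam q) : ∃ α T s : ℝ, 0 < α ∧ 0 ≤ T ∧ 0 ≤ s ∧ s ≤ 1 ∧
      s * (1 + α ^ 2) + (1 - s) * tailMoment α < δ ∧
      ∀ N : ℕ, ∀ θ ∈ Dfam N,
        ((Finset.univ.filter fun j => T < |θ j|).card : ℝ) ≤ s * N := by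
  rcases hD with ⟨p, ξ, hp, hξ, hDf, -⟩ | ⟨s, hs0, hs, hDf, -⟩
  · obtain ⟨α, hα, hm⟩ := exists_tailMoment_lt (r := δ / 4) (by positivity)
    have hm0 := tailMoment_nonneg α
    set B := 4 * (1 + α ^ 2) / δ with hB
    have hBpos : 0 < B := by positivity
    set A := B ^ (1 / p) with hA
    have hApos : 0 < A := Real.rpow_pos_of_pos hBpos _
    have hAp : A ^ p = B := by rw [hA, ← Real.rpow_mul hBpos.le, one_div_mul_cancel hp.ne', Real.rpow_one]
    refine ⟨α, ξ * A, min 1 (1 / B), hα, by positivity, by positivity, min_le_left _ _, ?_, ?_⟩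
    · have h1 : min 1 (1 / B) * (1 + α ^ 2) ≤ δ / 4 := by
        calc min 1 (1 / B) * (1 + α ^ 2) ≤ 1 / B * (1 + α ^ 2) :=
              mul_le_mul_of_nonneg_right (min_le_right _ _) (by positivity)
          _ = δ / 4 := by rw [hB]; field_simp
      have h2 : 0 ≤ min 1 (1 / B) := by positivity
      nlinarith
    · intro N θ hθ
      rw [hDf] at hθ
      have hcard : ((Finset.univ.filter fun j => ξ * A < |θ j|).card : ℝ) ≤ N := by
        have := Finset.card_filter_le (Finset.univ : Finset (Fin N)) (fun j => ξ * A < |θ j|)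
        rw [Finset.card_univ, Fintype.card_fin] at this
        exact_mod_cast this
      rcases Nat.eq_zero_or_pos N with rfl | hN
      · simp
      have hN' : (0 : ℝ) < N := by exact_mod_cast hN
      have hsum : ∑ j, |θ j| ^ p ≤ N * ξ ^ p := by
        have : (1 / (N : ℝ)) * ∑ i, |θ i| ^ p ≤ ξ ^ p := hθ
        rw [one_div, inv_mul_le_iff₀ hN'] at this
        exact this
      have hmk : ((Finset.univ.filter fun j => ξ * A < |θ j|).card : ℝ) * (ξ ^ p * B) ≤ N * ξ ^ p := by
        refine le_trans ?_ hsum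
        rw [← nsmul_eq_mul]
        refine le_trans ?_ (Finset.sum_le_univ_sum_of_nonneg
          (s := Finset.univ.filter fun j => ξ * A < |θ j|) fun j => Real.rpow_nonneg (abs_nonneg _) p)
        refine Finset.card_nsmul_le_sum _ _ _ fun j hj => ?_
        rw [← hAp, ← Real.mul_rpow hξ.le hApos.le]
        exact Real.rpow_le_rpow (by positivity) (Finset.mem_filter.1 hj).2.le hp.le
      have hξp : 0 < ξ ^ p := Real.rpow_pos_of_pos hξ p
      have h3 : ((Finset.univ.filter fun j => ξ * A < |θ j|).card : ℝ) ≤ 1 / B * N := by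
        rw [div_mul_eq_mul_div, one_mul, le_div_iff₀ hBpos]
        nlinarith
      rcases le_total 1 (1 / B) with h | h
      · rw [min_eq_left h, one_mul]; exact hcard
      · rw [min_eq_right h]; exact h3
  · have h1 : s / δ < sSup ((fun α : ℝ =>
      (1 - (2 / δ) * ((1 + α ^ 2) * gPhi (-α) - α * gphi α)) /
      (1 + α ^ 2 - 2 * ((1 + α ^ 2) * gPhi (-α) - α * gphi α))) '' Set.Ici 0) := by
      rw [div_lt_iff₀ hδ, mul_comm]; exact hs
    obtain ⟨_, ⟨α, hα, rfl⟩, h2⟩ := exists_lt_of_lt_csSup (Set.nonempty_Ici.image _) h1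
    have hα0 : 0 ≤ α := hα
    simp only at h2
    have he := tailMoment_eq hα0
    have hm1 := tailMoment_le_one hα0
    have e1 : (2 / δ) * ((1 + α ^ 2) * gPhi (-α) - α * gphi α) = tailMoment α / δ := by
      rw [he]; ring
    rw [e1, ← he] at h2
    have hαpos : 0 < α := by
      refine lt_of_le_of_ne hα0 fun h0 => ?_
      have h3 : tailMoment α = 1 := by
        rw [← h0, tailMoment, ← integral_sq_stdG]
        simp
      rw [h3, ← h0] at h2
      norm_num at h2
      have := div_nonneg hs0 hδ.le
      linarith
    have hden : 0 < 1 + α ^ 2 - tailMoment α := by nlinarith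
    rw [lt_div_iff₀ hden] at h2
    have h3 : s * (1 + α ^ 2 - tailMoment α) < δ - tailMoment α := by
      have := mul_lt_mul_of_pos_left h2 hδ
      have e2 : δ * (s / δ * (1 + α ^ 2 - tailMoment α)) = s * (1 + α ^ 2 - tailMoment α) := by
        field_simp
      have e3 : δ * (1 - tailMoment α / δ) = δ - tailMoment α := by field_simp
      rwa [e2, e3] at this
    refine ⟨α, 0, min s 1, hαpos, le_rfl, by positivity, min_le_right _ _, ?_, ?_⟩
    · have := mul_le_mul_of_nonneg_right (min_le_left s 1) hden.le
      linarith
    · intro N θ hθ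
      rw [hDf] at hθ
      have h4 : (l0 θ : ℝ) ≤ s * N := hθ
      have h5 : (Finset.univ.filter fun j => 0 < |θ j|).card = l0 θ := by
        unfold l0; congr 1; ext j; simp
      have h6 : (l0 θ : ℝ) ≤ N := by
        have : l0 θ ≤ N := by simpa [l0] using Finset.card_filter_le (Finset.univ : Finset (Fin N)) (fun j => θ j ≠ 0)
        exact_mod_cast this
      rw [h5]
      rcases le_total s 1 with h | h
      · rwa [min_eq_left h]
      · rw [min_eq_right h, one_mul]; exact h6

/-- Projection onto the interval `[-1, 1]`. -/
def clip1 (y : ℝ) : ℝ := max (-1) (min 1 y)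

theorem continuous_clip1 : Continuous clip1 := by unfold clip1; fun_prop

theorem abs_clip1_le (y : ℝ) : |clip1 y| ≤ 1 :=
  abs_le.2 ⟨le_max_left _ _, max_le (by norm_num) (min_le_left _ _)⟩

theorem clip1_of_abs_le {y : ℝ} (h : |y| ≤ 1) : clip1 y = y := by
  rw [clip1, min_eq_right (abs_le.1 h).2, max_eq_right (abs_le.1 h).1]

theorem clip1_of_one_le {y : ℝ} (h : 1 ≤ y) : clip1 y = 1 := by
  rw [clip1, min_eq_left h]; norm_num

theorem clip1_of_le_neg_one {y : ℝ} (h : y ≤ -1) : clip1 y = -1 := by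
  rw [clip1, min_eq_right (by linarith), max_eq_left h]

theorem eta_eq {b : ℝ} (hb : 0 < b) (x : ℝ) : eta x b = x - b * clip1 (x / b) := by
  unfold eta
  rcases le_total |x| b with h | h
  · rw [max_eq_right (by linarith), clip1_of_abs_le (by rwa [abs_div, abs_of_pos hb, div_le_one hb])]
    field_simp; ring
  · rw [max_eq_left (by linarith)]
    rcases le_total 0 x with hx | hx
    · rw [abs_of_nonneg hx] at h ⊢
      rw [Real.sign_of_pos (by linarith), clip1_of_one_le (by rwa [one_le_div hb])]; ring
    · rw [abs_of_nonpos hx] at h ⊢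
      rw [Real.sign_of_neg (by linarith), clip1_of_le_neg_one
        (by rw [div_le_iff₀ hb]; linarith)]; ring

theorem clip1_mul_eta {b : ℝ} (hb : 0 < b) (x : ℝ) : clip1 (x / b) * eta x b = |eta x b| := by
  rw [eta_eq hb]
  rcases le_total |x| b with h | h
  · rw [clip1_of_abs_le (by rwa [abs_div, abs_of_pos hb, div_le_one hb])]
    have : x - b * (x / b) = 0 := by field_simp; ring
    rw [this]; simp
  · rcases le_total 0 x with hx | hx
    · rw [abs_of_nonneg hx] at h
      rw [clip1_of_one_le (by rwa [one_le_div hb]), abs_of_nonneg (by linarith)]; ring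
    · rw [abs_of_nonpos hx] at h
      rw [clip1_of_le_neg_one (by rw [div_le_iff₀ hb]; linarith), abs_of_nonpos (by linarith)]; ring

/-- The error of the scalar soft-thresholding estimator. -/
def evoErr (t τ b x : ℝ) : ℝ := eta (t + τ * x) b - t

/-- The subgradient attached to the scalar soft-thresholding estimator. -/
def evoSub (t τ b x : ℝ) : ℝ := clip1 ((t + τ * x) / b)

section scalar

variable {t τ b : ℝ}

theorem evoErr_eq (hb : 0 < b) (x : ℝ) : evoErr t τ b x = τ * x - b * evoSub t τ b x := by
  rw [evoErr, eta_eq hb, evoSub]; ring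

theorem abs_evoSub_le (x : ℝ) : |evoSub t τ b x| ≤ 1 := abs_clip1_le _

theorem continuous_evoSub : Continuous (evoSub t τ b) :=
  continuous_clip1.comp (by fun_prop)

theorem continuous_evoErr (hb : 0 < b) : Continuous (evoErr t τ b) := by
  have h : evoErr t τ b = fun x => τ * x - b * evoSub t τ b x := funext fun x => evoErr_eq hb x
  have := continuous_evoSub (t := t) (τ := τ) (b := b)
  rw [h]; fun_prop

theorem evoSub_mul (hb : 0 < b) (x : ℝ) :
    evoSub t τ b x * (t + evoErr t τ b x) = |t + evoErr t τ b x| := by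
  have := clip1_mul_eta hb (t + τ * x)
  rw [evoErr, evoSub, add_sub_cancel]; exact this

theorem abs_evoErr_le (hb : 0 < b) (hτ : 0 < τ) (x : ℝ) : |evoErr t τ b x| ≤ τ * |x| + b := by
  rw [evoErr_eq hb]
  refine (abs_sub _ _).trans ?_
  rw [abs_mul, abs_mul, abs_of_pos hb, abs_of_pos hτ]
  have := mul_le_mul_of_nonneg_left (abs_evoSub_le (t := t) (τ := τ) (b := b) x) hb.le
  linarith

theorem abs_evoErr_sq_le (hb : 0 < b) (hτ : 0 < τ) (x : ℝ) :
    |evoErr t τ b x ^ 2| ≤ (2 * (τ ^ 2 + b ^ 2)) * (1 + x ^ 2) := by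
  rw [abs_pow]
  have h := pow_le_pow_left₀ (abs_nonneg _) (abs_evoErr_le (t := t) hb hτ x) 2
  have : |x| ^ 2 = x ^ 2 := sq_abs x
  nlinarith [sq_nonneg (τ * |x| - b), sq_nonneg (b * x)]

theorem abs_mul_evoErr_le (hb : 0 < b) (hτ : 0 < τ) (x : ℝ) :
    |x * evoErr t τ b x| ≤ (τ + b) * (1 + x ^ 2) := by
  rw [abs_mul]
  have h := mul_le_mul_of_nonneg_left (abs_evoErr_le (t := t) hb hτ x) (abs_nonneg x)
  have : |x| ^ 2 = x ^ 2 := sq_abs x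
  nlinarith [sq_nonneg (|x| - 1), abs_nonneg x]

/-- Increment of the absolute value along the estimator. -/
theorem abs_abs_add_evoErr_sub_le (hb : 0 < b) (hτ : 0 < τ) (x : ℝ) :
    |(|t + evoErr t τ b x| - |t|)| ≤ (τ + b) * (1 + x ^ 2) := by
  refine (abs_abs_sub_abs_le _ _).trans ?_
  rw [add_sub_cancel_left]
  refine (abs_evoErr_le hb hτ x).trans ?_
  have : |x| ^ 2 = x ^ 2 := sq_abs x
  nlinarith [sq_nonneg (|x| - 1), abs_nonneg x, mul_nonneg hτ.le (sq_nonneg (|x|-1)), mul_nonneg hb.le (sq_nonneg x), mul_nonneg hτ.le (sq_nonneg x)]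

end scalar

theorem tendsto_gphi_atTop : Filter.Tendsto gphi Filter.atTop (nhds 0) := by
  have h_int : ∀ k : ℕ, Integrable (fun x : ℝ => x ^ k * gphi x) := fun k => by
    have := (integrable_stdG_iff (f := fun x : ℝ => x ^ k)).1 (integrable_pow_stdG k)
    refine this.congr (Filter.Eventually.of_forall fun x => ?_)
    simp only [gphi_eq]; ring
  have h0 : Integrable gphi := by simpa using h_int 0
  have h1 : Integrable (fun x : ℝ => -x * gphi x) := by simpa using (h_int 1).neg
  exact tendsto_zero_of_hasDerivAt_of_integrableOn_Ioi (a := 0) (fun x _ => hasDerivAt_gphi x)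
    h1.integrableOn h0.integrableOn

/-- Gaussian integration by parts for functions differentiable off a countable set. -/
theorem integral_id_mul_stdG_of_countable {f f' : ℝ → ℝ} {C : ℝ} {s : Set ℝ} (hs : s.Countable)
    (hfc : Continuous f) (hfm : Measurable f') (hd : ∀ x ∉ s, HasDerivAt f (f' x) x)
    (hf : ∀ x, |f x| ≤ C) (hf' : ∀ x, |f' x| ≤ C) :
    ∫ x, x * f x ∂stdG = ∫ x, f' x ∂stdG := by
  have i1 : Integrable (fun x => x * f x) stdG :=
    integrable_id_stdG.mul_bdd (c := C) hfc.aestronglyMeasurable (Filter.Eventually.of_forall hf)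
  have i2 : Integrable f' stdG :=
    Integrable.of_bound hfm.aestronglyMeasurable C (Filter.Eventually.of_forall hf')
  have j1 := (integrable_stdG_iff _).1 i1
  have j2 := (integrable_stdG_iff _).1 i2
  rw [integral_stdG, integral_stdG]
  simp_rw [← gphi_eq] at j1 j2 ⊢
  have hgc : Continuous gphi := continuous_iff_continuousAt.2 fun x => (hasDerivAt_gphi x).continuousAt
  have key : ∀ R : ℝ, ∫ x in (-R)..R, (gphi x * f' x - gphi x * (x * f x)) =
      gphi R * f R - gphi (-R) * f (-R) := fun R =>
    integral_eq_of_hasDerivAt_off_countable (fun x => gphi x * f x) _ hs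
      (hgc.mul hfc).continuousOn
      (fun x hx => ((hasDerivAt_gphi x).mul (hd x hx.2)).congr_deriv (by ring))
      (j2.sub j1).intervalIntegrable
  have l1 := intervalIntegral_tendsto_integral (j2.sub j1) Filter.tendsto_neg_atTop_atBot
    Filter.tendsto_id
  simp only [id, Pi.sub_apply] at l1
  simp_rw [key] at l1
  have l2 : Filter.Tendsto (fun R => gphi R * f R - gphi (-R) * f (-R)) Filter.atTop (nhds 0) := by
    have hb : Filter.Tendsto (fun R => gphi R * (2 * C)) Filter.atTop (nhds 0) := by
      simpa using tendsto_gphi_atTop.mul_const (2 * C)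
    refine squeeze_zero_norm (fun R => ?_) hb
    have h0 : 0 ≤ gphi R := by rw [gphi_eq]; exact gaussianPDFReal_nonneg _ _ _
    rw [gphi_neg, ← mul_sub, norm_mul, Real.norm_eq_abs, abs_of_nonneg h0]
    refine mul_le_mul_of_nonneg_left ((abs_sub _ _).trans ?_) h0
    linarith [hf R, hf (-R)]
  have := tendsto_nhds_unique l1 l2
  rw [integral_sub j2 j1] at this
  linarith

theorem measurable_eta' (t τ b : ℝ) : Measurable fun x => eta' (t + τ * x) b := by
  unfold eta'
  exact Measurable.ite (measurableSet_lt measurable_const (by fun_prop)) measurable_const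
    measurable_const

theorem hasDerivAt_evoSub {t τ b x : ℝ} (hb : 0 < b) (h : |t + τ * x| ≠ b) :
    HasDerivAt (evoSub t τ b) (τ / b * (1 - eta' (t + τ * x) b)) x := by
  have hc : ContinuousAt (fun y => t + τ * y) x := by fun_prop
  have hlin : HasDerivAt (fun y => (t + τ * y) / b) (τ / b) x := by
    simpa using (((hasDerivAt_id x).const_mul τ).const_add t).div_const b
  rcases lt_or_gt_of_ne h with h1 | h1
  · have he : evoSub t τ b =ᶠ[nhds x] fun y => (t + τ * y) / b := by
      filter_upwards [hc.abs.eventually_lt_const h1] with y hy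
      exact clip1_of_abs_le (by rw [abs_div, abs_of_pos hb, div_le_one hb]; exact hy.le)
    simpa [eta', not_lt.2 h1.le] using hlin.congr_of_eventuallyEq he
  · have h2 : τ / b * (1 - eta' (t + τ * x) b) = 0 := by simp [eta', h1]
    rw [h2]
    rcases lt_abs.1 h1 with h3 | h3
    · have he : evoSub t τ b =ᶠ[nhds x] fun _ => 1 := by
        filter_upwards [hc.eventually_const_lt h3] with y hy
        exact clip1_of_one_le (by rw [one_le_div hb]; exact hy.le)
      exact (hasDerivAt_const x _).congr_of_eventuallyEq he
    · have he : evoSub t τ b =ᶠ[nhds x] fun _ => -1 := by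
        filter_upwards [hc.eventually_lt_const (lt_neg.1 h3)] with y hy
        exact clip1_of_le_neg_one (by rw [div_le_iff₀ hb]; linarith)
      exact (hasDerivAt_const x _).congr_of_eventuallyEq he

theorem eta'_mem (x b : ℝ) : 0 ≤ eta' x b ∧ eta' x b ≤ 1 := by
  unfold eta'; split_ifs <;> norm_num

theorem integrable_eta' (t τ b : ℝ) : Integrable (fun x => eta' (t + τ * x) b) stdG :=
  Integrable.of_bound (measurable_eta' t τ b).aestronglyMeasurable 1
    (Filter.Eventually.of_forall fun x => by
      rw [Real.norm_eq_abs, abs_of_nonneg (eta'_mem _ _).1]; exact (eta'_mem _ _).2)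

theorem integral_id_mul_evoErr {t τ b : ℝ} (hb : 0 < b) (hτ : 0 < τ) :
    ∫ x, x * evoErr t τ b x ∂stdG = τ * ∫ x, eta' (t + τ * x) b ∂stdG := by
  have hs : ({(b - t) / τ, (-b - t) / τ} : Set ℝ).Countable := by simp
  have hT := integral_id_mul_stdG_of_countable (f := evoSub t τ b) (C := 1 + τ / b) hs
    continuous_evoSub (((measurable_eta' t τ b).const_sub 1).const_mul (τ / b)) (fun x hx => ?_)
    (fun x => (abs_evoSub_le x).trans (by linarith [div_pos hτ hb])) (fun x => ?_)
  · have i1 : Integrable (fun x => x * evoSub t τ b x) stdG :=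
      integrable_id_stdG.mul_bdd (c := 1) continuous_evoSub.aestronglyMeasurable
        (Filter.Eventually.of_forall abs_evoSub_le)
    have e : ∀ x, x * evoErr t τ b x = τ * x ^ 2 - b * (x * evoSub t τ b x) := fun x => by
      rw [evoErr_eq hb]; ring
    simp_rw [e]
    rw [integral_sub (integrable_sq_stdG.const_mul τ) (i1.const_mul b), integral_const_mul,
      integral_const_mul, integral_sq_stdG, hT, integral_const_mul,
      integral_sub (integrable_const _) (integrable_eta' t τ b)]
    simp; field_simp; ring
  · refine hasDerivAt_evoSub hb fun h => hx ?_
    rcases (abs_eq hb.le).1 h with h1 | h1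
    · left; field_simp; linarith
    · right; rw [Set.mem_singleton_iff]; field_simp; linarith
  · have := eta'_mem (t + τ * x) b
    rw [abs_mul, abs_of_pos (div_pos hτ hb), abs_of_nonneg (by linarith)]
    nlinarith [div_pos hτ hb]

theorem isProbabilityMeasure_empDist {N : ℕ} (hN : 0 < N) (θ : Fin N → ℝ) :
    IsProbabilityMeasure (empDist θ) := ⟨by
  simp only [empDist, Measure.smul_apply, Measure.finsetSum_apply, measure_univ, Finset.sum_const,
    Finset.card_univ, Fintype.card_fin, nsmul_eq_mul, mul_one, smul_eq_mul]
  exact ENNReal.inv_mul_cancel (by exact_mod_cast hN.ne') (ENNReal.natCast_ne_top N)⟩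

theorem integral_empDist_prod_stdG {N : ℕ} (hN : 0 < N) (θ : Fin N → ℝ) {f : ℝ × ℝ → ℝ}
    (hf : Measurable f) {K : ℝ} (hb : ∀ q, |f q| ≤ K * (1 + q.2 ^ 2)) :
    ∫ q, f q ∂((empDist θ).prod stdG) = (1 / (N : ℝ)) * ∑ j, ∫ x, f (θ j, x) ∂stdG := by
  have := isProbabilityMeasure_empDist hN θ
  have hi : Integrable f ((empDist θ).prod stdG) :=
    ((integral_one_add_sq_stdG K).1.comp_snd (empDist θ)).mono' hf.aestronglyMeasurable
      (Filter.Eventually.of_forall hb)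
  rw [integral_prod _ hi, empDist, integral_smul_measure, integral_finsetSum_measure]
  · simp only [integral_dirac, ENNReal.toReal_inv, ENNReal.toReal_natCast, smul_eq_mul, one_div]
  · intro j _
    exact integrable_dirac (by simp)

/-- The state evolution fixed point, written as sums over the coordinates. -/
structure EvoSys (n : ℝ) {N : ℕ} (σ lam β τ : ℝ) (θ : Fin N → ℝ) : Prop where
  β_pos : 0 < β
  τ_pos : 0 < τ
  sum_sq : ∑ j, ∫ x, evoErr (θ j) τ (τ * lam / β) x ^ 2 ∂stdG = n * (τ ^ 2 - σ ^ 2)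
  sum_mul : ∑ j, ∫ x, x * evoErr (θ j) τ (τ * lam / β) x ∂stdG = n * (τ - β)
  sum_prob : ∑ j, ∫ x, eta' (θ j + τ * x) (τ * lam / β) ∂stdG = n * (1 - β / τ)

theorem StateEvo.evoSys {δ σ lam β τ : ℝ} {N : ℕ} {θ : Fin N → ℝ} (hδ : 0 < δ) (hlam : 0 < lam)
    (hN : 0 < N) (h : StateEvo δ σ (empDist θ) lam β τ) : EvoSys (δ * N) σ lam β τ θ := by
  obtain ⟨hβ, hτ, h1, h2⟩ := h
  have hN' : (0 : ℝ) < N := by exact_mod_cast hN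
  set b := τ * lam / β with hb'
  have hb : 0 < b := by positivity
  have m1 : Measurable fun q : ℝ × ℝ => (eta (q.1 + τ * q.2) b - q.1) ^ 2 := by
    simp_rw [eta_eq hb]
    exact (by unfold clip1; fun_prop : Continuous fun q : ℝ × ℝ =>
      (q.1 + τ * q.2 - b * clip1 ((q.1 + τ * q.2) / b) - q.1) ^ 2).measurable
  have m2 : Measurable fun q : ℝ × ℝ => eta' (q.1 + τ * q.2) b := by
    unfold eta'
    exact Measurable.ite (measurableSet_lt measurable_const (by fun_prop)) measurable_const
      measurable_const
  rw [integral_empDist_prod_stdG hN θ m1 (K := 2 * (τ ^ 2 + b ^ 2))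
    (fun q => abs_evoErr_sq_le hb hτ q.2)] at h1
  rw [integral_empDist_prod_stdG hN θ m2 (K := 1) (fun q => ?_)] at h2
  swap
  · rw [abs_of_nonneg (eta'_mem _ _).1]
    have := (eta'_mem (q.1 + τ * q.2) b).2
    nlinarith [sq_nonneg q.2]
  have h3 : ∑ j, ∫ x, eta' (θ j + τ * x) b ∂stdG = δ * N * (1 - β / τ) := by
    have : β / τ = 1 - 1 / δ * (1 / N * ∑ j, ∫ x, eta' (θ j + τ * x) b ∂stdG) := by
      rw [div_eq_iff hτ.ne', mul_comm]; exact h2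
    rw [this]; field_simp; ring
  refine ⟨hβ, hτ, ?_, ?_, h3⟩
  · have h1' : τ ^ 2 = σ ^ 2 + 1 / δ * (1 / N * ∑ j, ∫ x, evoErr (θ j) τ b x ^ 2 ∂stdG) := h1
    rw [h1']
    field_simp; ring
  · change ∑ j, ∫ x, x * evoErr (θ j) τ b x ∂stdG = _
    simp_rw [integral_id_mul_evoErr hb hτ]
    rw [← Finset.mul_sum, h3]
    field_simp

section bounds

variable {N : ℕ} {n σ lam β τ : ℝ} {θ : Fin N → ℝ}

theorem EvoSys.le_tau (h : EvoSys n σ lam β τ θ) (hn : 0 < n) : σ ≤ τ := by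
  have h1 : 0 ≤ n * (τ ^ 2 - σ ^ 2) := by
    rw [← h.sum_sq]
    exact Finset.sum_nonneg fun j _ => integral_nonneg fun x => sq_nonneg _
  have h2 := nonneg_of_mul_nonneg_right h1 hn
  exact le_of_sq_le_sq (by linarith) h.τ_pos.le

theorem EvoSys.beta_le (h : EvoSys n σ lam β τ θ) (hn : 0 < n) : β ≤ τ := by
  have h1 : 0 ≤ n * (1 - β / τ) := by
    rw [← h.sum_prob]
    exact Finset.sum_nonneg fun j _ => integral_nonneg fun x => (eta'_mem _ _).1
  have h2 := nonneg_of_mul_nonneg_right h1 hn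
  exact (div_le_one h.τ_pos).1 (by linarith)

theorem sum_ite_card_filter {ι : Type*} [Fintype ι] (p : ι → Prop) [DecidablePred p] (a c : ℝ) :
    ∑ j, (if p j then a else c) =
      ((Finset.univ.filter p).card : ℝ) * a + (Fintype.card ι - (Finset.univ.filter p).card) * c := by
  rw [Finset.sum_ite, Finset.sum_const, Finset.sum_const, nsmul_eq_mul, nsmul_eq_mul]
  have := Finset.card_filter_add_card_filter_not (s := (Finset.univ : Finset ι)) p
  rw [Finset.card_univ] at this
  rw [← this]; push_cast; ring

/-- Upper bound on the state evolution correlation through a reference subgradient. -/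
theorem EvoSys.sum_mul_le {α T s : ℝ} (h : EvoSys n σ lam β τ θ) (hn : 0 < n) (hlam : 0 < lam)
    (hα : 0 < α) (hT : 0 ≤ T)
    (hcard : ((Finset.univ.filter fun j => T < |θ j|).card : ℝ) ≤ s * N) :
    n * (τ - β) ≤ √((s * (1 + α ^ 2) + (1 - s) * tailMoment α) * N) * √(n * (τ ^ 2 - σ ^ 2)) +
      α * (β * n * (σ ^ 2 / τ - β) / lam + 2 * T * N) := by
  set b := τ * lam / β with hb'
  have hβ := h.β_pos
  have hτ := h.τ_pos
  have hb : 0 < b := by positivity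
  set v : Fin N → ℝ → ℝ := fun j x => if T < |θ j| then SignType.sign (θ j) else clip1 (x / α)
    with hv
  have hvm : ∀ j, Measurable (v j) := fun j => by
    simp only [hv]
    split_ifs
    · exact measurable_const
    · exact (continuous_clip1.comp (by fun_prop)).measurable
  have hv1 : ∀ j x, |v j x| ≤ 1 := fun j x => by
    simp only [hv]
    split_ifs
    · rcases lt_trichotomy (θ j) 0 with h0 | h0 | h0 <;> simp [h0]
    · exact abs_clip1_le _
  set W : Fin N → ℝ → ℝ := fun j => evoErr (θ j) τ b with hW
  set D : Fin N → ℝ → ℝ := fun j x => |θ j + W j x| - |θ j| with hD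
  have hWm : ∀ j, Measurable (W j) := fun j => (continuous_evoErr hb).measurable
  -- pointwise
  have p1 : ∀ j x, v j x * W j x ≤ D j x + 2 * T := fun j x => by
    simp only [hv, hD]
    split_ifs with hj
    · have e : (SignType.sign (θ j) : ℝ) * θ j = |θ j| := sign_mul_self _
      have : (SignType.sign (θ j) : ℝ) * (θ j + W j x) ≤ |θ j + W j x| := by
        rcases lt_trichotomy (θ j) 0 with h0 | h0 | h0
        · simp only [h0, sign_neg, SignType.coe_neg_one]; linarith [neg_abs_le (θ j + W j x)]
        · simp [h0]
        · simp only [h0, sign_pos, SignType.coe_one]; linarith [le_abs_self (θ j + W j x)]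
      rw [mul_add, e] at this
      linarith
    · have h2 := abs_clip1_le (x / α)
      have h3 : clip1 (x / α) * (θ j + W j x) ≤ |θ j + W j x| := by
        refine (le_abs_self _).trans ?_
        rw [abs_mul]
        exact mul_le_of_le_one_left (abs_nonneg _) h2
      have h4 : -(clip1 (x / α) * θ j) ≤ |θ j| := by
        refine (neg_le_abs _).trans ?_
        rw [abs_mul]
        exact mul_le_of_le_one_left (abs_nonneg _) h2
      have h5 := not_lt.1 hj
      linarith
  have p2 : ∀ j x, lam * D j x ≤ β * (x * W j x) - β / τ * W j x ^ 2 := fun j x => by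
    have e1 := evoErr_eq (t := θ j) (τ := τ) hb x
    have e2 := evoSub_mul (t := θ j) (τ := τ) hb x
    have e3 : evoSub (θ j) τ b x * θ j ≤ |θ j| := by
      refine (le_abs_self _).trans ?_
      rw [abs_mul]
      exact mul_le_of_le_one_left (abs_nonneg _) (abs_evoSub_le x)
    have e4 : D j x ≤ evoSub (θ j) τ b x * W j x := by
      simp only [hD, hW]; rw [← e2]; linarith
    have e5 : lam * evoSub (θ j) τ b x = β * x - β / τ * W j x := by
      have : b * evoSub (θ j) τ b x = τ * x - W j x := by rw [hW]; simp only; rw [e1]; ring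
      rw [hb'] at this
      field_simp at this ⊢
      linarith
    calc lam * D j x ≤ lam * (evoSub (θ j) τ b x * W j x) := mul_le_mul_of_nonneg_left e4 hlam.le
      _ = (lam * evoSub (θ j) τ b x) * W j x := by ring
      _ = _ := by rw [e5]; ring
  -- integrability
  have iW : ∀ j, Integrable (fun x => W j x ^ 2) stdG := fun j =>
    integrable_stdG_of_abs_le ((hWm j).pow_const 2) (abs_evoErr_sq_le hb hτ)
  have iX : ∀ j, Integrable (fun x => x * W j x) stdG := fun j =>
    integrable_stdG_of_abs_le (measurable_id.mul (hWm j)) (abs_mul_evoErr_le hb hτ)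
  have iD : ∀ j, Integrable (D j) stdG := fun j =>
    integrable_stdG_of_abs_le (((hWm j).const_add _).abs.sub_const _) (abs_abs_add_evoErr_sub_le hb hτ)
  have iR : ∀ j, Integrable (fun x => (x - α * v j x) ^ 2) stdG := fun j => by
    refine integrable_stdG_of_abs_le (K := 2 * (1 + α ^ 2)) ((measurable_id.sub ((hvm j).const_mul α)).pow_const 2)
      fun x => ?_
    rw [abs_of_nonneg (sq_nonneg _)]
    have := (sq_le_one_iff_abs_le_one _).2 (hv1 j x)
    nlinarith [sq_nonneg (x + α * v j x), sq_nonneg α, mul_le_mul_of_nonneg_left this (sq_nonneg α), mul_nonneg (sq_nonneg α) (sq_nonneg x)]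
  -- second moment of the residual
  have r1 : ∀ j, ∫ x, (x - α * v j x) ^ 2 ∂stdG =
      if T < |θ j| then 1 + α ^ 2 else tailMoment α := fun j => by
    simp only [hv]
    split_ifs with hj
    · have h0 : θ j ≠ 0 := fun h0 => by simp [h0] at hj; linarith
      set ε : ℝ := ((SignType.sign (θ j) : SignType) : ℝ) with hε
      have hε2 : ε ^ 2 = 1 := by
        rcases lt_or_gt_of_ne h0 with h1 | h1 <;> simp [hε, h1]
      have e : ∀ x : ℝ, (x - α * ε) ^ 2 = (x ^ 2 - 2 * α * ε * x) + α ^ 2 := fun x => by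
        linear_combination α ^ 2 * hε2
      have hz : ∫ x, x ∂stdG = 0 := by simp [stdG]
      simp_rw [e]
      have i1 : Integrable (fun x : ℝ => x ^ 2 - 2 * α * ε * x) stdG :=
        integrable_sq_stdG.sub (integrable_id_stdG.const_mul _)
      rw [integral_add i1 (integrable_const _), integral_sub integrable_sq_stdG (integrable_id_stdG.const_mul _),
        integral_const_mul, hz, integral_sq_stdG]
      simp
    · unfold tailMoment
      refine integral_congr_ae (Filter.Eventually.of_forall fun x => ?_)
      simp only
      rw [← eta_eq hα, eta, mul_pow]
      rcases lt_trichotomy x 0 with h1 | h1 | h1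
      · rw [Real.sign_of_neg h1]; ring
      · simp [h1, hα.le]
      · rw [Real.sign_of_pos h1]; ring
  set R : Fin N → ℝ → ℝ := fun j x => x - α * v j x with hR
  have iRW : ∀ j, Integrable (fun x => R j x * W j x) stdG := fun j => by
    have ivW : Integrable (fun x => v j x * W j x) stdG := by
      refine Integrable.bdd_mul (c := 1) ?_ (hvm j).aestronglyMeasurable
        (Filter.Eventually.of_forall (hv1 j))
      exact integrable_stdG_of_abs_le (K := 2 * (τ + b)) (hWm j) fun x => by
        have h1 := abs_evoErr_le (t := θ j) hb hτ x
        have h2 : |x| ^ 2 = x ^ 2 := sq_abs x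
        have h3 : |x| ≤ 1 + x ^ 2 := by nlinarith [sq_nonneg (|x| - 1), abs_nonneg x]
        have h4 := mul_le_mul_of_nonneg_left h3 hτ.le
        nlinarith [mul_nonneg hb.le (sq_nonneg x), mul_nonneg hτ.le (sq_nonneg x)]
    refine ((iX j).sub (ivW.const_mul α)).congr (Filter.Eventually.of_forall fun x => ?_)
    simp only [hR, Pi.sub_apply]; ring
  set A := ∑ j, ∫ x, R j x ^ 2 ∂stdG with hA
  set B := ∑ j, ∫ x, W j x ^ 2 ∂stdG with hB
  set X := ∑ j, ∫ x, R j x * W j x ∂stdG with hX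
  have hAB : X ^ 2 ≤ A * B := by
    have hq : ∀ c : ℝ, 0 ≤ A * (c * c) + (-2 * X) * c + B := fun c => by
      have : A * (c * c) + (-2 * X) * c + B = ∑ j, ∫ x, (c * R j x - W j x) ^ 2 ∂stdG := by
        have e : ∀ j, ∫ x, (c * R j x - W j x) ^ 2 ∂stdG =
            (c * c) * ∫ x, R j x ^ 2 ∂stdG - (2 * c) * ∫ x, R j x * W j x ∂stdG +
              ∫ x, W j x ^ 2 ∂stdG := fun j => by
          have i1 : Integrable (fun x => c * c * R j x ^ 2) stdG := (iR j).const_mul _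
          have i2 : Integrable (fun x => 2 * c * (R j x * W j x)) stdG := (iRW j).const_mul _
          have i3 : Integrable (fun x => c * c * R j x ^ 2 - 2 * c * (R j x * W j x)) stdG :=
            i1.sub i2
          rw [← integral_const_mul, ← integral_const_mul, ← integral_sub i1 i2,
            ← integral_add i3 (iW j)]
          refine integral_congr_ae (Filter.Eventually.of_forall fun x => ?_)
          simp only; ring
        simp_rw [e]
        rw [Finset.sum_add_distrib, Finset.sum_sub_distrib, ← Finset.mul_sum, ← Finset.mul_sum]
        ring
      rw [this]
      exact Finset.sum_nonneg fun j _ => integral_nonneg fun x => sq_nonneg _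
    have := discrim_le_zero hq
    unfold discrim at this
    nlinarith
  have hB' : B = n * (τ ^ 2 - σ ^ 2) := h.sum_sq
  have hA' : A ≤ (s * (1 + α ^ 2) + (1 - s) * tailMoment α) * N := by
    have hm := tailMoment_le_one hα.le
    have e : A = ∑ j, if T < |θ j| then 1 + α ^ 2 else tailMoment α :=
      Finset.sum_congr rfl fun j _ => r1 j
    rw [e, sum_ite_card_filter, Fintype.card_fin]
    have := mul_le_mul_of_nonneg_right hcard (by nlinarith : 0 ≤ 1 + α ^ 2 - tailMoment α)
    linarith
  have hX' : X ≤ √((s * (1 + α ^ 2) + (1 - s) * tailMoment α) * N) * √(n * (τ ^ 2 - σ ^ 2)) := by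
    have hA0 : 0 ≤ A := Finset.sum_nonneg fun j _ => integral_nonneg fun x => sq_nonneg _
    rw [← hB', ← Real.sqrt_mul (hA0.trans hA')]
    refine Real.le_sqrt_of_sq_le (hAB.trans (mul_le_mul_of_nonneg_right hA' ?_))
    exact Finset.sum_nonneg fun j _ => integral_nonneg fun x => sq_nonneg _
  have hDsum : lam * ∑ j, ∫ x, D j x ∂stdG ≤ β * n * (σ ^ 2 / τ - β) := by
    have e : ∀ j, lam * ∫ x, D j x ∂stdG ≤
        β * ∫ x, x * W j x ∂stdG - β / τ * ∫ x, W j x ^ 2 ∂stdG := fun j => by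
      rw [← integral_const_mul, ← integral_const_mul, ← integral_const_mul,
        ← integral_sub ((iX j).const_mul _) ((iW j).const_mul _)]
      exact integral_mono ((iD j).const_mul _) (((iX j).const_mul _).sub ((iW j).const_mul _)) (p2 j)
    rw [Finset.mul_sum]
    refine (Finset.sum_le_sum fun j _ => e j).trans (le_of_eq ?_)
    rw [Finset.sum_sub_distrib, ← Finset.mul_sum, ← Finset.mul_sum, ← hB, hB', h.sum_mul]
    field_simp; ring
  have hfin : ∑ j, ∫ x, x * W j x ∂stdG ≤ X + α * (∑ j, ∫ x, D j x ∂stdG + 2 * T * N) := by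
    have e : ∀ j, ∫ x, x * W j x ∂stdG ≤
        ∫ x, R j x * W j x ∂stdG + α * (∫ x, D j x ∂stdG + 2 * T) := fun j => by
      have i1 : Integrable (fun x => D j x + 2 * T) stdG := (iD j).add (integrable_const _)
      have : ∫ x, D j x ∂stdG + 2 * T = ∫ x, (D j x + 2 * T) ∂stdG := by
        rw [integral_add (iD j) (integrable_const _)]; simp
      rw [this, ← integral_const_mul, ← integral_add (iRW j) (i1.const_mul α)]
      refine integral_mono (iX j) ((iRW j).add (i1.const_mul α)) fun x => ?_
      have := mul_le_mul_of_nonneg_left (p1 j x) hα.le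
      simp only [hR]
      linarith
    refine (Finset.sum_le_sum fun j _ => e j).trans (le_of_eq ?_)
    rw [Finset.sum_add_distrib, ← Finset.mul_sum, Finset.sum_add_distrib]
    simp only [Finset.sum_const, Finset.card_univ, Fintype.card_fin, nsmul_eq_mul]
    ring
  rw [h.sum_mul] at hfin
  refine hfin.trans (add_le_add hX' (mul_le_mul_of_nonneg_left ?_ hα.le))
  have : ∑ j, ∫ x, D j x ∂stdG ≤ β * n * (σ ^ 2 / τ - β) / lam := by
    rw [le_div_iff₀ hlam]; linarith
  linarith

end bounds

/-- Uniform upper bound for the effective noise level. -/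
theorem exists_tau_bound {δ σ lmin lmax α T s : ℝ} (hδ : 0 < δ) (hσ : 0 < σ) (hl : 0 < lmin)
    (hll : lmin ≤ lmax) (hα : 0 < α) (hT : 0 ≤ T) (hs : 0 ≤ s) (hs1 : s ≤ 1)
    (hr : s * (1 + α ^ 2) + (1 - s) * tailMoment α < δ) :
    ∃ τM : ℝ, 0 < τM ∧ ∀ (N : ℕ) (θ : Fin N → ℝ), 0 < N →
      ((Finset.univ.filter fun j => T < |θ j|).card : ℝ) ≤ s * N →
      ∀ lam ∈ Set.Icc lmin lmax, ∀ β τ : ℝ, EvoSys (δ * N) σ lam β τ θ → τ ≤ τM := by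
  set r := s * (1 + α ^ 2) + (1 - s) * tailMoment α with hr'
  have hr0 : 0 ≤ r := add_nonneg (by positivity)
    (mul_nonneg (by linarith) (tailMoment_nonneg α))
  set k := √(r * δ) with hk
  have hkδ : k < δ := by
    rw [hk, Real.sqrt_lt' hδ]; nlinarith
  set A := 1 + α * σ / lmin with hA
  have hA0 : 0 < A := by positivity
  refine ⟨(δ * (lmax * A ^ 2 / (4 * α)) + 2 * α * T) / (δ - k), ?_, ?_⟩
  · have : 0 < lmax := by linarith
    have : 0 < δ - k := by linarith
    positivity
  intro N θ hN hcard lam hlam β τ h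
  have hN' : (0 : ℝ) < N := by exact_mod_cast hN
  have hl0 : 0 < lam := by linarith [hlam.1]
  have hτ := h.τ_pos
  have hβ := h.β_pos
  have h1 := h.sum_mul_le (by positivity) hl0 hα hT hcard
  have hστ := h.le_tau (by positivity)
  have h2 : √(r * N) * √(δ * N * (τ ^ 2 - σ ^ 2)) ≤ N * (k * τ) := by
    rw [← Real.sqrt_mul (by positivity)]
    refine Real.sqrt_le_iff.2 ⟨by positivity, ?_⟩
    have : k ^ 2 = r * δ := Real.sq_sqrt (by positivity)
    rw [mul_pow, mul_pow, this]
    have : 0 ≤ r * N * (δ * N) * σ ^ 2 := by positivity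
    nlinarith
  have h3 : N * ((δ - k) * τ) ≤ N * (δ * (β + α * (β * (σ ^ 2 / τ - β) / lam)) + 2 * α * T) := by
    have e : α * (β * (δ * N) * (σ ^ 2 / τ - β) / lam + 2 * T * N) =
      N * (δ * (α * (β * (σ ^ 2 / τ - β) / lam)) + 2 * α * T) := by ring
    rw [e] at h1
    linarith
  have h4 := le_of_mul_le_mul_left h3 hN'
  have h5 : σ ^ 2 / τ ≤ σ := by rw [div_le_iff₀ hτ]; nlinarith
  have h6 : α * (β * (σ ^ 2 / τ - β) / lam) ≤ α * (β * (σ - β) / lam) := by gcongr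
  have h7 : β + α * (β * (σ - β) / lam) ≤ lam * (1 + α * σ / lam) ^ 2 / (4 * α) := by
    rw [le_div_iff₀ (by positivity)]
    have : lam * (1 + α * σ / lam) ^ 2 - (β + α * (β * (σ - β) / lam)) * (4 * α) =
      lam * (1 + α * σ / lam - 2 * α * β / lam) ^ 2 := by field_simp; ring
    have : 0 ≤ lam * (1 + α * σ / lam - 2 * α * β / lam) ^ 2 := by positivity
    linarith
  have h8 : lam * (1 + α * σ / lam) ^ 2 / (4 * α) ≤ lmax * A ^ 2 / (4 * α) := by
    rw [hA]
    have := hlam.1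
    have := hlam.2
    have : 0 < lmax := by linarith
    gcongr
  rw [le_div_iff₀ (by linarith)]
  nlinarith

/-- Uniform lower bound for the effective regularization ratio. -/
theorem exists_beta_bound {δ σ lmin lmax T s : ℝ} (hδ : 0 < δ) (hσ : 0 < σ) (hl : 0 < lmin)
    (hT : 0 ≤ T) (hsδ : s < δ) :
    ∃ βm : ℝ, 0 < βm ∧ ∀ (N : ℕ) (θ : Fin N → ℝ), 0 < N →
      ((Finset.univ.filter fun j => T < |θ j|).card : ℝ) ≤ s * N →
      ∀ lam ∈ Set.Icc lmin lmax, ∀ β τ : ℝ, EvoSys (δ * N) σ lam β τ θ → βm ≤ β := by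
  have hδs : 0 < δ - s := by linarith
  set a₁ := 2 * T / σ + √(8 / (δ - s)) with ha₁
  have hq : 0 < √(8 / (δ - s)) := Real.sqrt_pos.2 (by positivity)
  have ha₁0 : 0 < a₁ := by positivity
  refine ⟨min (σ * ((δ - s) / (2 * δ))) (lmin / a₁), by positivity, ?_⟩
  intro N θ hN hcard lam hlam β τ h
  have hN' : (0 : ℝ) < N := by exact_mod_cast hN
  have hl0 : 0 < lam := by linarith [hlam.1]
  have hτ := h.τ_pos
  have hβ := h.β_pos
  have hστ := h.le_tau (by positivity)
  set a := lam / β with ha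
  have ha0 : 0 < a := by positivity
  rcases lt_or_ge a a₁ with haa | haa
  · refine (min_le_right _ _).trans ?_
    rw [div_le_iff₀ ha₁0]
    rw [ha, div_lt_iff₀ hβ] at haa
    linarith [hlam.1]
  refine (min_le_left _ _).trans ?_
  have hTa : T ≤ σ * a / 2 := by
    have : 2 * T / σ ≤ a := by linarith
    rw [div_le_iff₀ hσ] at this
    linarith
  have ha8 : 4 / a ^ 2 ≤ (δ - s) / 2 := by
    have h1 : 8 / (δ - s) ≤ a ^ 2 := by
      rw [← Real.sq_sqrt (by positivity : 0 ≤ 8 / (δ - s))]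
      refine pow_le_pow_left₀ hq.le ?_ 2
      have : 0 ≤ 2 * T / σ := by positivity
      linarith
    rw [div_le_iff₀ hδs] at h1
    rw [div_le_iff₀ (by positivity)]
    linarith
  have hb : τ * lam / β = a * τ := by rw [ha]; field_simp
  have hj : ∀ j, ∫ x, eta' (θ j + τ * x) (τ * lam / β) ∂stdG ≤
      if T < |θ j| then 1 else 4 / a ^ 2 := by
    intro j
    split_ifs with hTj
    · have := integral_mono (integrable_eta' (θ j) τ (τ * lam / β)) (integrable_const (1 : ℝ))
        fun x => (eta'_mem _ _).2
      simpa using this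
    · have h4 : ∫ x, 4 / a ^ 2 * x ^ 2 ∂stdG = 4 / a ^ 2 := by
        rw [integral_const_mul, integral_sq_stdG, mul_one]
      rw [← h4]
      refine integral_mono (integrable_eta' (θ j) τ (τ * lam / β))
        (integrable_sq_stdG.const_mul _) fun x => ?_
      simp only [eta', hb]
      split_ifs with hx
      · have h5 : a * τ < T + τ * |x| := by
          refine hx.trans_le ((abs_add_le _ _).trans ?_)
          rw [abs_mul, abs_of_pos hτ]
          linarith [not_lt.1 hTj]
        have h6 : a / 2 < |x| := by
          have : σ * a ≤ τ * a := mul_le_mul_of_nonneg_right hστ ha0.le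
          by_contra h7
          have := mul_le_mul_of_nonneg_left (not_lt.1 h7) hτ.le
          linarith
        rw [div_mul_eq_mul_div, le_div_iff₀ (by positivity), ← sq_abs x]
        nlinarith
      · positivity
  have hsum := (Finset.sum_le_sum fun j (_ : j ∈ Finset.univ) => hj j)
  rw [h.sum_prob, sum_ite_card_filter, Fintype.card_fin] at hsum
  have h7 : δ * N * (1 - β / τ) ≤ N * ((δ + s) / 2) := by
    have : 0 ≤ 4 / a ^ 2 := by positivity
    have h8 : (0 : ℝ) ≤ ((Finset.univ.filter fun j => T < |θ j|).card : ℝ) := by positivity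
    nlinarith
  have h8 : δ * (1 - β / τ) ≤ (δ + s) / 2 := by
    refine le_of_mul_le_mul_left ?_ hN'
    linarith
  have h9 : (δ - s) / (2 * δ) ≤ β / τ := by
    rw [div_le_iff₀ (by positivity)]; linarith
  have h10 : (δ - s) / (2 * δ) * τ ≤ β := by rwa [le_div_iff₀ hτ] at h9
  refine le_trans ?_ h10
  rw [mul_comm]
  exact mul_le_mul_of_nonneg_left hστ (by positivity)

/-- Deterministic description of a typical realization of the auxiliary Gaussian problem: `W` is
the error of the soft-thresholding estimator, `V` its subgradient, `h` the Gaussian vector. -/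
structure AOGood {ι : Type*} [Fintype ι] (n σ lam β τ m₁ N₀ N₁ a ρ : ℝ) (θ h W V : ι → ℝ) :
    Prop where
  kkt : ∀ j, β / τ * W j - β * h j + lam * V j = 0
  V_le : ∀ j, |V j| ≤ 1
  dual : ∀ j, V j * (θ j + W j) = |θ j + W j|
  sum_sq : |∑ j, W j ^ 2 - n * (τ ^ 2 - σ ^ 2)| ≤ ρ * n
  sum_mul : |∑ j, h j * W j - n * (τ - β)| ≤ ρ * n
  sum_abs : |∑ j, (|θ j + W j| - |θ j|) - n * m₁| ≤ ρ * n
  card_zero : ((Finset.univ.filter fun j => |θ j + W j| < a).card : ℝ) ≤ n * N₀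
  card_one : ((Finset.univ.filter fun j => 1 - a < |V j|).card : ℝ) ≤ n * N₁

theorem card_filter_eq_sum {ι : Type*} [Fintype ι] (p : ι → Prop) [DecidablePred p] :
    ((Finset.univ.filter p).card : ℝ) = ∑ j, if p j then (1 : ℝ) else 0 := by
  simp

/-- Lagrange-type lower bound for the product of norms of two vectors sharing a coordinate. -/
theorem sum_sub_sq_le_norm_mul_norm {ι : Type*} [Fintype ι] {s : ℝ} (hs : 0 < s)
    (w W : ι → ℝ) :
    s * ∑ j, (w j - W j) ^ 2 ≤ 2 * (√(s + ∑ j, w j ^ 2) * √(s + ∑ j, W j ^ 2)) *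
      (√(s + ∑ j, w j ^ 2) * √(s + ∑ j, W j ^ 2) - (s + ∑ j, w j * W j)) := by
  set A := ∑ j, w j ^ 2 with hA
  set B := ∑ j, W j ^ 2 with hB
  set D := ∑ j, w j * W j with hD
  have hA0 : 0 ≤ A := Finset.sum_nonneg fun j _ => sq_nonneg _
  have hB0 : 0 ≤ B := Finset.sum_nonneg fun j _ => sq_nonneg _
  have hCS : D ^ 2 ≤ A * B := Finset.sum_mul_sq_le_sq_mul_sq _ _ _
  have hsub : ∑ j, (w j - W j) ^ 2 = A - 2 * D + B := by
    rw [hA, hB, hD, Finset.mul_sum, ← Finset.sum_sub_distrib, ← Finset.sum_add_distrib]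
    exact Finset.sum_congr rfl fun j _ => by ring
  have hAB : A - 2 * D + B ≥ 0 := by
    rw [← hsub]; exact Finset.sum_nonneg fun j _ => sq_nonneg _
  set p := √(s + A) with hp
  set q := √(s + B) with hq
  have hp2 : p ^ 2 = s + A := Real.sq_sqrt (by positivity)
  have hq2 : q ^ 2 = s + B := Real.sq_sqrt (by positivity)
  have hpq : 0 ≤ p * q := by positivity
  have h1 : (p * q) ^ 2 - (s + D) ^ 2 ≥ s * (A - 2 * D + B) := by
    rw [mul_pow, hp2, hq2]; nlinarith only [hCS]
  have h2 : |s + D| ≤ p * q := abs_le_of_sq_le_sq (by nlinarith only [h1, hAB, hs]) hpq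
  have h3 := abs_le.1 h2
  rw [hsub]
  have h4 : (p * q + (s + D)) * (p * q - (s + D)) ≤ 2 * (p * q) * (p * q - (s + D)) :=
    mul_le_mul_of_nonneg_right (by linarith) (by linarith)
  linarith only [h1, h4]

section deterministic

variable {ι : Type*} [Fintype ι] {n σ lam β τ m₁ N₀ N₁ a ρ : ℝ} {θ h W V : ι → ℝ}

theorem AOGood.sum_sub_mul (H : AOGood n σ lam β τ m₁ N₀ N₁ a ρ θ h W V) (hβ : 0 < β)
    (hτ : 0 < τ) (hβτ : β ≤ τ) (hn : 0 < n) :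
    lam * ∑ j, V j * W j ≤ n * (β * σ ^ 2 / τ - β ^ 2) + (β + 1) * (ρ * n) ∧
    n * (β * σ ^ 2 / τ - β ^ 2) - (β + 1) * (ρ * n) ≤ lam * ∑ j, V j * W j := by
  have e : lam * ∑ j, V j * W j = β * ∑ j, h j * W j - β / τ * ∑ j, W j ^ 2 := by
    rw [Finset.mul_sum, Finset.mul_sum, Finset.mul_sum, ← Finset.sum_sub_distrib]
    exact Finset.sum_congr rfl fun j _ => by linear_combination W j * H.kkt j
  have hr : β / τ ≤ 1 := (div_le_one hτ).2 hβτ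
  have hr0 : 0 ≤ β / τ := by positivity
  have h1 := abs_le.1 H.sum_sq
  have h2 := abs_le.1 H.sum_mul
  have hρ : 0 ≤ ρ * n := (abs_nonneg _).trans H.sum_sq
  have e2 : n * (β * σ ^ 2 / τ - β ^ 2) = β * (n * (τ - β)) - β / τ * (n * (τ ^ 2 - σ ^ 2)) := by
    field_simp; ring
  rw [e, e2]
  have h3 : β / τ * (ρ * n) ≤ 1 * (ρ * n) := by gcongr
  have h4 := mul_le_mul_of_nonneg_left h1.1 hr0
  have h5 := mul_le_mul_of_nonneg_left h1.2 hr0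
  have h6 := mul_le_mul_of_nonneg_left h2.1 hβ.le
  have h7 := mul_le_mul_of_nonneg_left h2.2 hβ.le
  constructor <;> linarith

set_option maxHeartbeats 1000000 in
/-- Lower bound for the auxiliary cost on a ball, with quadratic growth and a count of zeros. -/
theorem AOGood.lower (H : AOGood n σ lam β τ m₁ N₀ N₁ a ρ θ h W V) {τM βm lmax R t : ℝ}
    (hn : 0 < n) (hσ : 0 < σ) (hβm : 0 < βm) (hβ : βm ≤ β) (hβτ : β ≤ τ) (hστ : σ ≤ τ)
    (hτM : τ ≤ τM) (hlam : 0 < lam) (hlmax : lam ≤ lmax) (hρ : 0 ≤ ρ) (hρ1 : ρ ≤ 1)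
    (hR : 0 < R) (ha : 0 < a) (ht : 0 ≤ t)
    (hta : t ≤ βm * σ ^ 2 / (2 * τM * √(σ ^ 2 + R ^ 2) * √(τM ^ 2 + 1)) / 2 * a ^ 2)
    {g h₀ : ℝ} (hg : (1 - ρ) * √n ≤ g) (hh₀ : |h₀| ≤ ρ * √n)
    {w : ι → ℝ} (hw : ∑ j, w j ^ 2 ≤ n * R ^ 2) :
    n * (β ^ 2 / 2 + lam * m₁) - t * (n * N₀) +
        t * (Finset.univ.filter fun j => θ j + w j = 0).card +
        βm * σ ^ 2 / (2 * τM * √(σ ^ 2 + R ^ 2) * √(τM ^ 2 + 1)) / 2 *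
          max 0 ((∑ j, w j ^ 2) / 2 - n * (τM ^ 2 + 1)) -
        (√(σ ^ 2 + R ^ 2) / (2 * σ) + τM * √(σ ^ 2 + R ^ 2) + τM * σ + (τM + 1) + lmax) * (ρ * n)
      ≤ β * (g * √(n * σ ^ 2 + ∑ j, w j ^ 2)) + β * (h₀ * (√n * σ) - ∑ j, h j * w j)
        - n * β ^ 2 / 2 + lam * ∑ j, (|θ j + w j| - |θ j|) := by
  set K := √(σ ^ 2 + R ^ 2) with hK
  set KQ := √(τM ^ 2 + 1) with hKQ
  set c₃ := βm * σ ^ 2 / (2 * τM * K * KQ) with hc₃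
  have hβ0 : 0 < β := by linarith
  have hτ0 : 0 < τ := by linarith
  have hτM0 : 0 < τM := by linarith
  have hK0 : 0 < K := Real.sqrt_pos.2 (by positivity)
  have hKQ0 : 0 < KQ := Real.sqrt_pos.2 (by positivity)
  have hc₃0 : 0 < c₃ := by positivity
  have hsn : 0 < √n := Real.sqrt_pos.2 hn
  have hsn2 : √n * √n = n := Real.mul_self_sqrt hn.le
  have hr : β / τ ≤ 1 := (div_le_one hτ0).2 hβτ
  have hr0 : 0 < β / τ := by positivity
  have hs : 0 < n * σ ^ 2 := by positivity
  have hA0 : 0 ≤ ∑ j, w j ^ 2 := Finset.sum_nonneg fun j _ => sq_nonneg _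
  have hB0 : 0 ≤ ∑ j, W j ^ 2 := Finset.sum_nonneg fun j _ => sq_nonneg _
  have hSq := abs_le.1 H.sum_sq
  have hρn : 0 ≤ ρ * n := by positivity
  have hρn1 : ρ * n ≤ n := mul_le_of_le_one_left hn.le hρ1
  have hgap := sum_sub_sq_le_norm_mul_norm hs w W
  set sP := √(n * σ ^ 2 + ∑ j, w j ^ 2) with hsP
  set sQ := √(n * σ ^ 2 + ∑ j, W j ^ 2) with hsQ
  set E := ∑ j, (w j - W j) ^ 2 with hE
  have hE0 : 0 ≤ E := Finset.sum_nonneg fun j _ => sq_nonneg _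
  have hsP0 : 0 < sP := Real.sqrt_pos.2 (by positivity)
  have hsQ0 : 0 < sQ := Real.sqrt_pos.2 (by positivity)
  have hsPK : sP ≤ √n * K := by
    rw [hK, ← Real.sqrt_mul hn.le]
    exact Real.sqrt_le_sqrt (by linarith)
  have hsQK : sQ ≤ √n * KQ := by
    rw [hKQ, ← Real.sqrt_mul hn.le]
    refine Real.sqrt_le_sqrt ?_
    have : n * τ ^ 2 ≤ n * τM ^ 2 := by gcongr
    linarith
  have hsQτ : sQ ≤ √n * (τ + ρ / (2 * σ)) := by
    refine Real.sqrt_le_iff.2 ⟨by positivity, ?_⟩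
    have e : (√n * (τ + ρ / (2 * σ))) ^ 2 = n * (τ ^ 2 + ρ * (τ / σ) + (ρ / (2 * σ)) ^ 2) := by
      rw [mul_pow, Real.sq_sqrt hn.le]; field_simp; ring
    have h1 : 1 ≤ τ / σ := (one_le_div hσ).2 hστ
    have h2 : n * ρ * 1 ≤ n * ρ * (τ / σ) := mul_le_mul_of_nonneg_left h1 (by positivity)
    have h3 : 0 ≤ n * (ρ / (2 * σ)) ^ 2 := by positivity
    rw [e]
    linarith
  -- the gap between the product of norms and the inner product
  have hgap2 : σ ^ 2 / (2 * K * KQ) * E ≤ sP * sQ - (n * σ ^ 2 + ∑ j, w j * W j) := by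
    set y := sP * sQ - (n * σ ^ 2 + ∑ j, w j * W j) with hy
    have hy0 : 0 ≤ y := by
      have : 0 ≤ n * σ ^ 2 * E := by positivity
      have h1 := this.trans hgap
      exact nonneg_of_mul_nonneg_right h1 (by positivity)
    have h1 : sP * sQ ≤ n * (K * KQ) := by
      calc sP * sQ ≤ (√n * K) * (√n * KQ) := mul_le_mul hsPK hsQK hsQ0.le (by positivity)
        _ = n * (K * KQ) := by linear_combination (K * KQ) * hsn2
    have h2 : n * σ ^ 2 * E ≤ n * (2 * K * KQ * y) := by
      calc n * σ ^ 2 * E ≤ 2 * (sP * sQ) * y := hgap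
        _ ≤ 2 * (n * (K * KQ)) * y := by gcongr
        _ = _ := by ring
    rw [div_mul_eq_mul_div, div_le_iff₀ (by positivity)]
    have h3 : n * (σ ^ 2 * E) ≤ n * (2 * K * KQ * y) := by linarith
    have := le_of_mul_le_mul_left h3 hn
    linarith
  have hmain : β / τ * (n * σ ^ 2 + ∑ j, w j * W j) + c₃ * E - K / (2 * σ) * (ρ * n) ≤
      β * (√n * sP) := by
    have h1 : sP * sQ ≤ τ * (√n * sP) + K / (2 * σ) * (ρ * n) := by
      calc sP * sQ ≤ sP * (√n * (τ + ρ / (2 * σ))) := by gcongr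
        _ = τ * (√n * sP) + √n * sP * (ρ / (2 * σ)) := by ring
        _ ≤ τ * (√n * sP) + √n * (√n * K) * (ρ / (2 * σ)) := by gcongr
        _ = τ * (√n * sP) + (√n * √n) * K * (ρ / (2 * σ)) := by ring
        _ = _ := by rw [hsn2]; ring
    have h2 : β / τ * (n * σ ^ 2 + ∑ j, w j * W j + σ ^ 2 / (2 * K * KQ) * E) ≤
        β / τ * (τ * (√n * sP) + K / (2 * σ) * (ρ * n)) :=
      mul_le_mul_of_nonneg_left (by linarith) hr0.le
    have h3 : c₃ * E ≤ β / τ * (σ ^ 2 / (2 * K * KQ) * E) := by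
      have h4 : βm / τM ≤ β / τ := by gcongr
      have e : c₃ * E = βm / τM * (σ ^ 2 / (2 * K * KQ) * E) := by rw [hc₃]; field_simp
      rw [e]
      gcongr
    have h4 : β / τ * (τ * (√n * sP)) = β * (√n * sP) := by field_simp
    have h5 : β / τ * (K / (2 * σ) * (ρ * n)) ≤ 1 * (K / (2 * σ) * (ρ * n)) := by gcongr
    rw [mul_add, mul_add _ (τ * _), h4] at h2
    linarith
  have hgs : β * (√n * sP) - τM * K * (ρ * n) ≤ β * (g * sP) := by
    have h1 : β * ((1 - ρ) * √n * sP) ≤ β * (g * sP) := by gcongr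
    have h2 : β * (ρ * (√n * sP)) ≤ τM * (ρ * (√n * (√n * K))) := by gcongr; linarith
    have h3 : τM * (ρ * (√n * (√n * K))) = τM * K * (ρ * n) := by
      linear_combination τM * ρ * K * hsn2
    linarith
  have hh : -(τM * σ * (ρ * n)) ≤ β * (h₀ * (√n * σ)) := by
    have h1 : |β * (h₀ * (√n * σ))| ≤ τM * (ρ * √n * (√n * σ)) := by
      rw [abs_mul, abs_mul, abs_of_pos hβ0, abs_of_pos (by positivity : 0 < √n * σ)]
      gcongr; linarith
    have h2 : τM * (ρ * √n * (√n * σ)) = τM * σ * (ρ * n) := by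
      linear_combination τM * ρ * σ * hsn2
    linarith [(abs_le.1 h1).1]
  have hkkt : β / τ * ∑ j, w j * W j - β * ∑ j, h j * w j = -(lam * ∑ j, V j * w j) := by
    rw [Finset.mul_sum, Finset.mul_sum, Finset.mul_sum, ← Finset.sum_sub_distrib,
      ← Finset.sum_neg_distrib]
    exact Finset.sum_congr rfl fun j _ => by linear_combination w j * H.kkt j
  have hVW := (H.sum_sub_mul hβ0 hτ0 hβτ hn).1
  have hVW2 : (β + 1) * (ρ * n) ≤ (τM + 1) * (ρ * n) := by gcongr; linarith
  have habs := (abs_le.1 H.sum_abs).1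
  have habs2 : lam * (n * m₁) - lmax * (ρ * n) ≤ lam * ∑ j, (|θ j + W j| - |θ j|) := by
    have h1 := mul_le_mul_of_nonneg_left habs hlam.le
    have h2 : lam * (ρ * n) ≤ lmax * (ρ * n) := by gcongr
    linarith
  -- coordinatewise comparison
  have hcoord : t * (Finset.univ.filter fun j => θ j + w j = 0).card - t * (n * N₀) +
      lam * ∑ j, (|θ j + W j| - |θ j|) - lam * ∑ j, V j * W j ≤
      lam * ∑ j, (|θ j + w j| - |θ j|) - lam * ∑ j, V j * w j + c₃ / 2 * E := by
    have h1 := mul_le_mul_of_nonneg_left H.card_zero ht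
    rw [card_filter_eq_sum] at h1 ⊢
    have h2 : ∀ j, t * (if θ j + w j = 0 then (1 : ℝ) else 0) -
        t * (if |θ j + W j| < a then (1 : ℝ) else 0) ≤
        lam * (|θ j + w j| - |θ j|) - lam * (V j * w j) + c₃ / 2 * (w j - W j) ^ 2 -
        (lam * (|θ j + W j| - |θ j|) - lam * (V j * W j)) := by
      intro j
      have h3 : 0 ≤ lam * (|θ j + w j| - |θ j + W j| - V j * (w j - W j)) := by
        refine mul_nonneg hlam.le ?_
        have h4 : V j * (θ j + w j) ≤ |θ j + w j| := by
          refine (le_abs_self _).trans ?_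
          rw [abs_mul]
          exact mul_le_of_le_one_left (abs_nonneg _) (H.V_le j)
        have := H.dual j
        linarith
      have h5 : 0 ≤ c₃ / 2 * (w j - W j) ^ 2 := by positivity
      split_ifs with h6 h7 h7
      · linarith
      · have h8 : a ^ 2 ≤ (w j - W j) ^ 2 := by
          rw [← sq_abs (w j - W j)]
          have : |w j - W j| = |θ j + W j| := by
            rw [← abs_neg]; congr 1; linarith
          rw [this]
          exact pow_le_pow_left₀ ha.le (not_lt.1 h7) 2
        have h9 : t ≤ c₃ / 2 * (w j - W j) ^ 2 :=
          hta.trans (mul_le_mul_of_nonneg_left h8 (by positivity))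
        linarith
      · linarith
      · linarith
    have h3 := Finset.sum_le_sum fun j (_ : j ∈ Finset.univ) => h2 j
    simp only [Finset.sum_add_distrib, Finset.sum_sub_distrib, ← Finset.mul_sum] at h3 h1 ⊢
    rw [hE]
    linarith
  have hgrow : max 0 ((∑ j, w j ^ 2) / 2 - n * (τM ^ 2 + 1)) ≤ E := by
    refine max_le hE0 ?_
    have h1 : ∑ j, W j ^ 2 ≤ n * (τM ^ 2 + 1) := by
      have : n * τ ^ 2 ≤ n * τM ^ 2 := by gcongr
      linarith
    have h2 : (∑ j, w j ^ 2) / 2 ≤ ∑ j, (W j ^ 2 + (w j - W j) ^ 2) := by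
      rw [Finset.sum_div]
      exact Finset.sum_le_sum fun j _ => by
        linarith only [sq_nonneg (w j - 2 * W j)]
    rw [Finset.sum_add_distrib] at h2
    linarith
  have hgrow2 := mul_le_mul_of_nonneg_left hgrow (by positivity : 0 ≤ c₃ / 2)
  have e1 : β / τ * (n * σ ^ 2 + ∑ j, w j * W j) = n * (β * σ ^ 2 / τ) + β / τ * ∑ j, w j * W j := by
    ring
  rw [e1] at hmain
  linarith

end deterministic

section deterministic

variable {ι : Type*} [Fintype ι] {n σ lam β τ m₁ N₀ N₁ a ρ : ℝ} {θ h W V : ι → ℝ}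

theorem AOGood.sum_sq_shift_le (H : AOGood n σ lam β τ m₁ N₀ N₁ a ρ θ h W V) {τM ν R κ : ℝ}
    (hn : 0 < n) (hτ : 0 < τ) (hτM : τ ≤ τM) (hρ1 : ρ ≤ 1)
    (hν : (Fintype.card ι : ℝ) ≤ ν * n) (hκ : 0 < κ) (hκ1 : κ ≤ 1)
    (hR : 2 * (τM ^ 2 + 1) + 8 * ν ≤ R ^ 2) {v : ι → ℝ} (hv : ∀ j, |v j| ≤ 1) :
    ∑ j, (W j - κ * (v j - V j)) ^ 2 ≤ n * R ^ 2 := by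
  have h1 : ∀ j, (W j - κ * (v j - V j)) ^ 2 ≤ 2 * W j ^ 2 + 8 := by
    intro j
    have h2 : (κ * (v j - V j)) ^ 2 ≤ 4 := by
      have h3 : |κ * (v j - V j)| ≤ 1 * 2 := by
        rw [abs_mul, abs_of_pos hκ]
        refine mul_le_mul hκ1 ?_ (abs_nonneg _) zero_le_one
        have := abs_sub (v j) (V j)
        linarith [hv j, H.V_le j]
      rw [← sq_abs]
      nlinarith only [abs_nonneg (κ * (v j - V j)), h3]
    linarith only [h2, sq_nonneg (W j + κ * (v j - V j))]
  have h2 := Finset.sum_le_sum fun j (_ : j ∈ Finset.univ) => h1 j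
  simp only [Finset.sum_add_distrib, ← Finset.mul_sum, Finset.sum_const, Finset.card_univ,
    nsmul_eq_mul] at h2
  have h3 := (abs_le.1 H.sum_sq).2
  have h4 : τ ^ 2 ≤ τM ^ 2 := by gcongr
  have h5 : n * τ ^ 2 ≤ n * τM ^ 2 := by gcongr
  have h6 : ρ * n ≤ 1 * n := by gcongr
  have h7 : n * (2 * (τM ^ 2 + 1) + 8 * ν) ≤ n * R ^ 2 := by gcongr
  have h8 : 0 ≤ n * σ ^ 2 := by positivity
  linarith

theorem sq_add_div_le {n σ lam β τ βm lmax ν κ C ρ P D : ℝ}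
    (hn : 0 < n) (hσ : 0 < σ) (hβm : 0 < βm) (hβ : βm ≤ β) (hστ : σ ≤ τ) (hlam : 0 < lam)
    (hlmax : lam ≤ lmax) (hρ : 0 ≤ ρ) (hρ1 : ρ ≤ 1) (hν0 : 0 ≤ ν) (hκ : 0 < κ) (hκ1 : κ ≤ 1)
    (hD0 : 0 ≤ D) (hD4 : D ≤ 4 * (ν * n)) (hP2 : P ^ 2 ≤ ν * n * D) :
    (C * (ρ * n) + (κ * lam / β * P + κ ^ 2 * D / (2 * τ))) ^ 2 / n ≤ 3 * C ^ 2 * (ρ * n) +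
      κ ^ 2 * (3 * lmax ^ 2 * ν / βm ^ 2 + 3 * ν / σ ^ 2) * D := by
  have hβ0 : 0 < β := by linarith
  have hτ0 : 0 < τ := by linarith
  have hlmax0 : 0 < lmax := by linarith
  have h1 : (C * (ρ * n) + (κ * lam / β * P + κ ^ 2 * D / (2 * τ))) ^ 2 ≤ 3 * ((C * (ρ * n)) ^ 2 + (κ * lam / β * P) ^ 2 +
      (κ ^ 2 * D / (2 * τ)) ^ 2) := by
    linarith only [sq_nonneg (C * (ρ * n) - κ * lam / β * P),
      sq_nonneg (C * (ρ * n) - κ ^ 2 * D / (2 * τ)),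
      sq_nonneg (κ * lam / β * P - κ ^ 2 * D / (2 * τ))]
  have h2 : (C * (ρ * n)) ^ 2 ≤ n * (C ^ 2 * (ρ * n)) := by
    have : ρ ^ 2 ≤ ρ := by nlinarith only [hρ, hρ1]
    calc (C * (ρ * n)) ^ 2 = ρ ^ 2 * (C ^ 2 * n ^ 2) := by ring
      _ ≤ ρ * (C ^ 2 * n ^ 2) := by gcongr
      _ = _ := by ring
  have h3 : (κ * lam / β * P) ^ 2 ≤ n * (κ ^ 2 * (lmax ^ 2 * ν / βm ^ 2) * D) := by
    calc (κ * lam / β * P) ^ 2 = (κ * lam / β) ^ 2 * P ^ 2 := by ring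
      _ ≤ (κ * lmax / βm) ^ 2 * (ν * n * D) := by gcongr
      _ = _ := by field_simp
  have h4 : (κ ^ 2 * D / (2 * τ)) ^ 2 ≤ n * (κ ^ 2 * (ν / σ ^ 2) * D) := by
    have hκ2 : κ ^ 2 ≤ 1 := pow_le_one₀ hκ.le hκ1
    calc (κ ^ 2 * D / (2 * τ)) ^ 2 = κ ^ 2 * κ ^ 2 * D * D / (4 * τ ^ 2) := by
          field_simp; norm_num
      _ ≤ κ ^ 2 * 1 * D * (4 * (ν * n)) / (4 * σ ^ 2) := by gcongr
      _ = _ := by field_simp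
  rw [div_le_iff₀ hn]
  have e : (3 * C ^ 2 * (ρ * n) + κ ^ 2 * (3 * lmax ^ 2 * ν / βm ^ 2 + 3 * ν / σ ^ 2) * D) * n =
      3 * (n * (C ^ 2 * (ρ * n)) + n * (κ ^ 2 * (lmax ^ 2 * ν / βm ^ 2) * D) +
        n * (κ ^ 2 * (ν / σ ^ 2) * D)) := by ring
  rw [e]
  linarith

theorem AOGood.coordinate_upper (H : AOGood n σ lam β τ m₁ N₀ N₁ a ρ θ h W V) {lmin κ t : ℝ}
    (hlmin : 0 < lmin) (hlam0 : 0 < lam) (hκ : 0 < κ) (ha : 0 < a) (ht : 0 ≤ t)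
    (hta : t ≤ κ * lmin / 2 * a ^ 2) {v : ι → ℝ} (hv : ∀ j, |v j| ≤ 1) :
    lam * ∑ j, (v j * (θ j + (W j - κ * (v j - V j))) - |θ j|) +
      t * (Finset.univ.filter fun j => |v j| = 1).card ≤
    lam * ∑ j, (|θ j + W j| - |θ j|) - κ * lam * ∑ j, V j * (v j - V j) -
      κ * lam * ∑ j, (v j - V j) ^ 2 + κ * lmin / 2 * ∑ j, (v j - V j) ^ 2 + t * (n * N₁) := by
  have h1 := mul_le_mul_of_nonneg_left H.card_one ht
  rw [card_filter_eq_sum] at h1 ⊢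
  have h2 : ∀ j, lam * (v j * (θ j + (W j - κ * (v j - V j))) - |θ j|) +
      t * (if |v j| = 1 then (1 : ℝ) else 0) ≤
      lam * (|θ j + W j| - |θ j|) - κ * lam * (V j * (v j - V j)) -
      κ * lam * (v j - V j) ^ 2 + κ * lmin / 2 * (v j - V j) ^ 2 +
      t * (if 1 - a < |V j| then (1 : ℝ) else 0) := by
    intro j
    have h3 : lam * (v j * (θ j + W j) - |θ j + W j|) ≤ 0 := by
      refine mul_nonpos_of_nonneg_of_nonpos hlam0.le (sub_nonpos.2 ?_)
      refine (le_abs_self _).trans ?_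
      rw [abs_mul]
      exact mul_le_of_le_one_left (abs_nonneg _) (hv j)
    have h5 : 0 ≤ κ * lmin / 2 * (v j - V j) ^ 2 := by positivity
    have h6 : t * (if |v j| = 1 then (1 : ℝ) else 0) ≤ κ * lmin / 2 * (v j - V j) ^ 2 +
        t * (if 1 - a < |V j| then (1 : ℝ) else 0) := by
      split_ifs with h7 h8 h8
      · linarith
      · have h9 : a ≤ |v j - V j| := by
          have := abs_sub_abs_le_abs_sub (v j) (V j)
          linarith
        have h10 : a ^ 2 ≤ (v j - V j) ^ 2 := by
          rw [← sq_abs (v j - V j)]; gcongr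
        have h11 : κ * lmin / 2 * a ^ 2 ≤ κ * lmin / 2 * (v j - V j) ^ 2 := by gcongr
        linarith
      · linarith
      · linarith
    linarith
  have h3 := Finset.sum_le_sum fun j (_ : j ∈ Finset.univ) => h2 j
  simp only [Finset.sum_add_distrib, Finset.sum_sub_distrib, ← Finset.mul_sum] at h3 h1 ⊢
  linarith

set_option maxHeartbeats 1000000 in
/-- Upper bound for the dual auxiliary cost at a shifted soft-thresholding error. -/
theorem AOGood.upper (H : AOGood n σ lam β τ m₁ N₀ N₁ a ρ θ h W V) {τM βm lmin lmax ν R κ t : ℝ}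
    (hn : 0 < n) (hσ : 0 < σ) (hβm : 0 < βm) (hβ : βm ≤ β) (hβτ : β ≤ τ) (hστ : σ ≤ τ)
    (hτM : τ ≤ τM) (hlmin : 0 < lmin) (hlam : lmin ≤ lam) (hlmax : lam ≤ lmax)
    (hρ : 0 ≤ ρ) (hρ1 : ρ ≤ 1) (hν : (Fintype.card ι : ℝ) ≤ ν * n) (hκ : 0 < κ) (hκ1 : κ ≤ 1)
    (hκB : κ * (1 / 2 + 3 * lmax ^ 2 * ν / βm ^ 2 + 3 * ν / σ ^ 2) ≤ lmin / 2)
    (hR : 2 * (τM ^ 2 + 1) + 8 * ν ≤ R ^ 2) (ha : 0 < a) (ht : 0 ≤ t)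
    (hta : t ≤ κ * lmin / 2 * a ^ 2)
    {g h₀ : ℝ} (hg : g ≤ (1 + ρ) * √n) (hh₀ : |h₀| ≤ ρ * √n)
    {r : ℝ} (hr : 0 ≤ r) {v : ι → ℝ} (hv : ∀ j, |v j| ≤ 1) :
    r * (g * √(n * σ ^ 2 + ∑ j, (W j - κ * (v j - V j)) ^ 2)) +
      r * (h₀ * (√n * σ) - ∑ j, h j * (W j - κ * (v j - V j))) - n * r ^ 2 / 2 +
      lam * ∑ j, (v j * (θ j + (W j - κ * (v j - V j))) - |θ j|) + n / 4 * (r - β) ^ 2 +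
      t * (Finset.univ.filter fun j => |v j| = 1).card ≤
    n * (β ^ 2 / 2 + lam * m₁) + t * (n * N₁) +
      (lmax + τM * (1 / (2 * σ) + √(σ ^ 2 + R ^ 2) + 1 + σ) +
        3 * (1 / (2 * σ) + √(σ ^ 2 + R ^ 2) + 1 + σ) ^ 2) * (ρ * n) := by
  have hshift := H.sum_sq_shift_le hn (hσ.trans_le hστ) hτM hρ1 hν hκ hκ1 hR hv
  set C := 1 / (2 * σ) + √(σ ^ 2 + R ^ 2) + 1 + σ with hC
  have hC0 : 0 < C := by positivity
  have hβ0 : 0 < β := by linarith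
  have hτ0 : 0 < τ := by linarith
  have hτM0 : 0 < τM := by linarith
  have hlam0 : 0 < lam := by linarith
  have hsn : 0 < √n := Real.sqrt_pos.2 hn
  have hsn2 : √n * √n = n := Real.mul_self_sqrt hn.le
  have hρn : 0 ≤ ρ * n := by positivity
  have hν0 : 0 ≤ ν := by
    have : (0 : ℝ) ≤ ν * n := (Nat.cast_nonneg _).trans hν
    exact nonneg_of_mul_nonneg_left this hn
  set D := ∑ j, (v j - V j) ^ 2 with hD
  set P := ∑ j, V j * (v j - V j) with hP
  have hD0 : 0 ≤ D := Finset.sum_nonneg fun j _ => sq_nonneg _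
  have hV2 : ∑ j, V j ^ 2 ≤ ν * n := by
    refine le_trans ?_ hν
    have : ∀ j ∈ Finset.univ, V j ^ 2 ≤ (1 : ℝ) := fun j _ => by
      rw [← sq_abs]; exact pow_le_one₀ (abs_nonneg _) (H.V_le j)
    simpa using Finset.sum_le_sum this
  have hD4 : D ≤ 4 * (ν * n) := by
    have : ∀ j ∈ Finset.univ, (v j - V j) ^ 2 ≤ (4 : ℝ) := fun j _ => by
      have := abs_sub (v j) (V j)
      have h1 : |v j - V j| ≤ 2 := by linarith [hv j, H.V_le j]
      rw [← sq_abs]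
      nlinarith only [abs_nonneg (v j - V j), h1]
    have h1 := Finset.sum_le_sum this
    simp only [Finset.sum_const, Finset.card_univ, nsmul_eq_mul] at h1
    linarith
  have hP2 : P ^ 2 ≤ ν * n * D :=
    (Finset.sum_mul_sq_le_sq_mul_sq _ _ _).trans (by gcongr)
  set sP := √(n * σ ^ 2 + ∑ j, (W j - κ * (v j - V j)) ^ 2) with hsP
  have hsP0 : 0 ≤ sP := Real.sqrt_nonneg _
  have hsum0 : 0 ≤ ∑ j, (W j - κ * (v j - V j)) ^ 2 := Finset.sum_nonneg fun j _ => sq_nonneg _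
  have hsPK : sP ≤ √n * √(σ ^ 2 + R ^ 2) := by
    rw [← Real.sqrt_mul hn.le]
    exact Real.sqrt_le_sqrt (by linarith)
  have hexp : ∑ j, (W j - κ * (v j - V j)) ^ 2 =
      ∑ j, W j ^ 2 - 2 * κ * ∑ j, W j * (v j - V j) + κ ^ 2 * D := by
    rw [hD, Finset.mul_sum, Finset.mul_sum, ← Finset.sum_sub_distrib, ← Finset.sum_add_distrib]
    exact Finset.sum_congr rfl fun j _ => by ring
  have hSq := (abs_le.1 H.sum_sq).2
  have hmul := (abs_le.1 H.sum_mul).1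
  have hsqrt : √n * sP ≤ n * τ + 1 / (2 * σ) * (ρ * n) - κ / τ * ∑ j, W j * (v j - V j) +
      κ ^ 2 * D / (2 * τ) := by
    have h1 : sP ^ 2 = n * σ ^ 2 + ∑ j, (W j - κ * (v j - V j)) ^ 2 :=
      Real.sq_sqrt (by positivity)
    have h2 : √n * sP ≤ (sP ^ 2 + n * τ ^ 2) / (2 * τ) := by
      rw [le_div_iff₀ (by positivity)]
      have e : √n * √n * τ ^ 2 = n * τ ^ 2 := by rw [hsn2]
      linarith only [sq_nonneg (sP - √n * τ), e]
    have h3 : (sP ^ 2 + n * τ ^ 2) / (2 * τ) ≤ (2 * n * τ ^ 2 + ρ * n -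
        2 * κ * ∑ j, W j * (v j - V j) + κ ^ 2 * D) / (2 * τ) := by
      rw [h1, hexp]
      gcongr ?_ / (2 * τ)
      linarith
    have h4 : (2 * n * τ ^ 2 + ρ * n - 2 * κ * ∑ j, W j * (v j - V j) + κ ^ 2 * D) / (2 * τ) =
        n * τ + ρ * n / (2 * τ) - κ / τ * ∑ j, W j * (v j - V j) + κ ^ 2 * D / (2 * τ) := by
      field_simp
    have h5 : ρ * n / (2 * τ) ≤ 1 / (2 * σ) * (ρ * n) := by
      rw [one_div_mul_eq_div]; gcongr
    linarith
  have hgs : g * sP ≤ √n * sP + √(σ ^ 2 + R ^ 2) * (ρ * n) := by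
    have h1 : g * sP ≤ (1 + ρ) * √n * sP := by gcongr
    have h2 : ρ * √n * sP ≤ ρ * √n * (√n * √(σ ^ 2 + R ^ 2)) := by gcongr
    have h3 : ρ * √n * (√n * √(σ ^ 2 + R ^ 2)) = √(σ ^ 2 + R ^ 2) * (ρ * n) := by
      linear_combination ρ * √(σ ^ 2 + R ^ 2) * hsn2
    linarith
  have hh : h₀ * (√n * σ) ≤ σ * (ρ * n) := by
    have h1 : h₀ * (√n * σ) ≤ ρ * √n * (√n * σ) := by
      gcongr; exact (le_abs_self _).trans hh₀
    have h2 : ρ * √n * (√n * σ) = σ * (ρ * n) := by linear_combination ρ * σ * hsn2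
    linarith
  have hhw : ∑ j, h j * (W j - κ * (v j - V j)) =
      ∑ j, h j * W j - κ * ∑ j, h j * (v j - V j) := by
    rw [Finset.mul_sum, ← Finset.sum_sub_distrib]
    exact Finset.sum_congr rfl fun j _ => by ring
  have hkkt : κ * ∑ j, h j * (v j - V j) - κ / τ * ∑ j, W j * (v j - V j) =
      κ * lam / β * P := by
    rw [hP, Finset.mul_sum, Finset.mul_sum, Finset.mul_sum, ← Finset.sum_sub_distrib]
    refine Finset.sum_congr rfl fun j _ => ?_
    have := H.kkt j
    field_simp at this ⊢
    linear_combination (-(v j - V j)) * this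
  set y := κ * lam / β * P + κ ^ 2 * D / (2 * τ) with hy
  have hΨ : g * sP + (h₀ * (√n * σ) - ∑ j, h j * (W j - κ * (v j - V j))) ≤
      n * β + (C * (ρ * n) + y) := by
    have e : C * (ρ * n) = 1 / (2 * σ) * (ρ * n) + √(σ ^ 2 + R ^ 2) * (ρ * n) + ρ * n +
        σ * (ρ * n) := by rw [hC]; ring
    rw [hhw]
    linarith
  have hquad : r * (g * sP) + r * (h₀ * (√n * σ) - ∑ j, h j * (W j - κ * (v j - V j))) -
      n * r ^ 2 / 2 + n / 4 * (r - β) ^ 2 ≤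
      n * (β ^ 2 / 2) + β * (C * (ρ * n) + y) + (C * (ρ * n) + y) ^ 2 / n := by
    have h1 := mul_le_mul_of_nonneg_left hΨ hr
    set z := C * (ρ * n) + y
    have h2 : (r - β) * z - n / 4 * (r - β) ^ 2 ≤ z ^ 2 / n := by
      rw [le_div_iff₀ hn]
      linarith only [sq_nonneg (z - n / 2 * (r - β))]
    linarith
  have hsqz := sq_add_div_le (C := C) (τ := τ) hn hσ hβm hβ hστ hlam0 hlmax hρ hρ1 hν0 hκ hκ1 hD0 hD4 hP2
  rw [← hy] at hsqz
  have hβy : β * (C * (ρ * n) + y) ≤ τM * C * (ρ * n) + κ * lam * P + κ ^ 2 * (1 / 2) * D := by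
    have h1 : β * (C * (ρ * n)) ≤ τM * (C * (ρ * n)) := by gcongr; linarith
    have h2 : β * (κ * lam / β * P) = κ * lam * P := by field_simp
    have h3 : β * (κ ^ 2 * D / (2 * τ)) ≤ τ * (κ ^ 2 * D / (2 * τ)) := by gcongr
    have h4 : τ * (κ ^ 2 * D / (2 * τ)) = κ ^ 2 * (1 / 2) * D := by field_simp
    rw [hy, mul_add, mul_add, h2]
    linarith
  have hB : κ ^ 2 * (1 / 2) * D + κ ^ 2 * (3 * lmax ^ 2 * ν / βm ^ 2 + 3 * ν / σ ^ 2) * D ≤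
      κ * lmin / 2 * D := by
    have h1 := mul_le_mul_of_nonneg_left hκB (by positivity : 0 ≤ κ * D)
    linarith
  have hlamD : κ * lmin * D ≤ κ * lam * D := by gcongr
  have habs : lam * ∑ j, (|θ j + W j| - |θ j|) ≤ lam * (n * m₁) + lmax * (ρ * n) := by
    have h1 := mul_le_mul_of_nonneg_left (abs_le.1 H.sum_abs).2 hlam0.le
    have h2 : lam * (ρ * n) ≤ lmax * (ρ * n) := by gcongr
    linarith
  have hcoord := H.coordinate_upper hlmin hlam0 hκ ha ht hta hv
  linarith

end deterministic

theorem stdG_le_abs {s : ℝ} (hs : 0 ≤ s) :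
    stdG {x | s ≤ |x|} ≤ ENNReal.ofReal (2 * Real.exp (-(s ^ 2 / 2))) := by
  have h_int : ∀ t : ℝ, Integrable (fun x => Real.exp (t * id x)) stdG := fun t => by
    unfold stdG; exact integrable_exp_mul_gaussianReal t
  have hm : ∀ t : ℝ, mgf id stdG t = Real.exp (t ^ 2 / 2) := fun t => by
    unfold stdG; rw [mgf_id_gaussianReal]; simp
  have h1 := measure_ge_le_exp_mul_mgf (μ := stdG) (X := id) s hs (h_int s)
  have h2 := measure_le_le_exp_mul_mgf (μ := stdG) (X := id) (-s) (neg_nonpos.2 hs) (h_int (-s))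
  rw [hm, ← Real.exp_add] at h1 h2
  have e1 : -s * s + s ^ 2 / 2 = -(s ^ 2 / 2) := by ring
  have e2 : -(-s) * -s + (-s) ^ 2 / 2 = -(s ^ 2 / 2) := by ring
  rw [e1] at h1
  rw [e2] at h2
  have hsub : {x : ℝ | s ≤ |x|} ⊆ {x | s ≤ id x} ∪ {x | id x ≤ -s} := fun x hx => by
    rcases le_abs.1 (show s ≤ |x| from hx) with h | h
    · exact Or.inl h
    · exact Or.inr (show x ≤ -s by linarith)
  have h3 : stdG.real {x | s ≤ |x|} ≤ 2 * Real.exp (-(s ^ 2 / 2)) := by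
    refine (measureReal_mono hsub).trans ((measureReal_union_le _ _).trans ?_)
    linarith
  rw [← ofReal_measureReal]
  exact ENNReal.ofReal_le_ofReal h3

theorem stdG_Icc_le {p q : ℝ} (h : p ≤ q) : stdG.real (Set.Icc p q) ≤ (q - p) / 2 := by
  have hpdf : ∀ x, gaussianPDFReal 0 1 x ≤ 1 / 2 := by
    intro x
    rw [← gphi_eq, gphi]
    have h1 : (2 : ℝ) ≤ √(2 * Real.pi) := by
      rw [Real.le_sqrt' (by norm_num)]; nlinarith [Real.pi_gt_three]
    have h2 : Real.exp (-x ^ 2 / 2) ≤ 1 := Real.exp_le_one_iff.2 (by nlinarith [sq_nonneg x])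
    exact div_le_div₀ zero_le_one h2 two_pos h1
  rw [measureReal_def]
  refine ENNReal.toReal_le_of_le_ofReal (by linarith) ?_
  unfold stdG
  rw [gaussianReal_apply _ (by norm_num : (1 : ℝ≥0) ≠ 0)]
  calc ∫⁻ x in Set.Icc p q, gaussianPDF 0 1 x ≤ ∫⁻ _ in Set.Icc p q, ENNReal.ofReal (1 / 2) :=
        lintegral_mono fun x => ENNReal.ofReal_le_ofReal (hpdf x)
    _ = ENNReal.ofReal (1 / 2) * ENNReal.ofReal (q - p) := by
        rw [setLIntegral_const, Real.volume_Icc]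
    _ = _ := by rw [← ENNReal.ofReal_mul (by norm_num)]; congr 1; ring

theorem stdG_abs_mem_le {t τ c d : ℝ} (hτ : 0 < τ) (hcd : c ≤ d) :
    stdG.real {x | c ≤ |t + τ * x| ∧ |t + τ * x| ≤ d} ≤ (d - c) / τ := by
  have hsub : {x | c ≤ |t + τ * x| ∧ |t + τ * x| ≤ d} ⊆
      Set.Icc ((c - t) / τ) ((d - t) / τ) ∪ Set.Icc ((-d - t) / τ) ((-c - t) / τ) := by
    rintro x ⟨h1, h2⟩
    simp only [Set.mem_union, Set.mem_Icc, div_le_iff₀ hτ, le_div_iff₀ hτ]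
    have h3 := abs_le.1 h2
    rcases le_abs.1 h1 with h | h
    · left; constructor <;> linarith
    · right; constructor <;> linarith
  refine (measureReal_mono hsub).trans ((measureReal_union_le _ _).trans ?_)
  have h1 := stdG_Icc_le (p := (c - t) / τ) (q := (d - t) / τ) (by gcongr)
  have h2 := stdG_Icc_le (p := (-d - t) / τ) (q := (-c - t) / τ) (by gcongr)
  have e : (d - c) / τ = ((d - t) / τ - (c - t) / τ) / 2 + ((-c - t) / τ - (-d - t) / τ) / 2 := by
    field_simp; ring
  rw [e]
  exact add_le_add h1 h2

theorem measurable_ite_abs_evoErr (t τ b a : ℝ) (hb : 0 < b) :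
    Measurable fun x => if |t + evoErr t τ b x| < a then (1 : ℝ) else 0 :=
  Measurable.ite (measurableSet_lt (((continuous_evoErr hb).measurable.const_add t).norm)
    measurable_const) measurable_const measurable_const

theorem measurable_ite_abs_evoSub (t τ b a : ℝ) :
    Measurable fun x => if 1 - a < |evoSub t τ b x| then (1 : ℝ) else 0 :=
  Measurable.ite (measurableSet_lt measurable_const (continuous_evoSub.measurable.norm))
    measurable_const measurable_const

theorem integrable_stdG_of_mem_unit {f : ℝ → ℝ} (hf : Measurable f)
    (h : ∀ x, 0 ≤ f x ∧ f x ≤ 1) : Integrable f stdG :=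
  Integrable.of_bound hf.aestronglyMeasurable 1
    (Filter.Eventually.of_forall fun x => by
      rw [Real.norm_eq_abs, abs_of_nonneg (h x).1]; exact (h x).2)

theorem ite_one_zero_mem (p : Prop) [Decidable p] :
    0 ≤ (if p then (1 : ℝ) else 0) ∧ (if p then (1 : ℝ) else 0) ≤ 1 := by
  split_ifs <;> norm_num

theorem integral_ite_abs_mem_le {t τ c d : ℝ} (hτ : 0 < τ) (hcd : c ≤ d) :
    Integrable (fun x => if c ≤ |t + τ * x| ∧ |t + τ * x| ≤ d then (1 : ℝ) else 0) stdG ∧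
    ∫ x, (if c ≤ |t + τ * x| ∧ |t + τ * x| ≤ d then (1 : ℝ) else 0) ∂stdG ≤ (d - c) / τ := by
  have hmeas : MeasurableSet {x : ℝ | c ≤ |t + τ * x| ∧ |t + τ * x| ≤ d} :=
    (measurableSet_le (f := fun _ => c) (g := fun x : ℝ => |t + τ * x|) (by fun_prop)
      (by fun_prop)).inter (measurableSet_le (f := fun x : ℝ => |t + τ * x|) (g := fun _ => d)
      (by fun_prop) (by fun_prop))
  refine ⟨integrable_stdG_of_mem_unit (Measurable.ite hmeas measurable_const measurable_const)
    fun x => ite_one_zero_mem _, ?_⟩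
  refine le_trans (le_of_eq ?_) (stdG_abs_mem_le (t := t) hτ hcd)
  rw [← integral_indicator_one hmeas]
  exact integral_congr_ae (Filter.Eventually.of_forall fun x => by
    simp [Set.indicator_apply])

theorem integral_ite_abs_evoErr_le {t τ b a : ℝ} (hb : 0 < b) (hτ : 0 < τ) (ha : 0 < a) :
    ∫ x, (if |t + evoErr t τ b x| < a then (1 : ℝ) else 0) ∂stdG ≤
      1 - ∫ x, eta' (t + τ * x) b ∂stdG + a / τ := by
  obtain ⟨i3, h3⟩ := integral_ite_abs_mem_le (t := t) hτ (by linarith : b ≤ b + a)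
  rw [add_sub_cancel_left] at h3
  have i2 := integrable_eta' t τ b
  have i12 : Integrable (fun x => 1 - eta' (t + τ * x) b) stdG := (integrable_const 1).sub i2
  have e : ∫ x, (1 - eta' (t + τ * x) b +
      if b ≤ |t + τ * x| ∧ |t + τ * x| ≤ b + a then (1 : ℝ) else 0) ∂stdG =
      1 - ∫ x, eta' (t + τ * x) b ∂stdG +
      ∫ x, (if b ≤ |t + τ * x| ∧ |t + τ * x| ≤ b + a then (1 : ℝ) else 0) ∂stdG := by
    rw [integral_add i12 i3, integral_sub (integrable_const 1) i2]; simp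
  refine le_trans (integral_mono (integrable_stdG_of_mem_unit (measurable_ite_abs_evoErr _ _ _ _ hb)
    fun x => ite_one_zero_mem _) (i12.add i3) fun x => ?_) (by
      simp only [Pi.add_apply]
      rw [e]; linarith)
  simp only [Pi.add_apply, eta', evoErr, add_sub_cancel]
  have key : |eta (t + τ * x) b| < a → |t + τ * x| < b + a := by
    intro h
    by_contra hc
    rw [not_lt] at hc
    have h0 : t + τ * x ≠ 0 := by
      intro h0; rw [h0, abs_zero] at hc; linarith
    rw [eta, abs_mul, max_eq_left (by linarith), abs_of_nonneg (by linarith : 0 ≤ |t + τ * x| - b)] at h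
    have : |Real.sign (t + τ * x)| = 1 := by
      rcases Real.sign_apply_eq_of_ne_zero _ h0 with h | h <;> rw [h] <;> simp
    rw [this] at h
    linarith
  by_cases h1 : |eta (t + τ * x) b| < a
  · rw [if_pos h1]
    by_cases h2 : b < |t + τ * x|
    · rw [if_pos h2, if_pos ⟨h2.le, (key h1).le⟩]; norm_num
    · rw [if_neg h2, sub_zero]
      exact le_add_of_nonneg_right (ite_one_zero_mem _).1
  · rw [if_neg h1]
    exact add_nonneg (sub_nonneg.2 (ite_one_zero_mem _).2) (ite_one_zero_mem _).1

theorem integral_ite_abs_evoSub_le {t τ b a : ℝ} (hb : 0 < b) (hτ : 0 < τ) (ha : 0 < a) :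
    ∫ x, (if 1 - a < |evoSub t τ b x| then (1 : ℝ) else 0) ∂stdG ≤
      ∫ x, eta' (t + τ * x) b ∂stdG + b * a / τ := by
  have hba : b * (1 - a) ≤ b := mul_le_of_le_one_right hb.le (by linarith)
  obtain ⟨i3, h3⟩ := integral_ite_abs_mem_le (t := t) hτ hba
  have e0 : b - b * (1 - a) = b * a := by ring
  rw [e0] at h3
  have i2 := integrable_eta' t τ b
  have e := integral_add i2 i3
  refine le_trans (integral_mono (integrable_stdG_of_mem_unit (measurable_ite_abs_evoSub _ _ _ _)
    fun x => ite_one_zero_mem _) (i2.add i3) fun x => ?_) (by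
      simp only [Pi.add_apply]
      rw [e]; linarith)
  simp only [Pi.add_apply, eta']
  have key : 1 - a < |evoSub t τ b x| → b * (1 - a) ≤ |t + τ * x| := by
    intro h
    rw [evoSub] at h
    by_contra hc
    rw [not_le] at hc
    have h1 : |(t + τ * x) / b| < 1 - a := by
      rw [abs_div, abs_of_pos hb, div_lt_iff₀ hb]; linarith
    rw [clip1_of_abs_le (by linarith)] at h
    linarith
  by_cases h1 : 1 - a < |evoSub t τ b x|
  · rw [if_pos h1]
    by_cases h2 : b < |t + τ * x|
    · rw [if_pos h2]
      exact le_add_of_nonneg_right (ite_one_zero_mem _).1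
    · rw [if_neg h2, if_pos ⟨key h1, not_lt.1 h2⟩, zero_add]
  · rw [if_neg h1]
    exact add_nonneg (ite_one_zero_mem _).1 (ite_one_zero_mem _).1

theorem bernstein_option {K δ : ℝ} (hK : 0 < K) (hδ : 0 < δ) : ∃ c : ℝ, 0 < c ∧
    ∀ N : ℕ, 0 < N → ∀ F : Fin N → ℝ → ℝ, (∀ j, Measurable (F j)) →
    (∀ j x, |F j x| ≤ K * (1 + x ^ 2)) → ∀ ρ ∈ Set.Ioc (0 : ℝ) 1,
    gpi (Option (Fin N)) {h | ρ * (δ * N) ≤ |∑ j, F j (h (some j)) - ∑ j, ∫ x, F j x ∂stdG|} ≤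
      ENNReal.ofReal (2 * Real.exp (-(c * N * ρ ^ 2))) := by
  obtain ⟨c, hc, H⟩ := bernstein_stdG hK
  set δ' := min (δ / 2) 1 with hδ'
  have hδ'0 : 0 < δ' := lt_min (by positivity) one_pos
  refine ⟨c * δ' ^ 2, by positivity, fun N hN F hF hb ρ hρ => ?_⟩
  have h1 := H (fun o : Option (Fin N) => o.elim (fun _ => 0) F)
    (by rintro (_ | j); exacts [measurable_const, hF j])
    (by
      rintro (_ | j) x
      · simp only [Option.elim_none, abs_zero]; positivity
      · exact hb j x)
    (ρ * δ') ⟨mul_pos hρ.1 hδ'0, mul_le_one₀ hρ.2 hδ'0.le (min_le_right _ _)⟩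
  have hN1 : (1 : ℝ) ≤ N := by exact_mod_cast hN
  have hcard : (Fintype.card (Option (Fin N)) : ℝ) = N + 1 := by simp
  rw [hcard] at h1
  refine (measure_mono fun h hh => ?_).trans (h1.trans (ENNReal.ofReal_le_ofReal ?_))
  · simp only [Set.mem_ofPred_eq, Fintype.sum_option, Option.elim_none, Option.elim_some,
      integral_zero, zero_add, Finset.sum_sub_distrib] at hh ⊢
    refine le_trans ?_ hh
    have h2 : δ' * (N + 1) ≤ δ / 2 * (2 * N) := by
      have : δ' ≤ δ / 2 := min_le_left _ _
      gcongr; linarith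
    have h3 := mul_le_mul_of_nonneg_left h2 hρ.1.le
    linarith
  · gcongr 2 * Real.exp (-?_)
    have : 0 ≤ c * (ρ * δ') ^ 2 := by positivity
    linarith

/-- Normalized mean increment of the `ℓ¹` norm under scalar soft thresholding. -/
def evoMean {N : ℕ} (n : ℝ) (θ : Fin N → ℝ) (τ b : ℝ) : ℝ :=
  (∑ j, ∫ x, (|θ j + evoErr (θ j) τ b x| - |θ j|) ∂stdG) / n

/-- Typical realizations of the Gaussian vector driving the scalar estimators; the coordinate
`none` is paired with the noise direction. -/
def EvoTypical {N : ℕ} (n δ σ lam β τ A a ρ : ℝ) (θ : Fin N → ℝ) (h : Option (Fin N) → ℝ) : Prop :=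
  |h none| ≤ ρ * √n ∧
  AOGood n σ lam β τ (evoMean n θ τ (τ * lam / β)) (1 / δ - (1 - β / τ) + A * a)
    (1 - β / τ + A * a) a ρ θ (fun j => h (some j))
    (fun j => evoErr (θ j) τ (τ * lam / β) (h (some j)))
    (fun j => evoSub (θ j) τ (τ * lam / β) (h (some j)))

theorem gpi_none_le {N : ℕ} {s : ℝ} (hs : 0 ≤ s) :
    gpi (Option (Fin N)) {h | s ≤ |h none|} ≤ ENNReal.ofReal (2 * Real.exp (-(s ^ 2 / 2))) := by
  have h1 := (measurePreserving_eval_gpi (none : Option (Fin N))).measure_preimage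
    (s := {x | s ≤ |x|})
    (measurableSet_le (f := fun _ => s) (g := fun x : ℝ => |x|) (by fun_prop)
      (by fun_prop)).nullMeasurableSet
  exact h1.trans_le (stdG_le_abs hs)

theorem measure_compl_evoTypical_le {δ σ lmin lmax τM βm : ℝ} (hδ : 0 < δ) (hσ : 0 < σ)
    (hl : 0 < lmin) (hll : lmin ≤ lmax) (hτM : 0 < τM) (hβm : 0 < βm) :
    ∃ A c : ℝ, 0 < A ∧ 0 < c ∧ ∀ N : ℕ, 0 < N → ∀ θ : Fin N → ℝ, ∀ lam ∈ Set.Icc lmin lmax,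
      ∀ β τ : ℝ, EvoSys (δ * N) σ lam β τ θ → σ ≤ τ → τ ≤ τM → βm ≤ β →
      ∀ a ρ : ℝ, 0 < ρ → ρ ≤ 1 → ρ ≤ a →
      gpi (Option (Fin N)) {h | ¬ EvoTypical (δ * N) δ σ lam β τ A a ρ θ h} ≤
        ENNReal.ofReal (12 * Real.exp (-(c * N * ρ ^ 2))) := by
  have hlmax : 0 < lmax := hl.trans_le hll
  set bM := τM * lmax / βm with hbM
  have hbM0 : 0 < bM := by positivity
  set K := 2 * (τM ^ 2 + bM ^ 2) + (τM + bM) + 1 with hK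
  have hK0 : 0 < K := by positivity
  obtain ⟨c₀, hc₀, H⟩ := bernstein_option hK0 hδ
  set A := lmax / (βm * δ) + 1 / (δ * σ) + 1 with hA
  have hA0 : 0 < A := by positivity
  refine ⟨A, min c₀ (δ / 2), hA0, lt_min hc₀ (by positivity),
    fun N hN θ lam hlam β τ hE hστ hτ hβ a ρ hρ hρ1 hρa => ?_⟩
  have hN0 : (0 : ℝ) < N := by exact_mod_cast hN
  have hβ0 := hE.β_pos
  have hτ0 := hE.τ_pos
  have hlam0 : 0 < lam := hl.trans_le hlam.1
  have ha : 0 < a := hρ.trans_le hρa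
  set n := δ * (N : ℝ) with hn
  have hn0 : 0 < n := by positivity
  set b := τ * lam / β with hb
  have hb0 : 0 < b := by positivity
  have hbbM : b ≤ bM := div_le_div₀ (by positivity) (mul_le_mul hτ hlam.2 hlam0.le hτM.le) hβm hβ
  have hlin : τ + b ≤ K := by
    have : 0 ≤ 2 * (τM ^ 2 + bM ^ 2) := by positivity
    linarith
  have hsq : 2 * (τ ^ 2 + b ^ 2) ≤ K := by
    have h1 : τ ^ 2 ≤ τM ^ 2 := by gcongr
    have h2 : b ^ 2 ≤ bM ^ 2 := by gcongr
    linarith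
  have hone : 1 ≤ K := by
    have : 0 ≤ 2 * (τM ^ 2 + bM ^ 2) := by positivity
    linarith
  have up : ∀ {C x : ℝ}, C ≤ K → C * (1 + x ^ 2) ≤ K * (1 + x ^ 2) := fun h => by gcongr
  have hind : ∀ (p : Prop) [Decidable p] (x : ℝ), |if p then (1 : ℝ) else 0| ≤ K * (1 + x ^ 2) := by
    intro p _ x
    rw [abs_of_nonneg (ite_one_zero_mem p).1]
    refine (ite_one_zero_mem p).2.trans (le_trans ?_ (up (x := x) hone))
    linarith [sq_nonneg x]
  have mE : ∀ j, Measurable (evoErr (θ j) τ b) := fun j => (continuous_evoErr hb0).measurable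
  have B₁ := H N hN (fun j x => evoErr (θ j) τ b x ^ 2) (fun j => (mE j).pow_const 2)
    (fun j x => (abs_evoErr_sq_le hb0 hτ0 x).trans (up hsq)) ρ ⟨hρ, hρ1⟩
  have B₂ := H N hN (fun j x => x * evoErr (θ j) τ b x) (fun j => measurable_id.mul (mE j))
    (fun j x => (abs_mul_evoErr_le hb0 hτ0 x).trans (up hlin)) ρ ⟨hρ, hρ1⟩
  have B₃ := H N hN (fun j x => |θ j + evoErr (θ j) τ b x| - |θ j|)
    (fun j => ((mE j).const_add _).norm.sub_const _)
    (fun j x => (abs_abs_add_evoErr_sub_le hb0 hτ0 x).trans (up hlin)) ρ ⟨hρ, hρ1⟩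
  have B₄ := H N hN (fun j x => if |θ j + evoErr (θ j) τ b x| < a then (1 : ℝ) else 0)
    (fun j => measurable_ite_abs_evoErr _ _ _ _ hb0) (fun j x => hind _ x) ρ ⟨hρ, hρ1⟩
  have B₅ := H N hN (fun j x => if 1 - a < |evoSub (θ j) τ b x| then (1 : ℝ) else 0)
    (fun j => measurable_ite_abs_evoSub _ _ _ _) (fun j x => hind _ x) ρ ⟨hρ, hρ1⟩
  have B₀ := gpi_none_le (N := N) (s := ρ * √n) (by positivity)
  set U := ENNReal.ofReal (2 * Real.exp (-(min c₀ (δ / 2) * N * ρ ^ 2))) with hU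
  have hU₁ : ENNReal.ofReal (2 * Real.exp (-(c₀ * N * ρ ^ 2))) ≤ U := by
    refine ENNReal.ofReal_le_ofReal ?_
    gcongr 2 * Real.exp (-(?_ * N * ρ ^ 2))
    exact min_le_left _ _
  have hU₀ : ENNReal.ofReal (2 * Real.exp (-((ρ * √n) ^ 2 / 2))) ≤ U := by
    refine ENNReal.ofReal_le_ofReal ?_
    have e : (ρ * √n) ^ 2 / 2 = δ / 2 * N * ρ ^ 2 := by
      rw [mul_pow, Real.sq_sqrt hn0.le]; ring
    rw [e]
    gcongr 2 * Real.exp (-(?_ * N * ρ ^ 2))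
    exact min_le_right _ _
  have e12 : ENNReal.ofReal (12 * Real.exp (-(min c₀ (δ / 2) * N * ρ ^ 2))) =
      U + (U + (U + (U + (U + U)))) := by
    rw [hU]
    simp only [← ENNReal.ofReal_add (by positivity : 0 ≤ 2 * Real.exp (-(min c₀ (δ / 2) * N * ρ ^ 2)))
      (by positivity : 0 ≤ 2 * Real.exp (-(min c₀ (δ / 2) * N * ρ ^ 2)))]
    repeat rw [← ENNReal.ofReal_add (by positivity) (by positivity)]
    congr 1; ring
  rw [e12]
  refine le_trans (measure_mono (t := _ ∪ (_ ∪ (_ ∪ (_ ∪ (_ ∪ _))))) ?_)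
    ((measure_union_le _ _).trans (add_le_add (B₀.trans hU₀)
    ((measure_union_le _ _).trans (add_le_add (B₁.trans hU₁)
    ((measure_union_le _ _).trans (add_le_add (B₂.trans hU₁)
    ((measure_union_le _ _).trans (add_le_add (B₃.trans hU₁)
    ((measure_union_le _ _).trans (add_le_add (B₄.trans hU₁) (B₅.trans hU₁)))))))))))
  intro h hh
  by_contra hc
  simp only [Set.mem_union, Set.mem_ofPred_eq, not_or, not_le] at hc
  obtain ⟨c0, c1, c2, c3, c4, c5⟩ := hc
  rw [hE.sum_sq] at c1
  rw [hE.sum_mul] at c2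
  have hNn : (N : ℝ) = n * (1 / δ) := by rw [hn]; field_simp
  refine hh ⟨c0.le, ?_, fun j => abs_evoSub_le _, fun j => evoSub_mul hb0 _, c1.le, c2.le, ?_,
    ?_, ?_⟩
  · intro j
    rw [evoErr_eq hb0]
    simp only [hb]
    field_simp
    ring
  · rw [evoMean, mul_div_cancel₀ _ hn0.ne']
    exact c3.le
  · rw [card_filter_eq_sum]
    have h1 : ∑ j, ∫ x, (if |θ j + evoErr (θ j) τ b x| < a then (1 : ℝ) else 0) ∂stdG ≤
        N - n * (1 - β / τ) + N * (a / σ) := by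
      calc _ ≤ ∑ j, (1 - ∫ x, eta' (θ j + τ * x) b ∂stdG + a / σ) :=
            Finset.sum_le_sum fun j _ => (integral_ite_abs_evoErr_le hb0 hτ0 ha).trans (by gcongr)
        _ = _ := by
            rw [Finset.sum_add_distrib, Finset.sum_sub_distrib, hE.sum_prob]; simp
    have h2 := (abs_lt.1 c4).2
    have h3 : ρ * n ≤ a * n := by gcongr
    have h4 : n * (1 / δ) * (a / σ) + a * n ≤ n * (A * a) := by
      have e : n * (A * a) = n * (1 / δ) * (a / σ) + a * n + n * (lmax / (βm * δ) * a) := by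
        rw [hA]; field_simp; ring
      rw [e]
      exact le_add_of_nonneg_right (by positivity)
    rw [hNn] at h1
    linarith
  · rw [card_filter_eq_sum]
    have h1 : ∑ j, ∫ x, (if 1 - a < |evoSub (θ j) τ b x| then (1 : ℝ) else 0) ∂stdG ≤
        n * (1 - β / τ) + N * (lmax / βm * a) := by
      calc _ ≤ ∑ j, (∫ x, eta' (θ j + τ * x) b ∂stdG + lmax / βm * a) :=
            Finset.sum_le_sum fun j _ => (integral_ite_abs_evoSub_le hb0 hτ0 ha).trans (by
              have e : b * a / τ = lam / β * a := by rw [hb]; field_simp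
              rw [e]
              have : lam / β ≤ lmax / βm := div_le_div₀ hlmax.le hlam.2 hβm hβ
              gcongr)
        _ = _ := by
            rw [Finset.sum_add_distrib, hE.sum_prob]; simp
    have h2 := (abs_lt.1 c5).2
    have h3 : ρ * n ≤ a * n := by gcongr
    have h4 : n * (1 / δ) * (lmax / βm * a) + a * n ≤ n * (A * a) := by
      have e : n * (A * a) = n * (1 / δ) * (lmax / βm * a) + a * n + n * (1 / (δ * σ) * a) := by
        rw [hA]; field_simp; ring
      rw [e]
      exact le_add_of_nonneg_right (by positivity)
    rw [hNn] at h1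
    linarith

/-- Concentration of the Euclidean norm of a standard Gaussian vector. -/
theorem measure_l2_compl_le {δ : ℝ} (hδ : 0 < δ) : ∃ c : ℝ, 0 < c ∧
    ∀ N n : ℕ, (n : ℝ) = δ * N → ∀ ρ ∈ Set.Ioc (0 : ℝ) 1,
    gpi (Fin n) {g | ¬ ((1 - ρ) * √n ≤ l2 g ∧ l2 g ≤ (1 + ρ) * √n)} ≤
      ENNReal.ofReal (2 * Real.exp (-(c * N * ρ ^ 2))) := by
  obtain ⟨c, hc, H⟩ := bernstein_stdG one_pos
  refine ⟨c * δ, by positivity, fun N n hn ρ hρ => ?_⟩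
  have h1 := H (fun (_ : Fin n) x => x ^ 2) (fun _ => by fun_prop) (fun _ x => by
    rw [abs_of_nonneg (sq_nonneg x)]; linarith) ρ hρ
  simp only [Fintype.card_fin, integral_sq_stdG, Finset.sum_sub_distrib, Finset.sum_const,
    Finset.card_univ, nsmul_eq_mul, mul_one] at h1
  have e : c * n * ρ ^ 2 = c * δ * N * ρ ^ 2 := by rw [hn]; ring
  rw [e] at h1
  refine (measure_mono fun g hg => ?_).trans h1
  by_contra hc
  refine hg ?_
  rw [Set.mem_ofPred_eq, not_le, ← l2_sq] at hc
  obtain ⟨h2, h3⟩ := abs_lt.1 hc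
  have hn0 : (0 : ℝ) ≤ n := Nat.cast_nonneg _
  have hs : √(n : ℝ) ^ 2 = n := Real.sq_sqrt hn0
  have hρ2 : ρ ^ 2 ≤ ρ := by nlinarith only [hρ.1, hρ.2]
  have h4 : (n : ℝ) * ρ ^ 2 ≤ n * ρ := by gcongr
  have h5 : 0 ≤ (n : ℝ) * ρ := mul_nonneg hn0 hρ.1.le
  constructor
  · refine le_of_sq_le_sq ?_ (l2_nonneg g)
    rw [mul_pow, hs]
    linarith
  · have h6 : 0 ≤ (1 + ρ) * √(n : ℝ) := mul_nonneg (by linarith [hρ.1]) (Real.sqrt_nonneg _)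
    refine le_of_sq_le_sq ?_ h6
    rw [mul_pow, hs]
    have := mul_nonneg hn0 (sq_nonneg ρ)
    linarith

/-- The standard Gaussian array encoded by a design matrix and a noise vector. -/
def modelArray {n N : ℕ} (ω : (Fin n → Fin N → ℝ) × (Fin n → ℝ)) (i : Fin n) :
    Option (Fin N) → ℝ
  | none => ω.2 i
  | some j => √n * ω.1 i j

theorem measure_preimage_modelArray {n N : ℕ} (hn : 0 < n) {γ : Type*} [Fintype γ]
    (e : γ ≃ Fin n × Option (Fin N)) (S : Set (γ → ℝ)) :
    Pmodel n N ((fun ω c => modelArray ω (e c).1 (e c).2) ⁻¹' S) ≤ gpi γ S := by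
  have hn' : (0 : ℝ) < √n := Real.sqrt_pos.2 (by exact_mod_cast hn)
  have hm : Measurable fun (ω : (Fin n → Fin N → ℝ) × (Fin n → ℝ)) c =>
      modelArray ω (e c).1 (e c).2 := by
    refine measurable_pi_iff.2 fun c => ?_
    rcases e c with ⟨i, _ | j⟩ <;> simp only [modelArray] <;> fun_prop
  have hscale : (gaussianReal 0 ((n : ℝ≥0))⁻¹).map (fun x => √n * x) = stdG := by
    rw [gaussianReal_map_const_mul, stdG]
    congr 1
    · simp
    · ext
      simp [Real.sq_sqrt, hn.ne']
  have key : gpi γ = (Pmodel n N).map fun ω c => modelArray ω (e c).1 (e c).2 := by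
    have : IsProbabilityMeasure (PX n N) := by unfold PX; infer_instance
    have : IsProbabilityMeasure (Pz n) := by unfold Pz; infer_instance
    refine Measure.pi_eq fun s hs => ?_
    rw [Measure.map_apply hm (MeasurableSet.univ_pi hs)]
    have hpre : (fun (ω : (Fin n → Fin N → ℝ) × (Fin n → ℝ)) c =>
        modelArray ω (e c).1 (e c).2) ⁻¹' Set.univ.pi s =
        (Set.univ.pi fun i => Set.univ.pi fun j => (fun x => √n * x) ⁻¹' s (e.symm (i, some j))) ×ˢ
          (Set.univ.pi fun i => s (e.symm (i, none))) := by
      ext ω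
      simp only [Set.mem_preimage, Set.mem_pi, Set.mem_univ, true_imp_iff, Set.mem_prod]
      constructor
      · intro h
        exact ⟨fun i j => by simpa [modelArray] using h (e.symm (i, some j)),
          fun i => by simpa [modelArray] using h (e.symm (i, none))⟩
      · rintro ⟨h1, h2⟩ c
        obtain ⟨⟨i, o⟩, rfl⟩ := e.symm.surjective c
        rcases o with _ | j
        · simpa [modelArray] using h2 i
        · simpa [modelArray] using h1 i j
    rw [hpre, Pmodel, Measure.prod_prod, PX, Pz, Measure.pi_pi, Measure.pi_pi,
      ← e.symm.prod_comp, Fintype.prod_prod_type]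
    simp_rw [Fintype.prod_option, Finset.prod_mul_distrib]
    rw [mul_comm]
    congr 1
    refine Finset.prod_congr rfl fun i _ => ?_
    rw [Measure.pi_pi]
    refine Finset.prod_congr rfl fun j _ => ?_
    rw [← hscale, Measure.map_apply (by fun_prop) (hs _)]
  rw [key]
  exact Measure.le_map_apply hm.aemeasurable S

theorem isBounded_pi_of_abs_le {ι : Type*} [Fintype ι] (B : ℝ) :
    Bornology.IsBounded {x : ι → ℝ | ∀ i, |x i| ≤ B} := by
  refine (Metric.isBounded_closedBall (x := (0 : ι → ℝ)) (r := max B 0)).subset fun x hx => ?_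
  rw [mem_closedBall_zero_iff, pi_norm_le_iff_of_nonneg (le_max_right _ _)]
  exact fun i => (hx i).trans (le_max_left _ _)

theorem isBounded_abs_le (B : ℝ) : Bornology.IsBounded {x : ℝ | |x| ≤ B} := by
  refine (Metric.isBounded_Icc (-B) B).subset fun x hx => abs_le.1 hx

theorem abs_le_of_sum_sq_le {ι : Type*} [Fintype ι] {x : ι → ℝ} {B : ℝ}
    (h : ∑ i, x i ^ 2 ≤ B) (i : ι) : |x i| ≤ √B :=
  Real.abs_le_sqrt ((Finset.single_le_sum (f := fun i => x i ^ 2) (fun _ _ => sq_nonneg _)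
    (Finset.mem_univ i)).trans h)

theorem abs_le_of_l2_le {ι : Type*} [Fintype ι] {x : ι → ℝ} {B : ℝ}
    (h : l2 x ≤ B) (i : ι) : |x i| ≤ B := by
  refine le_trans ?_ h
  exact abs_le_of_sum_sq_le le_rfl i

theorem l2_smul {ι : Type*} [Fintype ι] {c : ℝ} (hc : 0 ≤ c) (x : ι → ℝ) :
    l2 (fun i => c * x i) = c * l2 x := by
  unfold l2
  simp_rw [mul_pow, ← Finset.mul_sum]
  rw [Real.sqrt_mul (sq_nonneg c), Real.sqrt_sq hc]

/-- Primal comparison: a lower bound valid for the decoupled cost is, up to a factor two in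
probability, valid for the Lasso cost. -/
theorem measure_primal_le {n N : ℕ} (hn : 0 < n) {σ lam β R r : ℝ} (θ : Fin N → ℝ)
    (hβ : 0 < β) (hr : 0 < r) (f : (Fin N → ℝ) → ℝ) {B : ℝ}
    (hf : ∀ w : Fin N → ℝ, ∑ j, w j ^ 2 ≤ n * R ^ 2 → |f w| ≤ B)
    (E : Set ((Fin n → ℝ) × (Option (Fin N) → ℝ)))
    (hE : ∀ p ∈ E, 0 < l2 p.1 ∧ ∀ w : Fin N → ℝ, ∑ j, w j ^ 2 ≤ n * R ^ 2 → f w + r ≤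
      β * (l2 p.1 * √(n * σ ^ 2 + ∑ j, w j ^ 2)) +
        β * (p.2 none * (√n * σ) - ∑ j, p.2 (some j) * w j) - n * β ^ 2 / 2 +
        lam * ∑ j, (|θ j + w j| - |θ j|)) :
    Pmodel n N {ω | ∃ w : Fin N → ℝ, ∑ j, w j ^ 2 ≤ n * R ^ 2 ∧
      (∑ i, (σ * ω.2 i - ∑ j, ω.1 i j * w j) ^ 2) / 2 + lam * ∑ j, (|θ j + w j| - |θ j|) ≤ f w} ≤
      2 * ((gpi (Fin n)).prod (gpi (Option (Fin N)))) Eᶜ := by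
  have hn' : (0 : ℝ) < n := by exact_mod_cast hn
  have hsn : 0 < √(n : ℝ) := Real.sqrt_pos.2 hn'
  have hsn2 : √(n : ℝ) ^ 2 = n := Real.sq_sqrt hn'.le
  set dir : (Fin N → ℝ) → Option (Fin N) → ℝ := fun w o => o.elim (√n * σ) (fun j => -w j) with hdir
  set cst : (Fin N → ℝ) → ℝ := fun w =>
    -(n * β ^ 2 / 2) + lam * ∑ j, (|θ j + w j| - |θ j|) - f w with hcst
  set S : Set ((Option (Fin N) → ℝ) × (Fin n → ℝ) × ℝ) :=
    (fun w => (dir w, 0, cst w)) '' {w | ∑ j, w j ^ 2 ≤ n * R ^ 2} with hS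
  set T : Set ((Fin n → ℝ) × ℝ) := {t | l2 t.1 = β ∧ t.2 = 0} with hT
  have hl2 : ∀ w, l2 (dir w) = √(n * σ ^ 2 + ∑ j, w j ^ 2) := by
    intro w
    simp only [l2, hdir, Fintype.sum_option, Option.elim_none, Option.elim_some, neg_sq, mul_pow,
      hsn2]
  have hSb : Bornology.IsBounded S := by
    refine (((isBounded_pi_of_abs_le (max |√n * σ| (√(n * R ^ 2)))).prod
      ((Bornology.isBounded_singleton (x := (0 : Fin n → ℝ))).prod (isBounded_abs_le
        (n * β ^ 2 / 2 + |lam| * (N * √(n * R ^ 2)) + B))))).subset ?_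
    rintro _ ⟨w, hw, rfl⟩
    refine ⟨?_, rfl, ?_⟩
    · rintro (_ | j)
      · exact le_max_left _ _
      · refine le_trans ?_ (le_max_right _ _)
        simpa [hdir] using abs_le_of_sum_sq_le hw j
    · have h1 : |∑ j, (|θ j + w j| - |θ j|)| ≤ N * √(n * R ^ 2) := by
        refine (Finset.abs_sum_le_sum_abs _ _).trans ?_
        calc ∑ j, |(|θ j + w j| - |θ j|)| ≤ ∑ _j : Fin N, √(n * R ^ 2) := by
              refine Finset.sum_le_sum fun j _ => ?_
              refine (abs_abs_sub_abs_le _ _).trans ?_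
              rw [add_sub_cancel_left]
              exact abs_le_of_sum_sq_le hw j
          _ = _ := by simp
      have h2 : |lam * ∑ j, (|θ j + w j| - |θ j|)| ≤ |lam| * (N * √(n * R ^ 2)) := by
        rw [abs_mul]; gcongr
      have h3 := abs_le.1 h2
      have h4 := abs_le.1 (hf w hw)
      have h5 : 0 ≤ n * β ^ 2 / 2 := by positivity
      simp only [Set.mem_ofPred_eq, hcst]
      rw [abs_le]
      constructor <;> linarith [h3.1, h3.2, h4.1, h4.2]
  have hTb : Bornology.IsBounded T := by
    refine ((isBounded_pi_of_abs_le β).prod (Bornology.isBounded_singleton (x := (0 : ℝ)))).subset ?_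
    rintro ⟨u, x⟩ ⟨h1, h2⟩
    exact ⟨fun i => abs_le_of_l2_le (le_of_eq h1) i, h2⟩
  have key := gordon_bounded S T hSb hTb E hr (by
    rintro ⟨g, h⟩ hp _ ⟨w, hw, rfl⟩
    obtain ⟨hg, hlow⟩ := hE _ hp
    refine ⟨(fun i => β / l2 g * g i, 0), ⟨?_, rfl⟩, ?_⟩
    · rw [l2_smul (by positivity)]
      exact div_mul_cancel₀ _ hg.ne'
    · have h1 := hlow w hw
      simp only [gordonAO, hl2]
      rw [l2_smul (by positivity), div_mul_cancel₀ _ hg.ne']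
      have h2 : ∑ k, g k * (β / l2 g * g k) = β * l2 g := by
        have : ∀ k, g k * (β / l2 g * g k) = β / l2 g * g k ^ 2 := fun k => by ring
        simp_rw [this]
        rw [← Finset.mul_sum, ← l2_sq]
        field_simp
      have h3 : ∑ m, h m * dir w m = h none * (√n * σ) - ∑ j, h (some j) * w j := by
        simp [hdir, Fintype.sum_option, sub_eq_add_neg]
      rw [h2, h3]
      simp only [hcst, Pi.zero_apply, zero_mul, Finset.sum_const_zero]
      simp only at h1
      linarith)
  refine le_trans ?_ key
  refine le_trans (measure_mono ?_) (measure_preimage_modelArray hn (Equiv.refl _) _)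
  rintro ω ⟨w, hw, h⟩
  refine ⟨_, ⟨w, hw, rfl⟩, ?_⟩
  rintro ⟨u, x⟩ ⟨hu, hx⟩
  simp only at hu hx
  set e : Fin n → ℝ := fun i => σ * ω.2 i - ∑ j, ω.1 i j * w j with he
  have h1 : ∀ i, ∑ m, modelArray ω i m * dir w m = √n * e i := by
    intro i
    simp only [modelArray, hdir, Fintype.sum_option, Option.elim_none, Option.elim_some, he]
    rw [mul_sub, Finset.mul_sum, sub_eq_add_neg, ← Finset.sum_neg_distrib]
    congr 1
    · ring
    · exact Finset.sum_congr rfl fun j _ => by ring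
  have h2 : ∑ k, u k * ∑ m, modelArray ω k m * dir w m ≤ β * (√n * l2 e) := by
    simp_rw [h1]
    refine (sum_mul_le_l2 _ _).trans ?_
    rw [l2_smul hsn.le, hu]
  have h3 := l2_sq e
  have h4 : β * (√n * l2 e) ≤ n * β ^ 2 / 2 + l2 e ^ 2 / 2 := by
    have := sq_nonneg (√n * β - l2 e)
    nlinarith only [this, hsn2]
  rw [h3] at h4
  simp only [gordonPO, hcst, Pi.zero_apply, zero_mul, Finset.sum_const_zero, hx,
    Equiv.refl_apply]
  linarith

/-- Dual comparison: an upper bound valid for the decoupled dual cost is, up to a factor two in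
probability, valid for the dual Lasso cost. -/
theorem measure_dual_le {n N : ℕ} (hn : 0 < n) {σ lam R r K : ℝ} (θ : Fin N → ℝ)
    (hr : 0 < r) (hlam : 0 ≤ lam) (f : (Fin n → ℝ) → (Fin N → ℝ) → ℝ) {B : ℝ}
    (hf : ∀ u v, l2 u ≤ K → (∀ j, |v j| ≤ 1) → |f u v| ≤ B)
    (E : Set ((Option (Fin N) → ℝ) × (Fin n → ℝ)))
    (hE : ∀ p ∈ E, ∀ u v, l2 u ≤ K → (∀ j, |v j| ≤ 1) →
      ∃ w : Fin N → ℝ, ∑ j, w j ^ 2 ≤ n * R ^ 2 ∧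
        l2 u / √n * (l2 p.2 * √(n * σ ^ 2 + ∑ j, w j ^ 2)) +
        l2 u / √n * (p.1 none * (√n * σ) - ∑ j, p.1 (some j) * w j) +
        lam * ∑ j, (v j * (θ j + w j) - |θ j|) + r ≤ f u v) :
    Pmodel n N {ω | ∃ u v, l2 u ≤ K ∧ (∀ j, |v j| ≤ 1) ∧
      ∀ w : Fin N → ℝ, ∑ j, w j ^ 2 ≤ n * R ^ 2 →
      f u v ≤ ∑ i, u i * (σ * ω.2 i - ∑ j, ω.1 i j * w j) +
        lam * ∑ j, (v j * (θ j + w j) - |θ j|)} ≤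
      2 * ((gpi (Option (Fin N))).prod (gpi (Fin n))) Eᶜ := by
  have hn' : (0 : ℝ) < n := by exact_mod_cast hn
  have hsn : 0 < √(n : ℝ) := Real.sqrt_pos.2 hn'
  have hsn2 : √(n : ℝ) ^ 2 = n := Real.sq_sqrt hn'.le
  set dir : (Fin N → ℝ) → Option (Fin N) → ℝ := fun w o => o.elim (-(√n * σ)) w with hdir
  set lin : (Fin N → ℝ) → Option (Fin N) → ℝ := fun v o => o.elim 0 (fun j => -(lam * v j)) with hlin
  set cst : (Fin n → ℝ) → (Fin N → ℝ) → ℝ := fun u v =>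
    f u v - lam * ∑ j, (v j * θ j - |θ j|) with hcst
  set S : Set ((Fin n → ℝ) × (Option (Fin N) → ℝ) × ℝ) :=
    (fun p : (Fin n → ℝ) × (Fin N → ℝ) => ((fun i => 1 / √n * p.1 i), lin p.2, cst p.1 p.2)) ''
      {p | l2 p.1 ≤ K ∧ ∀ j, |p.2 j| ≤ 1} with hS
  set T : Set ((Option (Fin N) → ℝ) × ℝ) :=
    (fun w => (dir w, 0)) '' {w | ∑ j, w j ^ 2 ≤ n * R ^ 2} with hT
  have hl2 : ∀ w, l2 (dir w) = √(n * σ ^ 2 + ∑ j, w j ^ 2) := by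
    intro w
    simp only [l2, hdir, Fintype.sum_option, Option.elim_none, Option.elim_some, neg_sq, mul_pow,
      hsn2]
  have hsum : ∀ v w : Fin N → ℝ, ∑ j, (v j * (θ j + w j) - |θ j|) =
      ∑ j, v j * w j + ∑ j, (v j * θ j - |θ j|) := by
    intro v w
    rw [← Finset.sum_add_distrib]
    exact Finset.sum_congr rfl fun j _ => by ring
  have hlw : ∀ v w, ∑ k, lin v k * dir w k = -(lam * ∑ j, v j * w j) := by
    intro v w
    simp only [hlin, hdir, Fintype.sum_option, Option.elim_none, Option.elim_some, zero_mul,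
      zero_add, Finset.mul_sum, ← Finset.sum_neg_distrib]
    exact Finset.sum_congr rfl fun j _ => by ring
  have hSb : Bornology.IsBounded S := by
    refine ((isBounded_pi_of_abs_le (1 / √n * K)).prod
      ((isBounded_pi_of_abs_le lam).prod (isBounded_abs_le
        (B + lam * ∑ j, 2 * |θ j|)))).subset ?_
    rintro _ ⟨⟨u, v⟩, ⟨hu, hv⟩, rfl⟩
    refine ⟨fun i => ?_, ?_, ?_⟩
    · refine abs_le_of_l2_le ?_ i
      rw [l2_smul (by positivity)]
      exact mul_le_mul_of_nonneg_left hu (by positivity)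
    · rintro (_ | j)
      · simpa [hlin] using hlam
      · simp only [hlin, Option.elim_some, abs_neg, abs_mul, abs_of_nonneg hlam]
        exact mul_le_of_le_one_right hlam (hv j)
    · have h1 : |∑ j, (v j * θ j - |θ j|)| ≤ ∑ j, 2 * |θ j| := by
        refine (Finset.abs_sum_le_sum_abs _ _).trans (Finset.sum_le_sum fun j _ => ?_)
        refine (abs_sub _ _).trans ?_
        rw [abs_mul, abs_abs]
        nlinarith [mul_le_mul_of_nonneg_right (hv j) (abs_nonneg (θ j))]
      have h2 : |lam * ∑ j, (v j * θ j - |θ j|)| ≤ lam * ∑ j, 2 * |θ j| := by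
        rw [abs_mul, abs_of_nonneg hlam]; gcongr
      exact (abs_sub _ _).trans (add_le_add (hf u v hu hv) h2)
  have hTb : Bornology.IsBounded T := by
    refine ((isBounded_pi_of_abs_le (max |√n * σ| (√(n * R ^ 2)))).prod
      (Bornology.isBounded_singleton (x := (0 : ℝ)))).subset ?_
    rintro _ ⟨w, hw, rfl⟩
    refine ⟨?_, rfl⟩
    rintro (_ | j)
    · simp [hdir]
    · refine le_trans ?_ (le_max_right _ _)
      simpa [hdir] using abs_le_of_sum_sq_le hw j
  have key := gordon_bounded S T hSb hTb E hr (by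
    rintro ⟨h, g⟩ hp _ ⟨⟨u, v⟩, ⟨hu, hv⟩, rfl⟩
    obtain ⟨w, hw, hup⟩ := hE _ hp u v hu hv
    refine ⟨_, ⟨w, hw, rfl⟩, ?_⟩
    simp only at hup
    simp only [gordonAO, hl2, hlw, hcst]
    rw [l2_smul (by positivity)]
    have h1 : ∑ k, h k * dir w k = -(h none * (√n * σ) - ∑ j, h (some j) * w j) := by
      simp only [hdir, Fintype.sum_option, Option.elim_none, Option.elim_some]
      ring
    have h2 : -(l2 g * (1 / √n * l2 u)) ≤ ∑ m, g m * (1 / √n * u m) := by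
      have := sum_mul_le_l2 (fun m => -g m) (fun m => 1 / √n * u m)
      rw [l2_smul (by positivity)] at this
      have h3 : l2 (fun m => -g m) = l2 g := by simp [l2]
      rw [h3] at this
      simp only [neg_mul, Finset.sum_neg_distrib] at this
      linarith
    have h3 := mul_le_mul_of_nonneg_left h2 (Real.sqrt_nonneg (n * σ ^ 2 + ∑ j, w j ^ 2))
    rw [h1]
    rw [hsum] at hup
    have h4 : 1 / √n * l2 u * -(h none * (√n * σ) - ∑ j, h (some j) * w j) =
      - (l2 u / √n * (h none * (√n * σ) - ∑ j, h (some j) * w j)) := by ring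
    have h5 : √(n * σ ^ 2 + ∑ j, w j ^ 2) * -(l2 g * (1 / √n * l2 u)) =
      -(l2 u / √n * (l2 g * √(n * σ ^ 2 + ∑ j, w j ^ 2))) := by ring
    rw [h4]
    rw [h5] at h3
    linarith)
  refine le_trans ?_ key
  refine le_trans (measure_mono ?_) (measure_preimage_modelArray hn (Equiv.prodComm _ _) _)
  rintro ω ⟨u, v, hu, hv, h⟩
  refine ⟨_, ⟨(u, v), ⟨hu, hv⟩, rfl⟩, ?_⟩
  rintro _ ⟨w, hw, rfl⟩
  have h0 := h w hw
  have h1 : ∑ k, dir w k * ∑ m, modelArray ω m k * (1 / √n * u m) =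
      -∑ i, u i * (σ * ω.2 i - ∑ j, ω.1 i j * w j) := by
    simp_rw [Finset.mul_sum]
    rw [Finset.sum_comm, ← Finset.sum_neg_distrib]
    refine Finset.sum_congr rfl fun i _ => ?_
    simp only [modelArray, hdir, Fintype.sum_option, Option.elim_none, Option.elim_some]
    rw [mul_sub, Finset.mul_sum, neg_sub, sub_eq_neg_add]
    congr 1
    · field_simp
    · refine Finset.sum_congr rfl fun j _ => ?_
      field_simp
  simp only [gordonPO, hlw, hcst, Equiv.prodComm_apply, Prod.fst_swap, Prod.snd_swap]
  rw [h1]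
  rw [hsum] at h0
  linarith

theorem prod_compl_le {α β : Type*} [MeasurableSpace α] [MeasurableSpace β] (μ : Measure α)
    (ν : Measure β) [IsProbabilityMeasure μ] [IsProbabilityMeasure ν] (P : α → Prop) (Q : β → Prop) :
    (μ.prod ν) {p | P p.1 ∧ Q p.2}ᶜ ≤ μ {x | ¬ P x} + ν {y | ¬ Q y} := by
  have h : {p : α × β | P p.1 ∧ Q p.2}ᶜ ⊆ ({x | ¬ P x} ×ˢ Set.univ) ∪ (Set.univ ×ˢ {y | ¬ Q y}) := by
    intro p hp
    by_cases h1 : P p.1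
    · exact Or.inr ⟨trivial, fun h2 => hp ⟨h1, h2⟩⟩
    · exact Or.inl ⟨h1, trivial⟩
  refine (measure_mono h).trans ((measure_union_le _ _).trans ?_)
  rw [Measure.prod_prod, Measure.prod_prod, measure_univ, measure_univ, mul_one, one_mul]

/-- Curvature of the auxiliary cost on the ball of radius `R √n`. -/
def primalCurv (σ βm τM R : ℝ) : ℝ :=
  βm * σ ^ 2 / (2 * τM * √(σ ^ 2 + R ^ 2) * √(τM ^ 2 + 1))

/-- The Lasso cost along `θ + w` is bounded below on the ball of radius `R √n`, with quadratic
growth and a bonus `t` for every vanishing coordinate. -/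
def PrimalGood {n N : ℕ} (σ lam m c τM R t N₀ err : ℝ) (θ : Fin N → ℝ)
    (ω : (Fin n → Fin N → ℝ) × (Fin n → ℝ)) : Prop :=
  ∀ w : Fin N → ℝ, ∑ j, w j ^ 2 ≤ n * R ^ 2 →
    n * m - t * (n * N₀) + t * (Finset.univ.filter fun j => θ j + w j = 0).card +
      c / 2 * max 0 ((∑ j, w j ^ 2) / 2 - n * (τM ^ 2 + 1)) - err <
    (∑ i, (σ * ω.2 i - ∑ j, ω.1 i j * w j) ^ 2) / 2 + lam * ∑ j, (|θ j + w j| - |θ j|)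

/-- The dual Lasso cost at `(u, v)` is bounded above, with quadratic growth in the norm of `u` and a
bonus `t` for every saturated coordinate of `v`. -/
def DualGood {n N : ℕ} (σ lam m β R K t N₁ err : ℝ) (θ : Fin N → ℝ)
    (ω : (Fin n → Fin N → ℝ) × (Fin n → ℝ)) : Prop :=
  ∀ (u : Fin n → ℝ) (v : Fin N → ℝ), l2 u ≤ K → (∀ j, |v j| ≤ 1) →
    ∃ w : Fin N → ℝ, ∑ j, w j ^ 2 ≤ n * R ^ 2 ∧
      ∑ i, u i * (σ * ω.2 i - ∑ j, ω.1 i j * w j) - l2 u ^ 2 / 2 +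
        lam * ∑ j, (v j * (θ j + w j) - |θ j|) + n / 4 * (l2 u / √n - β) ^ 2 +
        t * (Finset.univ.filter fun j => |v j| = 1).card <
      n * m + t * (n * N₁) + err

theorem exists_pos_mul_le {x y : ℝ} (hx : 0 < x) (hy : 0 < y) :
    ∃ κ : ℝ, 0 < κ ∧ κ ≤ 1 ∧ κ * x ≤ y := by
  refine ⟨min 1 (y / x), by positivity, min_le_left _ _, ?_⟩
  calc min 1 (y / x) * x ≤ y / x * x := by gcongr; exact min_le_right _ _
    _ = y := div_mul_cancel₀ _ hx.ne'

section

variable {δ σ lmin lmax τM βm : ℝ}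

/-- The Lasso cost satisfies the primal and dual comparison bounds with high probability. -/
theorem measure_compl_good_le (hδ : 0 < δ) (hσ : 0 < σ)
    (hl : 0 < lmin) (hll : lmin ≤ lmax) (hτM : 0 < τM) (hβm : 0 < βm) :
    ∃ A c : ℝ, 0 < A ∧ 0 < c ∧ ∀ R : ℝ, 0 < R → 2 * (τM ^ 2 + 1) + 8 * (1 / δ) ≤ R ^ 2 →
      ∃ C k : ℝ, 0 < C ∧ 0 < k ∧ ∀ N n : ℕ, 0 < N → (n : ℝ) = δ * N →
      ∀ θ : Fin N → ℝ, ∀ lam ∈ Set.Icc lmin lmax,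
      ∀ β τ : ℝ, EvoSys (δ * N) σ lam β τ θ → σ ≤ τ → τ ≤ τM → βm ≤ β → β ≤ τ →
      ∀ a ρ t : ℝ, 0 < ρ → ρ < 1 → ρ ≤ a → 0 ≤ t → t ≤ k * a ^ 2 →
      Pmodel n N {ω | ¬ PrimalGood σ lam (β ^ 2 / 2 + lam * evoMean n θ τ (τ * lam / β))
        (primalCurv σ βm τM R) τM R t (1 / δ - (1 - β / τ) + A * a) (C * (ρ * n)) θ ω} ≤
        ENNReal.ofReal (28 * Real.exp (-(c * N * ρ ^ 2))) ∧
      ∀ K : ℝ, 0 ≤ K → Pmodel n N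
        {ω | ¬ DualGood σ lam (β ^ 2 / 2 + lam * evoMean n θ τ (τ * lam / β))
          β R K t (1 - β / τ + A * a) (C * (ρ * n)) θ ω} ≤
        ENNReal.ofReal (28 * Real.exp (-(c * N * ρ ^ 2))) := by
  obtain ⟨A, c₁, hA, hc₁, H₁⟩ := measure_compl_evoTypical_le hδ hσ hl hll hτM hβm
  obtain ⟨c₂, hc₂, H₂⟩ := measure_l2_compl_le hδ
  refine ⟨A, min c₁ c₂, hA, lt_min hc₁ hc₂, fun R hR hR2 => ?_⟩
  have hlmax : 0 < lmax := hl.trans_le hll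
  obtain ⟨κ, hκ, hκ1, hκB⟩ := exists_pos_mul_le
    (x := 1 / 2 + 3 * lmax ^ 2 * (1 / δ) / βm ^ 2 + 3 * (1 / δ) / σ ^ 2) (y := lmin / 2)
    (by positivity) (by positivity)
  set CP := √(σ ^ 2 + R ^ 2) / (2 * σ) + τM * √(σ ^ 2 + R ^ 2) + τM * σ + (τM + 1) + lmax with hCP
  set CD := lmax + τM * (1 / (2 * σ) + √(σ ^ 2 + R ^ 2) + 1 + σ) +
        3 * (1 / (2 * σ) + √(σ ^ 2 + R ^ 2) + 1 + σ) ^ 2 with hCD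
  have hCP0 : 0 < CP := by positivity
  have hCD0 : 0 < CD := by positivity
  have hcurv : 0 < primalCurv σ βm τM R := by unfold primalCurv; positivity
  refine ⟨CP + CD + 1, min (primalCurv σ βm τM R / 2) (κ * lmin / 2), by positivity,
    lt_min (by positivity) (by positivity), ?_⟩
  intro N n hN hnN θ lam hlam β τ hsys hστ hτ hβ hβτ a ρ t hρ hρ1 hρa ht hta
  have hN' : (0 : ℝ) < N := by exact_mod_cast hN
  have hn' : (0 : ℝ) < n := by rw [hnN]; positivity
  have hn : 0 < n := by exact_mod_cast hn'
  have ha : 0 < a := hρ.trans_le hρa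
  have hβ0 : 0 < β := hβm.trans_le hβ
  have hlam0 : 0 < lam := hl.trans_le hlam.1
  have hsn : 0 < √(n : ℝ) := Real.sqrt_pos.2 hn'
  have hsn2 : √(n : ℝ) ^ 2 = n := Real.sq_sqrt hn'.le
  have B₁ := H₁ N hN θ lam hlam β τ hsys hστ hτ hβ a ρ hρ hρ1.le hρa
  have B₂ := H₂ N n hnN ρ ⟨hρ, hρ1.le⟩
  rw [← hnN] at B₁
  set ex := Real.exp (-(min c₁ c₂ * N * ρ ^ 2)) with hex
  have e₁ : Real.exp (-(c₁ * N * ρ ^ 2)) ≤ ex := by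
    rw [hex]; gcongr; exact min_le_left _ _
  have e₂ : Real.exp (-(c₂ * N * ρ ^ 2)) ≤ ex := by
    rw [hex]; gcongr; exact min_le_right _ _
  replace B₁ := B₁.trans (ENNReal.ofReal_le_ofReal (mul_le_mul_of_nonneg_left e₁ (by norm_num)))
  replace B₂ := B₂.trans (ENNReal.ofReal_le_ofReal (mul_le_mul_of_nonneg_left e₂ (by norm_num)))
  have hfin : ∀ x y : ℝ≥0∞, x ≤ ENNReal.ofReal (12 * ex) → y ≤ ENNReal.ofReal (2 * ex) →
      2 * (x + y) ≤ ENNReal.ofReal (28 * ex) := by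
    intro x y hx hy
    have hex0 : 0 ≤ ex := (Real.exp_pos _).le
    calc 2 * (x + y) ≤ 2 * (ENNReal.ofReal (12 * ex) + ENNReal.ofReal (2 * ex)) := by gcongr
      _ = ENNReal.ofReal (28 * ex) := by
        rw [← ENNReal.ofReal_add (by positivity) (by positivity),
          show (2 : ℝ≥0∞) = ENNReal.ofReal 2 by simp, ← ENNReal.ofReal_mul (by norm_num)]
        congr 1
        ring
  set m := β ^ 2 / 2 + lam * evoMean n θ τ (τ * lam / β) with hm
  have hcard : ∀ (p : Fin N → Prop) [DecidablePred p],
      ((Finset.univ.filter p).card : ℝ) ≤ N := fun p _ => by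
    have h1 := Finset.card_filter_le (Finset.univ : Finset (Fin N)) p
    rw [Finset.card_univ, Fintype.card_fin] at h1
    exact_mod_cast h1
  have htN : ∀ (p : Fin N → Prop) [DecidablePred p],
      |t * ((Finset.univ.filter p).card : ℝ)| ≤ t * N := fun p _ => by
    rw [abs_of_nonneg (by positivity)]
    exact mul_le_mul_of_nonneg_left (hcard p) ht
  have hρn : 0 < ρ * n := by positivity
  constructor
  · set N₀ := 1 / δ - (1 - β / τ) + A * a with hN₀
    have hmain := measure_primal_le hn (σ := σ) (lam := lam) (R := R) θ hβ0
      (r := (CD + 1) * (ρ * n)) (by positivity) (fun w : Fin N → ℝ =>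
        n * m - t * (n * N₀) + t * (Finset.univ.filter fun j => θ j + w j = 0).card +
      primalCurv σ βm τM R / 2 * max 0 ((∑ j, w j ^ 2) / 2 - n * (τM ^ 2 + 1)) -
        (CP + CD + 1) * (ρ * n))
      (B := |n * m| + |t * (n * N₀)| + t * N + primalCurv σ βm τM R / 2 * (n * R ^ 2) +
        (CP + CD + 1) * (ρ * n)) (by
        intro w hw
        have h1 := htN fun j => θ j + w j = 0
        have h2 : max 0 ((∑ j, w j ^ 2) / 2 - n * (τM ^ 2 + 1)) ≤ n * R ^ 2 := by
          refine max_le (by positivity) ?_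
          have : 0 ≤ (n : ℝ) * (τM ^ 2 + 1) := by positivity
          have : 0 ≤ ∑ j, w j ^ 2 := Finset.sum_nonneg fun _ _ => sq_nonneg _
          linarith
        have h3 : 0 ≤ primalCurv σ βm τM R / 2 * max 0 ((∑ j, w j ^ 2) / 2 - n * (τM ^ 2 + 1)) :=
          mul_nonneg (by positivity) (le_max_left _ _)
        have h4 := mul_le_mul_of_nonneg_left h2 (by positivity : 0 ≤ primalCurv σ βm τM R / 2)
        have h5 := abs_le.1 h1
        have h6 := abs_le.1 (le_refl |n * m|)
        have h7 := abs_le.1 (le_refl |t * (n * N₀)|)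
        have h8 : 0 ≤ (CP + CD + 1) * (ρ * n) := by positivity
        have h9 : 0 ≤ primalCurv σ βm τM R / 2 * (n * R ^ 2) := by positivity
        rw [abs_le]
        constructor <;> linarith only [h3, h4, h5.1, h5.2, h6.1, h6.2, h7.1, h7.2, h8, h9])
      {p | ((1 - ρ) * √n ≤ l2 p.1 ∧ l2 p.1 ≤ (1 + ρ) * √n) ∧ EvoTypical n δ σ lam β τ A a ρ θ p.2} (by
        rintro ⟨g, h⟩ ⟨⟨hg, -⟩, hh₀, hgood⟩
        refine ⟨lt_of_lt_of_le (mul_pos (by linarith) hsn) hg, fun w hw => ?_⟩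
        have hlow := hgood.lower hn' hσ hβm hβ hβτ hστ hτ hlam0 hlam.2 hρ.le hρ1.le hR ha ht
          (hta.trans (mul_le_mul_of_nonneg_right (min_le_left _ _) (sq_nonneg a))) hg hh₀ hw
        simp only [primalCurv, ← hCP, ← hm, ← hN₀] at hlow ⊢
        linarith only [hlow])
    have hprod := prod_compl_le (gpi (Fin n)) (gpi (Option (Fin N)))
      (fun g => (1 - ρ) * √n ≤ l2 g ∧ l2 g ≤ (1 + ρ) * √n) (EvoTypical n δ σ lam β τ A a ρ θ)
    refine le_trans (measure_mono ?_) (hmain.trans ((mul_le_mul_right hprod 2).trans ?_))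
    · intro ω hω
      simp only [PrimalGood, Set.mem_ofPred_eq, not_forall, not_lt] at hω
      obtain ⟨w, hw, h⟩ := hω
      exact ⟨w, hw, h⟩
    · rw [add_comm]
      exact hfin _ _ B₁ B₂
  · intro K hK
    set N₁ := 1 - β / τ + A * a with hN₁
    have hmain := measure_dual_le hn (σ := σ) (lam := lam) (R := R) (K := K) θ
      (r := (CP + 1) * (ρ * n)) (by positivity) hlam0.le (fun (u : Fin n → ℝ) (v : Fin N → ℝ) =>
        n * m + t * (n * N₁) + (CP + CD + 1) * (ρ * n) + l2 u ^ 2 / 2 - n / 4 * (l2 u / √n - β) ^ 2 -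
          t * (Finset.univ.filter fun j => |v j| = 1).card)
      (B := |n * m| + |t * (n * N₁)| + (CP + CD + 1) * (ρ * n) + K ^ 2 / 2 +
        n / 4 * (K / √n + β) ^ 2 + t * N) (by
        intro u v hu hv
        have h1 := htN fun j => |v j| = 1
        have hu0 := l2_nonneg u
        have h2 : l2 u ^ 2 / 2 ≤ K ^ 2 / 2 := by gcongr
        have h3 : (l2 u / √n - β) ^ 2 ≤ (K / √n + β) ^ 2 := by
          have h31 : l2 u / √n ≤ K / √n := by gcongr
          have h32 : 0 ≤ l2 u / √n := by positivity
          apply sq_le_sq' <;> linarith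
        have h4 := mul_le_mul_of_nonneg_left h3 (by positivity : 0 ≤ (n : ℝ) / 4)
        have h5 := abs_le.1 h1
        have h6 := abs_le.1 (le_refl |n * m|)
        have h7 := abs_le.1 (le_refl |t * (n * N₁)|)
        have h8 : 0 ≤ (CP + CD + 1) * (ρ * n) := by positivity
        have h9 : 0 ≤ n / 4 * (l2 u / √n - β) ^ 2 := by positivity
        have h10 : 0 ≤ l2 u ^ 2 / 2 := by positivity
        rw [abs_le]
        constructor <;> linarith only [h2, h4, h5.1, h5.2, h6.1, h6.2, h7.1, h7.2, h8, h9, h10])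
      {p | EvoTypical n δ σ lam β τ A a ρ θ p.1 ∧ ((1 - ρ) * √n ≤ l2 p.2 ∧ l2 p.2 ≤ (1 + ρ) * √n)} (by
        rintro ⟨h, g⟩ ⟨⟨hh₀, hgood⟩, -, hg⟩ u v hu hv
        have hcN : (Fintype.card (Fin N) : ℝ) ≤ 1 / δ * n := by
          rw [Fintype.card_fin, hnN]; field_simp; rfl
        have hτ0 : 0 < τ := hσ.trans_le hστ
        have hr0 : 0 ≤ l2 u / √n := div_nonneg (l2_nonneg u) hsn.le
        refine ⟨_, hgood.sum_sq_shift_le hn' hτ0 hτ hρ1.le hcN hκ hκ1 hR2 hv, ?_⟩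
        have hup := hgood.upper hn' hσ hβm hβ hβτ hστ hτ hl hlam.1 hlam.2 hρ.le hρ1.le hcN hκ hκ1
          hκB hR2 ha ht (hta.trans (mul_le_mul_of_nonneg_right (min_le_right _ _) (sq_nonneg a)))
          hg hh₀ hr0 hv
        have hsq : n * (l2 u / √n) ^ 2 = l2 u ^ 2 := by
          rw [div_pow, hsn2]; field_simp
        simp only [hsq, ← hCD, ← hm, ← hN₁] at hup ⊢
        linarith only [hup])
    have hprod := prod_compl_le (gpi (Option (Fin N))) (gpi (Fin n))
      (EvoTypical n δ σ lam β τ A a ρ θ) (fun g => (1 - ρ) * √n ≤ l2 g ∧ l2 g ≤ (1 + ρ) * √n)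
    refine le_trans (measure_mono ?_) (hmain.trans ((mul_le_mul_right hprod 2).trans
      (hfin _ _ B₁ B₂)))
    intro ω hω
    simp only [DualGood, Set.mem_ofPred_eq, not_forall, not_exists, not_and, not_lt] at hω
    obtain ⟨u, v, hu, hv, h⟩ := hω
    refine ⟨u, v, hu, hv, fun w hw => ?_⟩
    have := h w hw
    linarith only [this]

end

section

variable {n N : ℕ}

theorem nonpos_of_forall_le_mul {a b : ℝ} (h : ∀ x : ℝ, 0 < x → x ≤ 1 → a ≤ x * b) : a ≤ 0 := by
  by_contra! ha
  obtain ⟨x, hx, hx1, hxb⟩ := exists_pos_mul_le (x := |b| + 1) (y := a / 2) (by positivity)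
    (by positivity)
  have h1 := h x hx hx1
  have h2 : x * b ≤ x * (|b| + 1) := by
    gcongr; linarith [le_abs_self b]
  linarith

/-- Stationarity conditions for the Lasso. -/
theorem lasso_kkt {X : Fin n → Fin N → ℝ} {y : Fin n → ℝ} {lam : ℝ} {θ : Fin N → ℝ} (hn : 0 < n)
    (hlam : 0 ≤ lam) (h : IsMinOn (lassoCost X y lam) Set.univ θ) (k : Fin N) :
    |∑ i, X i k * (y i - ∑ j, X i j * θ j)| ≤ lam ∧
      (∑ i, X i k * (y i - ∑ j, X i j * θ j)) * θ k = lam * |θ k| := by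
  have hn' : (0 : ℝ) < n := by exact_mod_cast hn
  set e : Fin n → ℝ := fun i => y i - ∑ j, X i j * θ j with he
  set G := ∑ i, X i k * e i with hG
  set Q := ∑ i, X i k ^ 2 with hQ
  have hQ0 : 0 ≤ Q := Finset.sum_nonneg fun _ _ => sq_nonneg _
  have key : ∀ s : ℝ, s * G ≤ s ^ 2 * Q / 2 + lam * (|θ k + s| - |θ k|) := by
    intro s
    have h1 : lassoCost X y lam θ ≤ lassoCost X y lam (Function.update θ k (θ k + s)) :=
      h (Set.mem_univ _)
    have h2 : ∀ i, y i - ∑ j, X i j * Function.update θ k (θ k + s) j = e i - s * X i k := by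
      intro i
      have : ∑ j, X i j * Function.update θ k (θ k + s) j =
          ∑ j, X i j * θ j + ∑ j, if j = k then s * X i k else 0 := by
        rw [← Finset.sum_add_distrib]
        refine Finset.sum_congr rfl fun j _ => ?_
        by_cases hj : j = k
        · subst hj; simp; ring
        · simp [hj]
      rw [this, Finset.sum_ite_eq' Finset.univ k, if_pos (Finset.mem_univ k)]
      simp only [he]; ring
    have h3 : ∑ j, |Function.update θ k (θ k + s) j| = ∑ j, |θ j| + (|θ k + s| - |θ k|) := by
      have : ∑ j, |Function.update θ k (θ k + s) j| =
          ∑ j, |θ j| + ∑ j, if j = k then |θ k + s| - |θ k| else 0 := by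
        rw [← Finset.sum_add_distrib]
        refine Finset.sum_congr rfl fun j _ => ?_
        by_cases hj : j = k
        · subst hj; simp
        · simp [hj]
      rw [this, Finset.sum_ite_eq' Finset.univ k, if_pos (Finset.mem_univ k)]
    have h4 : ∑ i, (e i - s * X i k) ^ 2 = ∑ i, e i ^ 2 - 2 * (s * G) + s ^ 2 * Q := by
      rw [hG, hQ, Finset.mul_sum, Finset.mul_sum, Finset.mul_sum, ← Finset.sum_sub_distrib,
        ← Finset.sum_add_distrib]
      exact Finset.sum_congr rfl fun i _ => by ring
    simp only [lassoCost, h2, h3, h4] at h1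
    have h5 : 0 ≤ 1 / (n : ℝ) * ((-(s * G) + s ^ 2 * Q / 2) + lam * (|θ k + s| - |θ k|)) := by
      have : 1 / (n : ℝ) * ((-(s * G) + s ^ 2 * Q / 2) + lam * (|θ k + s| - |θ k|)) =
        (1 / (2 * n) * (∑ i, e i ^ 2 - 2 * (s * G) + s ^ 2 * Q) +
          lam / n * (∑ j, |θ j| + (|θ k + s| - |θ k|))) -
        (1 / (2 * n) * (∑ i, e i ^ 2) + lam / n * ∑ j, |θ j|) := by
        field_simp; ring
      rw [this]
      exact sub_nonneg.2 h1
    have h6 := nonneg_of_mul_nonneg_right h5 (by positivity)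
    linarith
  have hsub : ∀ s, |θ k + s| - |θ k| ≤ |s| := fun s => by
    have := abs_add_le (θ k) s; linarith
  have hle : |G| ≤ lam := by
    rw [abs_le]
    constructor
    · have := nonpos_of_forall_le_mul (a := -lam - G) (b := Q / 2) fun x hx _ => by
        have h1 := key (-x)
        have h2 := mul_le_mul_of_nonneg_left (hsub (-x)) hlam
        rw [abs_neg, abs_of_pos hx] at h2
        have h3 : x * (-lam - G) ≤ x * (x * (Q / 2)) := by nlinarith only [h1, h2]
        exact le_of_mul_le_mul_left h3 hx
      linarith
    · have := nonpos_of_forall_le_mul (a := G - lam) (b := Q / 2) fun x hx _ => by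
        have h1 := key x
        have h2 := mul_le_mul_of_nonneg_left (hsub x) hlam
        rw [abs_of_pos hx] at h2
        have h3 : x * (G - lam) ≤ x * (x * (Q / 2)) := by nlinarith only [h1, h2]
        exact le_of_mul_le_mul_left h3 hx
      linarith
  refine ⟨hle, le_antisymm ?_ ?_⟩
  · calc G * θ k ≤ |G * θ k| := le_abs_self _
      _ = |G| * |θ k| := abs_mul _ _
      _ ≤ lam * |θ k| := by gcongr
  · have := nonpos_of_forall_le_mul (a := lam * |θ k| - G * θ k) (b := θ k ^ 2 * Q / 2)
      fun x hx hx1 => by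
        have h1 := key (-(x * θ k))
        have h2 : |θ k + -(x * θ k)| = (1 - x) * |θ k| := by
          rw [show θ k + -(x * θ k) = (1 - x) * θ k by ring, abs_mul,
            abs_of_nonneg (by linarith)]
        rw [h2] at h1
        have h3 : x * (lam * |θ k| - G * θ k) ≤ x * (x * (θ k ^ 2 * Q / 2)) := by
          nlinarith only [h1]
        exact le_of_mul_le_mul_left h3 hx
    linarith

/-- Increment of the rescaled Lasso cost along `w` from the signal `θ`, up to the value of the
penalty. -/
def incCost (σ lam : ℝ) (θ : Fin N → ℝ) (ω : (Fin n → Fin N → ℝ) × (Fin n → ℝ)) (w : Fin N → ℝ) : ℝ :=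
  (∑ i, (σ * ω.2 i - ∑ j, ω.1 i j * w j) ^ 2) / 2 + lam * ∑ j, (|θ j + w j| - |θ j|)

variable {σ lam : ℝ} {θ : Fin N → ℝ} {ω : (Fin n → Fin N → ℝ) × (Fin n → ℝ)}

theorem yvec_sub (x : Fin N → ℝ) (i : Fin n) :
    yvec σ θ ω.1 ω.2 i - ∑ j, ω.1 i j * x j = σ * ω.2 i - ∑ j, ω.1 i j * (x j - θ j) := by
  simp only [yvec, mul_sub, Finset.sum_sub_distrib]
  ring

theorem incCost_eq (hn : 0 < n) (x : Fin N → ℝ) : incCost σ lam θ ω (fun j => x j - θ j) =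
    n * lassoCost ω.1 (yvec σ θ ω.1 ω.2) lam x - lam * ∑ j, |θ j| := by
  have hn' : (0 : ℝ) < n := by exact_mod_cast hn
  simp only [incCost, lassoCost, yvec_sub, add_sub_cancel, Finset.sum_sub_distrib]
  field_simp
  ring

theorem incCost_le_of_isMinOn (hn : 0 < n) {x : Fin N → ℝ}
    (h : IsMinOn (lassoCost ω.1 (yvec σ θ ω.1 ω.2) lam) Set.univ x) (w : Fin N → ℝ) :
    incCost σ lam θ ω (fun j => x j - θ j) ≤ incCost σ lam θ ω w := by
  have h1 := incCost_eq (σ := σ) (lam := lam) (θ := θ) (ω := ω) hn (fun j => θ j + w j)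
  simp only [add_sub_cancel_left] at h1
  rw [h1, incCost_eq hn]
  have h2 : lassoCost ω.1 (yvec σ θ ω.1 ω.2) lam x ≤
    lassoCost ω.1 (yvec σ θ ω.1 ω.2) lam (fun j => θ j + w j) := h (Set.mem_univ _)
  gcongr

theorem incCost_smul_le (hlam : 0 ≤ lam) {s : ℝ} (hs : 0 ≤ s) (hs1 : s ≤ 1) (w : Fin N → ℝ) :
    incCost σ lam θ ω (fun j => s * w j) ≤
      s * incCost σ lam θ ω w + (1 - s) * incCost σ lam θ ω 0 := by
  have h1 : ∀ i, (σ * ω.2 i - ∑ j, ω.1 i j * (s * w j)) ^ 2 ≤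
      s * (σ * ω.2 i - ∑ j, ω.1 i j * w j) ^ 2 + (1 - s) * (σ * ω.2 i) ^ 2 := by
    intro i
    have : ∑ j, ω.1 i j * (s * w j) = s * ∑ j, ω.1 i j * w j := by
      rw [Finset.mul_sum]; exact Finset.sum_congr rfl fun j _ => by ring
    rw [this]
    have := mul_nonneg (mul_nonneg hs (sub_nonneg.2 hs1)) (sq_nonneg (∑ j, ω.1 i j * w j))
    linarith
  have h2 : ∀ j, |θ j + s * w j| - |θ j| ≤ s * (|θ j + w j| - |θ j|) := by
    intro j
    have h3 := abs_add_le (s * (θ j + w j)) ((1 - s) * θ j)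
    rw [abs_mul, abs_mul, abs_of_nonneg hs, abs_of_nonneg (sub_nonneg.2 hs1),
      show s * (θ j + w j) + (1 - s) * θ j = θ j + s * w j by ring] at h3
    linarith
  have h3 := Finset.sum_le_sum fun i (_ : i ∈ Finset.univ) => h1 i
  have h4 := mul_le_mul_of_nonneg_left (Finset.sum_le_sum fun j (_ : j ∈ Finset.univ) => h2 j) hlam
  rw [Finset.sum_add_distrib, ← Finset.mul_sum, ← Finset.mul_sum] at h3
  rw [← Finset.mul_sum] at h4
  simp only [incCost, Pi.zero_apply, mul_zero, Finset.sum_const_zero, sub_zero, add_zero, sub_self]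
  linarith

theorem abs_sum_abs_sub_le {w : Fin N → ℝ} {B : ℝ} (hB : 0 ≤ B) (hw : ∑ j, w j ^ 2 ≤ B ^ 2) :
    |∑ j, (|θ j + w j| - |θ j|)| ≤ √N * B := by
  calc |∑ j, (|θ j + w j| - |θ j|)| ≤ ∑ j, |(|θ j + w j| - |θ j|)| := Finset.abs_sum_le_sum_abs _ _
    _ ≤ ∑ j, 1 * |w j| := by
        refine Finset.sum_le_sum fun j _ => ?_
        refine (abs_abs_sub_abs_le _ _).trans ?_
        rw [add_sub_cancel_left, one_mul]
    _ ≤ √(∑ _j : Fin N, (1 : ℝ) ^ 2) * √(∑ j, |w j| ^ 2) := Real.sum_mul_le_sqrt_mul_sqrt _ _ _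
    _ ≤ √N * B := by
        simp only [one_pow, Finset.sum_const, Finset.card_univ, Fintype.card_fin, nsmul_eq_mul,
          mul_one, sq_abs]
        gcongr
        exact Real.sqrt_le_iff.2 ⟨hB, hw⟩

/-- A point whose cost does not exceed the cost at the origin lies in the ball of radius `B` as soon
as the cost on its boundary is large for a nearby penalty level. -/
theorem sum_sq_le_of_incCost_le {lam₀ η B M : ℝ} (hlam : 0 ≤ lam) (hη : |lam - lam₀| ≤ η) (hB : 0 < B)
    (h0 : incCost σ lam θ ω 0 ≤ M) {w : Fin N → ℝ}
    (hw : incCost σ lam θ ω w ≤ incCost σ lam θ ω 0)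
    (hbd : ∀ v : Fin N → ℝ, ∑ j, v j ^ 2 = B ^ 2 → M + η * (√N * B) < incCost σ lam₀ θ ω v) :
    ∑ j, w j ^ 2 ≤ B ^ 2 := by
  by_contra! hlt
  set s := B / √(∑ j, w j ^ 2) with hs
  have hq : B < √(∑ j, w j ^ 2) := Real.lt_sqrt_of_sq_lt hlt
  have hq0 := hB.trans hq
  have hs0 : 0 < s := by positivity
  have hs1 : s ≤ 1 := (div_le_one hq0).2 hq.le
  have hsw : ∑ j, (s * w j) ^ 2 = B ^ 2 := by
    simp_rw [mul_pow, ← Finset.mul_sum]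
    rw [hs, div_pow, Real.sq_sqrt (by positivity)]
    exact div_mul_cancel₀ _ ((sq_nonneg B).trans_lt hlt).ne'
  have h1 := hbd _ hsw
  have h2 := incCost_smul_le (σ := σ) (θ := θ) (ω := ω) hlam hs0.le hs1 w
  have h3 := mul_le_mul_of_nonneg_left hw hs0.le
  have h4 : incCost σ lam₀ θ ω (fun j => s * w j) - incCost σ lam θ ω (fun j => s * w j) ≤
      η * (√N * B) := by
    have h5 : incCost σ lam₀ θ ω (fun j => s * w j) - incCost σ lam θ ω (fun j => s * w j) =
      (lam₀ - lam) * ∑ j, (|θ j + s * w j| - |θ j|) := by unfold incCost; ring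
    rw [h5]
    refine (le_abs_self _).trans ?_
    rw [abs_mul, abs_sub_comm]
    exact mul_le_mul hη (abs_sum_abs_sub_le hB.le hsw.le) (abs_nonneg _) ((abs_nonneg _).trans hη)
  linarith

end

section

variable {n N : ℕ} {σ lam lam₀ : ℝ} {θ : Fin N → ℝ} {ω : (Fin n → Fin N → ℝ) × (Fin n → ℝ)}

/-- The Lasso residual. -/
def lassoResidual (σ : ℝ) (θ : Fin N → ℝ) (ω : (Fin n → Fin N → ℝ) × (Fin n → ℝ)) (x : Fin N → ℝ)
    (i : Fin n) : ℝ :=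
  σ * ω.2 i - ∑ j, ω.1 i j * (x j - θ j)

/-- Localization of the Lasso error and of its residual. -/
theorem PrimalGood.localize {ν m M₁ c τM R N₀ C ρ lmax : ℝ} {x : Fin N → ℝ} (hn : 0 < n)
    (hν : ν ^ 2 * n = N) (hν0 : 0 ≤ ν) (hR : 0 < R) (hc : 0 ≤ c)
    (hgood : PrimalGood σ lam₀ m c τM R 0 N₀ (C * (ρ * n)) θ ω)
    (hm : -(lmax * M₁) ≤ m) (hlam : 0 ≤ lam) (hlmax : lam ≤ lmax) (hdiff : |lam - lam₀| ≤ ρ)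
    (hC : C * ρ ≤ 1) (hνR : ρ * (ν * R) ≤ 1)
    (hcR : lmax * M₁ + 2 * σ ^ 2 + 2 ≤ c / 2 * (R ^ 2 / 2 - (τM ^ 2 + 1)))
    (hz : l2 ω.2 ≤ 2 * √n)
    (hx : IsMinOn (lassoCost ω.1 (yvec σ θ ω.1 ω.2) lam) Set.univ x) :
    ∑ j, (x j - θ j) ^ 2 ≤ n * R ^ 2 ∧
      l2 (lassoResidual σ θ ω x) ^ 2 ≤ n * (4 * σ ^ 2 + 2 * lmax * (ν * R)) := by
  have hn' : (0 : ℝ) < n := by exact_mod_cast hn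
  have hsn : 0 < √(n : ℝ) := Real.sqrt_pos.2 hn'
  have hsn2 : √(n : ℝ) ^ 2 = n := Real.sq_sqrt hn'.le
  have hsN : √(N : ℝ) = ν * √n := by
    rw [← hν, Real.sqrt_mul (sq_nonneg ν), Real.sqrt_sq hν0]
  have hB : (√n * R) ^ 2 = n * R ^ 2 := by rw [mul_pow, hsn2]
  have hNB : √N * (√n * R) = n * (ν * R) := by
    rw [hsN]; calc ν * √n * (√n * R) = √n ^ 2 * (ν * R) := by ring
      _ = _ := by rw [hsn2]
  have h0 : incCost σ lam θ ω 0 ≤ n * (2 * σ ^ 2) := by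
    simp only [incCost, Pi.zero_apply, mul_zero, Finset.sum_const_zero, sub_zero, add_zero,
      sub_self, mul_pow]
    rw [← Finset.mul_sum, ← l2_sq]
    have h1 : l2 ω.2 ^ 2 ≤ (2 * √n) ^ 2 := by
      have := l2_nonneg ω.2
      gcongr
    rw [mul_pow, hsn2] at h1
    have := mul_le_mul_of_nonneg_left h1 (sq_nonneg σ)
    linarith
  have hmin := incCost_le_of_isMinOn hn hx
  have hloc : ∑ j, (x j - θ j) ^ 2 ≤ (√n * R) ^ 2 := by
    refine sum_sq_le_of_incCost_le hlam hdiff (by positivity) h0 (hmin 0) fun v hv => ?_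
    rw [hB] at hv
    have h1 := hgood v hv.le
    rw [hNB]
    have h2 : n * R ^ 2 / 2 - n * (τM ^ 2 + 1) ≤ max 0 (n * R ^ 2 / 2 - n * (τM ^ 2 + 1)) :=
      le_max_right _ _
    have h3 := mul_le_mul_of_nonneg_left h2 (by positivity : 0 ≤ c / 2)
    rw [hv] at h1
    have h4 := mul_le_mul_of_nonneg_left hm hn'.le
    have h5 := mul_le_mul_of_nonneg_left hC hn'.le
    have h6 := mul_le_mul_of_nonneg_left hνR hn'.le
    have h7 := mul_le_mul_of_nonneg_left hcR hn'.le
    simp only [zero_mul, sub_zero, add_zero] at h1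
    refine lt_of_le_of_lt ?_ h1
    linarith only [h3, h4, h5, h6, h7]
  refine ⟨hB ▸ hloc, ?_⟩
  have h1 := (hmin 0).trans h0
  have h2 := (abs_le.1 (abs_sum_abs_sub_le (θ := θ) (by positivity) hloc)).1
  rw [hNB] at h2
  have h3 := mul_le_mul_of_nonneg_left h2 hlam
  have h4 : lam * (n * (ν * R)) ≤ lmax * (n * (ν * R)) := by gcongr
  rw [l2_sq]
  simp only [incCost] at h1
  simp only [lassoResidual]
  linarith

/-- The dual bound evaluated at the Lasso residual. -/
theorem DualGood.cost_lt {m β R K t N₁ err : ℝ} {x : Fin N → ℝ} (hn : 0 < n)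
    (hgood : DualGood σ lam₀ m β R K t N₁ err θ ω) (hlam : 0 < lam) (hlam₀ : 0 ≤ lam₀) (ht : 0 ≤ t)
    (hK : lam₀ / lam * l2 (lassoResidual σ θ ω x) ≤ K)
    (hx : IsMinOn (lassoCost ω.1 (yvec σ θ ω.1 ω.2) lam) Set.univ x) :
    incCost σ lam₀ θ ω (fun j => x j - θ j) -
        (1 - lam₀ / lam) ^ 2 * l2 (lassoResidual σ θ ω x) ^ 2 / 2 +
        n / 4 * (lam₀ / lam * l2 (lassoResidual σ θ ω x) / √n - β) ^ 2 + t * l0 x <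
      n * m + t * (n * N₁) + err := by
  set e := lassoResidual σ θ ω x with he
  have hkkt := lasso_kkt hn hlam.le hx
  simp only [yvec_sub] at hkkt
  set v : Fin N → ℝ := fun k => (∑ i, ω.1 i k * e i) / lam with hv
  have hc : 0 ≤ lam₀ / lam := by positivity
  have hv1 : ∀ k, |v k| ≤ 1 := fun k => by
    rw [hv, abs_div, abs_of_pos hlam, div_le_one hlam]; exact (hkkt k).1
  have hvx : ∀ k, v k * x k = |x k| := fun k => by
    have h1 := (hkkt k).2
    simp only [hv, div_mul_eq_mul_div]
    rw [div_eq_iff hlam.ne', mul_comm |x k|]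
    exact h1
  have hlamv : ∀ k, ∑ i, ω.1 i k * e i = lam * v k := fun k => by
    simp only [hv]; field_simp
  obtain ⟨w, -, h⟩ := hgood (fun i => lam₀ / lam * e i) v (by rwa [l2_smul hc]) hv1
  rw [l2_smul hc] at h
  have hind : ∀ w : Fin N → ℝ, ∑ i, lam₀ / lam * e i * (σ * ω.2 i - ∑ j, ω.1 i j * w j) +
      lam₀ * ∑ j, (v j * (θ j + w j) - |θ j|) =
      lam₀ / lam * ∑ i, e i * (σ * ω.2 i) + lam₀ * ∑ j, (v j * θ j - |θ j|) := by
    intro w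
    have h1 : ∑ i, lam₀ / lam * e i * (σ * ω.2 i - ∑ j, ω.1 i j * w j) =
        lam₀ / lam * ∑ i, e i * (σ * ω.2 i) - lam₀ / lam * ∑ i, ∑ j, e i * (ω.1 i j * w j) := by
      rw [Finset.mul_sum, Finset.mul_sum, ← Finset.sum_sub_distrib]
      refine Finset.sum_congr rfl fun i _ => ?_
      rw [← Finset.mul_sum]; ring
    have h2 : ∑ i, ∑ j, e i * (ω.1 i j * w j) = lam * ∑ j, v j * w j := by
      rw [Finset.sum_comm, Finset.mul_sum]
      refine Finset.sum_congr rfl fun j _ => ?_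
      rw [← mul_assoc, ← hlamv, Finset.sum_mul]
      exact Finset.sum_congr rfl fun i _ => by ring
    have h3 : ∑ j, (v j * (θ j + w j) - |θ j|) =
        ∑ j, v j * w j + ∑ j, (v j * θ j - |θ j|) := by
      rw [← Finset.sum_add_distrib]
      exact Finset.sum_congr rfl fun j _ => by ring
    have h4 : lam₀ / lam * lam = lam₀ := div_mul_cancel₀ _ hlam.ne'
    rw [h1, h2, h3]
    linear_combination (-∑ j, v j * w j) * h4
  have hval : ∑ i, lam₀ / lam * e i * (σ * ω.2 i - ∑ j, ω.1 i j * w j) +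
      lam₀ * ∑ j, (v j * (θ j + w j) - |θ j|) =
      lam₀ / lam * l2 e ^ 2 + lam₀ * ∑ j, (|x j| - |θ j|) := by
    have h1 : ∑ i, lam₀ / lam * e i * (σ * ω.2 i - ∑ j, ω.1 i j * (x j - θ j)) =
        lam₀ / lam * l2 e ^ 2 := by
      rw [l2_sq, Finset.mul_sum]
      refine Finset.sum_congr rfl fun i _ => ?_
      simp only [he, lassoResidual]; ring
    have h2 : ∑ j, (v j * (θ j + (x j - θ j)) - |θ j|) = ∑ j, (|x j| - |θ j|) := by
      refine Finset.sum_congr rfl fun j _ => ?_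
      rw [add_sub_cancel, hvx]
    rw [hind w, ← hind fun j => x j - θ j, h1, h2]
  have hcost : incCost σ lam₀ θ ω (fun j => x j - θ j) =
      l2 e ^ 2 / 2 + lam₀ * ∑ j, (|x j| - |θ j|) := by
    rw [l2_sq]
    simp only [incCost, add_sub_cancel, he, lassoResidual]
  have hcard : (l0 x : ℝ) ≤ (Finset.univ.filter fun j => |v j| = 1).card := by
    unfold l0
    refine Nat.cast_le.2 (Finset.card_le_card fun j hj => ?_)
    simp only [Finset.mem_filter, Finset.mem_univ, true_and] at hj ⊢
    have h1 := congrArg abs (hvx j)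
    rw [abs_mul, abs_abs] at h1
    exact mul_right_cancel₀ (abs_ne_zero.2 hj) (by rw [h1, one_mul])
  have htc := mul_le_mul_of_nonneg_left hcard ht
  rw [hcost]
  refine lt_of_le_of_lt ?_ h
  linarith only [hval, htc]

theorem card_eq_zero_add_l0 (x : Fin N → ℝ) :
    ((Finset.univ.filter fun j => x j = 0).card : ℝ) + l0 x = N := by
  have h := Finset.card_filter_add_card_filter_not (s := (Finset.univ : Finset (Fin N)))
    (fun j => x j = 0)
  rw [Finset.card_univ, Fintype.card_fin] at h
  unfold l0
  exact_mod_cast h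

/-- Control of the residual norm and of the sparsity of the Lasso on the good event. -/
theorem residual_and_l0_control {m β c τM R K t N₀ N₁ C ρ U lmin : ℝ} {x : Fin N → ℝ} (hn : 0 < n)
    (hP₀ : PrimalGood σ lam₀ m c τM R 0 N₀ (C * (ρ * n)) θ ω)
    (hPt : PrimalGood σ lam₀ m c τM R t N₀ (C * (ρ * n)) θ ω)
    (hD₀ : DualGood σ lam₀ m β R K 0 N₁ (C * (ρ * n)) θ ω)
    (hDt : DualGood σ lam₀ m β R K t N₁ (C * (ρ * n)) θ ω)
    (hl : 0 < lmin) (hlam : lmin ≤ lam) (hlam₀ : 0 ≤ lam₀) (hdiff : |lam - lam₀| ≤ ρ) (hρ1 : ρ ≤ 1)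
    (hc : 0 ≤ c) (ht : 0 ≤ t)
    (hloc : ∑ j, (x j - θ j) ^ 2 ≤ n * R ^ 2)
    (hU : l2 (lassoResidual σ θ ω x) ^ 2 ≤ n * U)
    (hK : lam₀ / lam * l2 (lassoResidual σ θ ω x) ≤ K)
    (hx : IsMinOn (lassoCost ω.1 (yvec σ θ ω.1 ω.2) lam) Set.univ x) :
    |1 - lam₀ / lam| ≤ ρ / lmin ∧
    (lam₀ / lam * l2 (lassoResidual σ θ ω x) / √n - β) ^ 2 ≤ 4 * ((2 * C + U / (2 * lmin ^ 2)) * ρ) ∧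
    t * ((N - l0 x) - n * N₀) ≤ (2 * C + U / (2 * lmin ^ 2)) * ρ * n ∧
    t * (l0 x - n * N₁) ≤ (2 * C + U / (2 * lmin ^ 2)) * ρ * n := by
  have hn' : (0 : ℝ) < n := by exact_mod_cast hn
  have hlam0 : 0 < lam := hl.trans_le hlam
  have hρ0 : 0 ≤ ρ := (abs_nonneg _).trans hdiff
  have hU0 : 0 ≤ U := nonneg_of_mul_nonneg_right ((sq_nonneg _).trans hU) hn'
  have h1 : |1 - lam₀ / lam| ≤ ρ / lmin := by
    rw [show 1 - lam₀ / lam = (lam - lam₀) / lam by field_simp, abs_div, abs_of_pos hlam0]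
    gcongr
  have h2 : (1 - lam₀ / lam) ^ 2 * l2 (lassoResidual σ θ ω x) ^ 2 / 2 ≤
      U / (2 * lmin ^ 2) * ρ * n := by
    have h3 : (1 - lam₀ / lam) ^ 2 ≤ ρ / lmin ^ 2 := by
      rw [← sq_abs]
      calc |1 - lam₀ / lam| ^ 2 ≤ (ρ / lmin) ^ 2 := by gcongr
        _ = ρ * ρ / lmin ^ 2 := by rw [div_pow, sq ρ]
        _ ≤ ρ / lmin ^ 2 := by
            gcongr; exact mul_le_of_le_one_right hρ0 hρ1
    calc (1 - lam₀ / lam) ^ 2 * l2 (lassoResidual σ θ ω x) ^ 2 / 2 ≤ ρ / lmin ^ 2 * (n * U) / 2 := by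
          gcongr
      _ = _ := by field_simp
  have p₀ := hP₀ _ hloc
  have pt := hPt _ hloc
  have d₀ := hD₀.cost_lt hn hlam0 hlam₀ le_rfl hK hx
  have dt := hDt.cost_lt hn hlam0 hlam₀ ht hK hx
  have hmax : 0 ≤ c / 2 * max 0 ((∑ j, (x j - θ j) ^ 2) / 2 - n * (τM ^ 2 + 1)) :=
    mul_nonneg (by positivity) (le_max_left _ _)
  have hz := card_eq_zero_add_l0 x
  have hz' : t * ((Finset.univ.filter fun j => x j = 0).card : ℝ) = t * (N - l0 x) := by
    rw [← hz]; ring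
  simp only [add_sub_cancel] at p₀ pt
  rw [hz'] at pt
  simp only [incCost, add_sub_cancel] at d₀ dt
  simp only [zero_mul, sub_zero, add_zero] at p₀ d₀
  have hsq : 0 ≤ n / 4 * (lam₀ / lam * l2 (lassoResidual σ θ ω x) / √n - β) ^ 2 := by positivity
  refine ⟨h1, ?_, ?_, ?_⟩
  · have h4 : n * (lam₀ / lam * l2 (lassoResidual σ θ ω x) / √n - β) ^ 2 ≤
        n * (4 * ((2 * C + U / (2 * lmin ^ 2)) * ρ)) := by
      linarith only [h2, p₀, d₀, hmax]
    exact le_of_mul_le_mul_left h4 hn'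
  · linarith only [h2, pt, d₀, hmax, hsq]
  · linarith only [h2, p₀, dt, hmax, hsq]

end

/-- Stability of the ratio defining the estimated noise level. -/
theorem abs_div_sub_le {q c β τ τM βm lmin U E a A x : ℝ} (hβm : 0 < βm) (hβ : βm ≤ β) (hτ : 0 < τ)
    (hτM : τ ≤ τM) (hl : 0 < lmin) (hq : 0 ≤ q) (hqU : q ^ 2 ≤ U) (hE : 0 ≤ E) (ha : 0 ≤ a)
    (h1 : |1 - c| ≤ a / lmin) (h2 : (c * q - β) ^ 2 ≤ E * a ^ 2)
    (h3 : |x - (1 - β / τ)| ≤ A * a) (hA : A * a ≤ βm / τM / 2) :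
    |q / (1 - x) - τ| ≤ (√E + √U / lmin + τM * A) * (2 / (βm / τM)) * a := by
  have hτM0 : 0 < τM := hτ.trans_le hτM
  have hb0 : 0 < βm / τM := by positivity
  have hb : βm / τM ≤ β / τ := by
    have : 0 < β := hβm.trans_le hβ
    gcongr
  have h4 := abs_le.1 h3
  have hx : βm / τM / 2 ≤ 1 - x := by linarith [h4.2]
  have hx0 : 0 < 1 - x := by linarith
  have hqU' : q ≤ √U := Real.le_sqrt_of_sq_le hqU
  have h5 : |c * q - β| ≤ √E * a := by
    refine Real.abs_le_sqrt h2 |>.trans ?_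
    rw [Real.sqrt_mul hE, Real.sqrt_sq ha]
  have h6 : |(1 - c) * q| ≤ a / lmin * √U := by
    rw [abs_mul, abs_of_nonneg hq]; gcongr
  have h7 : |τ * ((1 - β / τ) - x)| ≤ τM * (A * a) := by
    rw [abs_mul, abs_of_pos hτ, abs_sub_comm]
    have := (abs_nonneg _).trans h3
    gcongr
  have h8 : q - τ * (1 - x) = (c * q - β) + (1 - c) * q - τ * ((1 - β / τ) - x) := by
    field_simp; ring
  have h9 : |q - τ * (1 - x)| ≤ (√E + √U / lmin + τM * A) * a := by
    have e : a / lmin * √U = √U / lmin * a := by ring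
    rw [e] at h6
    rw [abs_le] at *
    rw [h8]
    constructor <;> linarith [h5.1, h5.2, h6.1, h6.2, h7.1, h7.2]
  have h10 : q / (1 - x) - τ = (q - τ * (1 - x)) / (1 - x) := by field_simp
  rw [h10, abs_div, abs_of_pos hx0, div_le_iff₀ hx0]
  refine h9.trans ?_
  have h11 := (abs_nonneg _).trans h9
  calc (√E + √U / lmin + τM * A) * a = (√E + √U / lmin + τM * A) * a * (2 / (βm / τM)) *
        (βm / τM / 2) := by field_simp
    _ ≤ (√E + √U / lmin + τM * A) * a * (2 / (βm / τM)) * (1 - x) := by gcongr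
    _ = _ := by ring

instance isProbabilityMeasure_Pmodel (n N : ℕ) : IsProbabilityMeasure (Pmodel n N) := by
  have : IsProbabilityMeasure (PX n N) := by unfold PX; infer_instance
  have : IsProbabilityMeasure (Pz n) := by unfold Pz; infer_instance
  unfold Pmodel; infer_instance

theorem Pmodel_snd_preimage_le {n N : ℕ} (S : Set (Fin n → ℝ)) :
    Pmodel n N {ω | ω.2 ∈ S} ≤ gpi (Fin n) S := by
  have : IsProbabilityMeasure (PX n N) := by unfold PX; infer_instance
  have : IsProbabilityMeasure (Pz n) := by unfold Pz; infer_instance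
  have h : {ω : (Fin n → Fin N → ℝ) × (Fin n → ℝ) | ω.2 ∈ S} = Set.univ ×ˢ S := by
    ext ω; simp
  rw [h, Pmodel, Measure.prod_prod, measure_univ, one_mul]
  rfl

theorem EvoSys.neg_le_evoMean {n σ lam β τ : ℝ} {N : ℕ} {θ : Fin N → ℝ}
    (h : EvoSys n σ lam β τ θ) (hn : 0 < n) (hlam : 0 < lam) :
    -((N / n + τ ^ 2) / 2) ≤ evoMean n θ τ (τ * lam / β) := by
  have hβ := h.β_pos
  have hτ := h.τ_pos
  have hb : 0 < τ * lam / β := by positivity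
  have hWm : ∀ j, Measurable (evoErr (θ j) τ (τ * lam / β)) := fun j =>
    (continuous_evoErr hb).measurable
  have iW : ∀ j, Integrable (fun x => evoErr (θ j) τ (τ * lam / β) x ^ 2) stdG := fun j =>
    integrable_stdG_of_abs_le ((hWm j).pow_const 2) (abs_evoErr_sq_le hb hτ)
  have iD : ∀ j, Integrable (fun x => |θ j + evoErr (θ j) τ (τ * lam / β) x| - |θ j|) stdG :=
    fun j => integrable_stdG_of_abs_le (((hWm j).const_add _).abs.sub_const _)
      (abs_abs_add_evoErr_sub_le hb hτ)
  have h1 : ∀ j, -((1 + ∫ x, evoErr (θ j) τ (τ * lam / β) x ^ 2 ∂stdG) / 2) ≤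
      ∫ x, (|θ j + evoErr (θ j) τ (τ * lam / β) x| - |θ j|) ∂stdG := by
    intro j
    have h2 : ∫ x, -((1 + evoErr (θ j) τ (τ * lam / β) x ^ 2) / 2) ∂stdG =
        -((1 + ∫ x, evoErr (θ j) τ (τ * lam / β) x ^ 2 ∂stdG) / 2) := by
      rw [integral_neg, integral_div, integral_add (integrable_const _) (iW j)]
      simp
    rw [← h2]
    refine integral_mono (((integrable_const _).add (iW j)).div_const 2).neg (iD j) fun x => ?_
    have h3 := abs_sub_abs_le_abs_sub (θ j) (θ j + evoErr (θ j) τ (τ * lam / β) x)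
    rw [sub_add_cancel_left, abs_neg] at h3
    have h4 : |evoErr (θ j) τ (τ * lam / β) x| ^ 2 = evoErr (θ j) τ (τ * lam / β) x ^ 2 :=
      sq_abs _
    simp only
    nlinarith [sq_nonneg (|evoErr (θ j) τ (τ * lam / β) x| - 1)]
  have h5 := Finset.sum_le_sum fun j (_ : j ∈ Finset.univ) => h1 j
  rw [Finset.sum_neg_distrib, ← Finset.sum_div, Finset.sum_add_distrib, h.sum_sq] at h5
  simp only [Finset.sum_const, Finset.card_univ, Fintype.card_fin, nsmul_eq_mul, mul_one] at h5
  rw [evoMean, le_div_iff₀ hn]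
  refine le_trans ?_ h5
  have h6 : -((N / n + τ ^ 2) / 2) * n = -((N + n * τ ^ 2) / 2) := by field_simp
  rw [h6]
  nlinarith [mul_nonneg hn.le (sq_nonneg σ)]

theorem tauHat_eq {n N : ℕ} {σ : ℝ} {θ : Fin N → ℝ} {ω : (Fin n → Fin N → ℝ) × (Fin n → ℝ)}
    (hn : 0 < n) (x : Fin N → ℝ) :
    tauHat ω.1 (yvec σ θ ω.1 ω.2) x = l2 (lassoResidual σ θ ω x) / √n / (1 - l0 x / n) := by
  have hn' : (0 : ℝ) < n := by exact_mod_cast hn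
  have hsn : 0 < √(n : ℝ) := Real.sqrt_pos.2 hn'
  have hsn2 : √(n : ℝ) ^ 2 = n := Real.sq_sqrt hn'.le
  have h1 : (n : ℝ) - l0 x = √n ^ 2 * (1 - l0 x / n) := by
    rw [hsn2]; field_simp
  rw [tauHat, h1]
  simp only [yvec_sub]
  rw [show √(∑ i, (σ * ω.2 i - ∑ j, ω.1 i j * (x j - θ j)) ^ 2) = l2 (lassoResidual σ θ ω x)
    from rfl, sq, mul_assoc, mul_div_mul_left _ _ hsn.ne', div_div]

/-- On the good event the estimated noise level is close to the state evolution parameter. -/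
theorem abs_tauHat_sub_le {n N : ℕ} {δ σ lmin lmax lam lam₀ m M₁ c τM βm R K A B C E U a ρ t β τ : ℝ}
    {θ x : Fin N → ℝ} {ω : (Fin n → Fin N → ℝ) × (Fin n → ℝ)}
    (hn : 0 < n) (hδ : 0 < δ) (hnN : (n : ℝ) = δ * N) (hl : 0 < lmin)
    (hlam : lam ∈ Set.Icc lmin lmax) (hlam₀ : lam₀ ∈ Set.Icc lmin lmax) (hdiff : |lam - lam₀| ≤ ρ)
    (hR : 0 < R) (hc : 0 ≤ c) (hC0 : 0 ≤ C) (hβm : 0 < βm) (hβ : βm ≤ β) (hτ : 0 < τ) (hτM : τ ≤ τM)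
    (hm : -(lmax * M₁) ≤ m) (hC : C * ρ ≤ 1) (hνR : ρ * (√(1 / δ) * R) ≤ 1)
    (hcR : lmax * M₁ + 2 * σ ^ 2 + 2 ≤ c / 2 * (R ^ 2 / 2 - (τM ^ 2 + 1)))
    (hU : U = 4 * σ ^ 2 + 2 * lmax * (√(1 / δ) * R)) (hK : K = lmax / lmin * √(n * U))
    (hE : E = 2 * C + U / (2 * lmin ^ 2)) (hρ1 : ρ ≤ 1) (hρa : ρ ≤ a) (hρa2 : ρ ≤ a ^ 2)
    (ht : 0 < t) (htE : E * ρ ≤ B * a * t) (hAB : (A + B) * a ≤ βm / τM / 2)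
    (hz : l2 ω.2 ≤ 2 * √n)
    (hP₀ : PrimalGood σ lam₀ m c τM R 0 (1 / δ - (1 - β / τ) + A * a) (C * (ρ * n)) θ ω)
    (hPt : PrimalGood σ lam₀ m c τM R t (1 / δ - (1 - β / τ) + A * a) (C * (ρ * n)) θ ω)
    (hD₀ : DualGood σ lam₀ m β R K 0 (1 - β / τ + A * a) (C * (ρ * n)) θ ω)
    (hDt : DualGood σ lam₀ m β R K t (1 - β / τ + A * a) (C * (ρ * n)) θ ω)
    (hx : IsMinOn (lassoCost ω.1 (yvec σ θ ω.1 ω.2) lam) Set.univ x) :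
    |tauHat ω.1 (yvec σ θ ω.1 ω.2) x - τ| ≤
      (√(4 * E) + √U / lmin + τM * (A + B)) * (2 / (βm / τM)) * a := by
  have hn' : (0 : ℝ) < n := by exact_mod_cast hn
  have hsn : 0 < √(n : ℝ) := Real.sqrt_pos.2 hn'
  have hsn2 : √(n : ℝ) ^ 2 = n := Real.sq_sqrt hn'.le
  have hρ0 : 0 ≤ ρ := (abs_nonneg _).trans hdiff
  have hlam0 : 0 < lam := hl.trans_le hlam.1
  have hlam₀0 : 0 < lam₀ := hl.trans_le hlam₀.1
  have hlmax : 0 < lmax := hlam0.trans_le hlam.2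
  have hU0 : 0 ≤ U := by rw [hU]; positivity
  have hE0 : 0 ≤ E := by rw [hE]; positivity
  have hNn : (N : ℝ) = n * (1 / δ) := by rw [hnN]; field_simp
  have hν : √(1 / δ) ^ 2 * n = N := by
    rw [Real.sq_sqrt (by positivity), hNn, mul_comm]
  obtain ⟨hloc, hres⟩ := hP₀.localize hn hν (Real.sqrt_nonneg _) hR hc hm hlam0.le hlam.2 hdiff hC
    hνR hcR hz hx
  rw [← hU] at hres
  have hK' : lam₀ / lam * l2 (lassoResidual σ θ ω x) ≤ K := by
    rw [hK]
    have := l2_nonneg (lassoResidual σ θ ω x)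
    have h1 : l2 (lassoResidual σ θ ω x) ≤ √(n * U) := Real.le_sqrt_of_sq_le hres
    have h2 : lam₀ / lam ≤ lmax / lmin := div_le_div₀ hlmax.le hlam₀.2 hl hlam.1
    gcongr
  obtain ⟨c1, c2, c3, c4⟩ := residual_and_l0_control hn hP₀ hPt hD₀ hDt hl hlam.1 hlam₀0.le hdiff
    hρ1 hc ht.le hloc hres hK' hx
  rw [← hE] at c2 c3 c4
  have e3 : (N - l0 x : ℝ) - n * (1 / δ - (1 - β / τ) + A * a) ≤ B * a * n := by
    refine le_of_mul_le_mul_left (c3.trans ?_) ht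
    have := mul_le_mul_of_nonneg_right htE hn'.le
    linarith only [this]
  have e4 : l0 x - n * (1 - β / τ + A * a) ≤ B * a * n := by
    refine le_of_mul_le_mul_left (c4.trans ?_) ht
    have := mul_le_mul_of_nonneg_right htE hn'.le
    linarith only [this]
  have e5 : |l0 x / n - (1 - β / τ)| ≤ (A + B) * a := by
    have h1 : l0 x / n - (1 - β / τ) = (l0 x - n * (1 - β / τ)) / n := by field_simp
    rw [h1, abs_div, abs_of_pos hn', div_le_iff₀ hn', abs_le]
    constructor
    · rw [hNn] at e3; linarith only [e3]
    · linarith only [e4]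
  rw [tauHat_eq hn]
  refine abs_div_sub_le (c := lam₀ / lam) hβm hβ hτ hτM hl
    (div_nonneg (l2_nonneg _) hsn.le) ?_ (by positivity) (hρ0.trans hρa) ?_ ?_ e5 hAB
  · rw [div_pow, hsn2, div_le_iff₀ hn', mul_comm U]; exact hres
  · exact c1.trans (by gcongr)
  · rw [← mul_div_assoc]
    refine c2.trans ?_
    rw [mul_assoc]; gcongr

/-- The localization radius can be chosen so that the quadratic growth dominates any constant. -/
theorem exists_radius {σ βm τM B₀ d : ℝ} (hσ : 0 < σ) (hβm : 0 < βm) (hτM : 0 < τM) (hB : 0 ≤ B₀)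
    (hd : 0 ≤ d) :
    ∃ R : ℝ, 0 < R ∧ 2 * (τM ^ 2 + 1) + 8 * d ≤ R ^ 2 ∧
      B₀ ≤ primalCurv σ βm τM R / 2 * (R ^ 2 / 2 - (τM ^ 2 + 1)) := by
  set kk := βm * σ ^ 2 / (4 * τM * √(τM ^ 2 + 1)) with hkk
  have hs : 0 < √(τM ^ 2 + 1) := Real.sqrt_pos.2 (by positivity)
  have hkk0 : 0 < kk := by positivity
  set R := σ + 2 * (τM + 1) + 8 * d + 1 + 8 * B₀ / kk with hR
  have hBk : 0 ≤ 8 * B₀ / kk := by positivity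
  have hR1 : 1 ≤ R := by linarith
  have hR0 : 0 < R := by linarith
  have hσR : σ ≤ R := by linarith
  have h1 : 4 * (τM + 1) ^ 2 + 8 * d ≤ R ^ 2 := by
    have h2 : 2 * (τM + 1) + 8 * d + 1 ≤ R := by linarith
    nlinarith [mul_self_le_mul_self (by positivity) h2, mul_nonneg hd hτM.le, mul_nonneg hd hd]
  have h3 : 4 * (τM ^ 2 + 1) ≤ R ^ 2 := by nlinarith
  refine ⟨R, hR0, by nlinarith, ?_⟩
  have h4 : kk / R ≤ primalCurv σ βm τM R := by
    rw [hkk, primalCurv, div_div]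
    have h5 : √(σ ^ 2 + R ^ 2) ≤ 2 * R := by
      rw [Real.sqrt_le_left (by positivity)]; nlinarith
    have : 0 < √(σ ^ 2 + R ^ 2) := Real.sqrt_pos.2 (by positivity)
    refine div_le_div_of_nonneg_left (by positivity) (by positivity) ?_
    calc 2 * τM * √(σ ^ 2 + R ^ 2) * √(τM ^ 2 + 1) ≤ 2 * τM * (2 * R) * √(τM ^ 2 + 1) := by gcongr
      _ = _ := by ring
  have h6 : R ^ 2 / 4 ≤ R ^ 2 / 2 - (τM ^ 2 + 1) := by linarith
  have h7 : 8 * B₀ ≤ kk * R := by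
    have : 8 * B₀ / kk ≤ R := by linarith
    rw [div_le_iff₀ hkk0] at this; linarith
  have h8 : 0 ≤ primalCurv σ βm τM R := le_trans (by positivity) h4
  calc B₀ ≤ kk * R / 8 := by linarith
    _ = kk / R / 2 * (R ^ 2 / 4) := by field_simp; ring
    _ ≤ _ := by gcongr

set_option maxHeartbeats 1000000 in
/-- Deviation of the estimated noise level, uniformly over a small window of tuning parameters. -/
theorem measure_window_le {δ σ lmin lmax q : ℝ} (hδ : 0 < δ) (hσ : 0 < σ) (hl : 0 < lmin)
    (hll : lmin ≤ lmax) {Dfam : (M : ℕ) → Set (Fin M → ℝ)} (hD : DFamSpec δ Dfam q) :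
    ∃ C₀ c₀ η : ℝ, 0 < C₀ ∧ 0 < c₀ ∧ 0 < η ∧ ∀ N n : ℕ, 0 < N → (n : ℝ) = δ * N →
      ∀ θ ∈ Dfam N, ∀ lam₀ ∈ Set.Icc lmin lmax, ∀ β τ : ℝ,
      StateEvo δ σ (empDist θ) lam₀ β τ → ∀ ε ∈ Set.Ioc (0 : ℝ) 1,
      Pmodel n N {ω | ∃ lam ∈ Set.Icc lmin lmax, |lam - lam₀| ≤ η * ε ^ 3 ∧
        ∃ x, IsMinOn (lassoCost ω.1 (yvec σ θ ω.1 ω.2) lam) Set.univ x ∧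
          ε / 4 < |tauHat ω.1 (yvec σ θ ω.1 ω.2) x - τ|} ≤
        ENNReal.ofReal (C₀ * Real.exp (-(c₀ * N * ε ^ 6))) := by
  obtain ⟨α, T, s, hα, hT, hs, hs1, hr, hcard⟩ := hD.exists_threshold hδ
  have hsδ : s < δ := by
    linarith only [mul_nonneg hs (sq_nonneg α), hr,
      mul_nonneg (sub_nonneg.2 hs1) (tailMoment_nonneg α)]
  obtain ⟨τM, hτM, HτM⟩ := exists_tau_bound hδ hσ hl hll hα hT hs hs1 hr
  obtain ⟨βm, hβm, Hβm⟩ := exists_beta_bound (lmax := lmax) hδ hσ hl hT hsδ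
  obtain ⟨A, c₁, hA, hc₁, H₁⟩ := measure_compl_good_le hδ hσ hl hll hτM hβm
  obtain ⟨c₂, hc₂, H₂⟩ := measure_l2_compl_le hδ
  have hlmax : 0 < lmax := hl.trans_le hll
  set M₁ := (1 / δ + τM ^ 2) / 2 with hM₁
  obtain ⟨R, hR, hR2, hRB⟩ := exists_radius (B₀ := lmax * M₁ + 2 * σ ^ 2 + 2) (d := 1 / δ) hσ hβm hτM
    (by positivity) (by positivity)
  obtain ⟨C, k, hC, hk, H₁⟩ := H₁ R hR hR2
  set U := 4 * σ ^ 2 + 2 * lmax * (√(1 / δ) * R) with hU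
  set E := 2 * C + U / (2 * lmin ^ 2) with hE
  have hU0 : 0 < U := by positivity
  have hE0 : 0 < E := by positivity
  set Q := (√(4 * E) + √U / lmin + τM * (A + E / k)) * (2 / (βm / τM)) with hQ
  have hQ0 : 0 < Q := by positivity
  obtain ⟨k₀, hk₀, -, hk₀1⟩ := exists_pos_mul_le
    (x := (A + E / k) * (2 / (βm / τM)) + 4 * Q + 2) (y := 1) (by positivity) one_pos
  obtain ⟨p, hp, hp1, hpC⟩ := exists_pos_mul_le (x := C + √(1 / δ) * R) (y := 1) (by positivity) one_pos
  refine ⟨114, min c₁ c₂ * (p * k₀ ^ 3) ^ 2, p * k₀ ^ 3, by norm_num, by positivity, by positivity, ?_⟩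
  intro N n hN hnN θ hθ lam₀ hlam₀ β τ hse ε hε
  have hN' : (0 : ℝ) < N := by exact_mod_cast hN
  have hn' : (0 : ℝ) < n := by rw [hnN]; positivity
  have hn : 0 < n := by exact_mod_cast hn'
  have hlam₀0 : 0 < lam₀ := hl.trans_le hlam₀.1
  have hsys := hse.evoSys hδ hlam₀0 hN
  have hτM' := HτM N θ hN (hcard N θ hθ) lam₀ hlam₀ β τ hsys
  have hβm' := Hβm N θ hN (hcard N θ hθ) lam₀ hlam₀ β τ hsys
  have hστ := hsys.le_tau (by positivity)
  have hβτ := hsys.beta_le (by positivity)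
  have hτ0 := hsys.τ_pos
  set a := k₀ * ε with ha
  have ha0 : 0 < a := mul_pos hk₀ hε.1
  have hx1 : 0 < (A + E / k) * (2 / (βm / τM)) := by positivity
  have hkx := mul_pos hk₀ hx1
  have hkQ := mul_pos hk₀ hQ0
  have hk₀3 : k₀ * ((A + E / k) * (2 / (βm / τM))) + 4 * (k₀ * Q) + 2 * k₀ ≤ 1 := by
    linarith only [hk₀1]
  have hk₀2 : k₀ ≤ 1 / 2 := by linarith only [hk₀3, hkx, hkQ]
  have ha1 : a ≤ 1 / 2 := by
    have := mul_le_mul hk₀2 hε.2 hε.1.le (by norm_num)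
    linarith only [this]
  have hak : a ≤ k₀ := mul_le_of_le_one_right hk₀.le hε.2
  have hQa : Q * a ≤ ε / 4 := by
    have h1 : k₀ * (4 * Q) ≤ 1 := by linarith only [hk₀3, hkx, hk₀]
    have h2 := mul_le_mul_of_nonneg_right h1 hε.1.le
    rw [ha]; linarith only [h2]
  have hABa : (A + E / k) * a ≤ βm / τM / 2 := by
    have h1 : a * ((A + E / k) * (2 / (βm / τM))) ≤ 1 := by
      have h2 := mul_le_mul_of_nonneg_right hak hx1.le
      linarith only [h2, hk₀3, hkQ, hk₀]
    have h3 : (A + E / k) * a = a * ((A + E / k) * (2 / (βm / τM))) * (βm / τM / 2) := by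
      field_simp
    rw [h3]
    exact mul_le_of_le_one_left (by positivity) h1
  set ρ := p * a ^ 3 with hρ
  have hρη : p * k₀ ^ 3 * ε ^ 3 = ρ := by rw [hρ, ha]; ring
  have hρ0 : 0 < ρ := by positivity
  have hρ3 : ρ ≤ a ^ 3 := mul_le_of_le_one_left (by positivity) hp1
  have ha32 : a ^ 3 ≤ a ^ 2 := pow_le_pow_of_le_one ha0.le (by linarith) (by norm_num)
  have ha21 : a ^ 2 ≤ a := pow_le_of_le_one ha0.le (by linarith) (by norm_num)
  have hρp : ρ ≤ p := mul_le_of_le_one_right hp.le (pow_le_one₀ ha0.le (by linarith))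
  have hρ1 : ρ < 1 := by linarith only [hρ3, ha32, ha21, ha1]
  have hνR0 : 0 < √(1 / δ) * R := by positivity
  have hCρ : C * ρ ≤ 1 := by
    linarith only [mul_le_mul_of_nonneg_left hρp hC.le, mul_pos hp hνR0, hpC]
  have hνρ : ρ * (√(1 / δ) * R) ≤ 1 := by
    linarith only [mul_le_mul_of_nonneg_right hρp hνR0.le, mul_pos hp hC, hpC]
  have ht0 : 0 < k * a ^ 2 := by positivity
  have htE : E * ρ ≤ E / k * a * (k * a ^ 2) := by
    have h1 : E / k * a * (k * a ^ 2) = E * a ^ 3 := by field_simp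
    rw [h1]; gcongr
  have hK0 : 0 ≤ lmax / lmin * √(n * U) := by positivity
  set m := β ^ 2 / 2 + lam₀ * evoMean n θ τ (τ * lam₀ / β) with hmdef
  have hm : -(lmax * M₁) ≤ m := by
    have h1 := hsys.neg_le_evoMean (by positivity) hlam₀0
    have h2 : (N : ℝ) / (δ * N) = 1 / δ := by field_simp
    rw [h2, ← hnN] at h1
    have h3 : τ ^ 2 ≤ τM ^ 2 := by gcongr
    have h4 : -M₁ ≤ evoMean n θ τ (τ * lam₀ / β) := by linarith only [h1, h3, hM₁]
    have h5 := mul_le_mul_of_nonneg_left h4 hlam₀0.le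
    have h6 : lam₀ * M₁ ≤ lmax * M₁ := by
      have := hlam₀.2
      gcongr
    linarith only [sq_nonneg β, h5, h6, hmdef]
  have hcurv : 0 ≤ primalCurv σ βm τM R := by unfold primalCurv; positivity
  obtain ⟨p0, d0⟩ := H₁ N n hN hnN θ lam₀ hlam₀ β τ hsys hστ hτM' hβm' hβτ a ρ 0 hρ0 hρ1
    ((hρ3.trans ha32).trans ha21) le_rfl (by positivity)
  obtain ⟨pt, dt⟩ := H₁ N n hN hnN θ lam₀ hlam₀ β τ hsys hστ hτM' hβm' hβτ a ρ (k * a ^ 2) hρ0 hρ1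
    ((hρ3.trans ha32).trans ha21) ht0.le le_rfl
  have d0 := d0 _ hK0
  have dt := dt _ hK0
  have z0 := (Pmodel_snd_preimage_le (N := N) _).trans (H₂ N n hnN ρ ⟨hρ0, hρ1.le⟩)
  set ex := Real.exp (-(min c₁ c₂ * (p * k₀ ^ 3) ^ 2 * N * ε ^ 6)) with hex
  have hexp : min c₁ c₂ * (p * k₀ ^ 3) ^ 2 * N * ε ^ 6 = min c₁ c₂ * N * ρ ^ 2 := by
    rw [← hρη]; ring
  have e₁ : Real.exp (-(c₁ * N * ρ ^ 2)) ≤ ex := by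
    rw [hex, hexp]; gcongr; exact min_le_left _ _
  have e₂ : Real.exp (-(c₂ * N * ρ ^ 2)) ≤ ex := by
    rw [hex, hexp]; gcongr; exact min_le_right _ _
  have hex0 : 0 ≤ ex := (Real.exp_pos _).le
  rw [hρη]
  refine (measure_mono (t := (({ω | ¬ PrimalGood σ lam₀ m (primalCurv σ βm τM R) τM R 0
        (1 / δ - (1 - β / τ) + A * a) (C * (ρ * n)) θ ω} ∪
      {ω | ¬ PrimalGood σ lam₀ m (primalCurv σ βm τM R) τM R (k * a ^ 2)
        (1 / δ - (1 - β / τ) + A * a) (C * (ρ * n)) θ ω}) ∪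
      ({ω | ¬ DualGood σ lam₀ m β R (lmax / lmin * √(n * U)) 0 (1 - β / τ + A * a)
        (C * (ρ * n)) θ ω} ∪
      {ω | ¬ DualGood σ lam₀ m β R (lmax / lmin * √(n * U)) (k * a ^ 2) (1 - β / τ + A * a)
        (C * (ρ * n)) θ ω})) ∪
      {ω | ω.2 ∈ {g | ¬ ((1 - ρ) * √n ≤ l2 g ∧ l2 g ≤ (1 + ρ) * √n)}}) ?_).trans ?_
  · rintro ω ⟨lam, hlam, hd, x, hx, hlt⟩
    by_contra hω
    simp only [Set.mem_union, Set.mem_ofPred_eq, not_or, not_not] at hω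
    obtain ⟨⟨⟨g1, g2⟩, g3, g4⟩, -, g5⟩ := hω
    have hz : l2 ω.2 ≤ 2 * √n := g5.trans (by gcongr; linarith)
    have := abs_tauHat_sub_le hn hδ hnN hl hlam hlam₀ hd hR hcurv hC.le hβm hβm' hτ0 hτM' hm hCρ hνρ
      hRB hU rfl hE hρ1.le ((hρ3.trans ha32).trans ha21) (hρ3.trans ha32) ht0 htE hABa hz g1 g2 g3 g4
      hx
    rw [← hQ] at this
    linarith only [this, hlt, hQa]
  · refine (measure_union_le _ _).trans ((add_le_add ((measure_union_le _ _).trans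
      (add_le_add ((measure_union_le _ _).trans (add_le_add p0 pt))
        ((measure_union_le _ _).trans (add_le_add d0 dt)))) z0).trans ?_)
    rw [← ENNReal.ofReal_add (by positivity) (by positivity),
      ← ENNReal.ofReal_add (by positivity) (by positivity),
      ← ENNReal.ofReal_add (by positivity) (by positivity)]
    refine ENNReal.ofReal_le_ofReal ?_
    linarith only [e₁, e₂]

theorem DFamSpec.q_nonneg {δ q : ℝ} {Dfam : (M : ℕ) → Set (Fin M → ℝ)} (hD : DFamSpec δ Dfam q) :
    0 ≤ q := by
  rcases hD with ⟨p, ξ, -, -, -, rfl⟩ | ⟨s, -, -, -, rfl⟩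
  · exact le_max_right _ _
  · exact le_rfl

/-- Two events of small probability leave out a common outcome. -/
theorem exists_notMem_of_measure_le {Ω : Type*} [MeasurableSpace Ω] (μ : Measure Ω)
    [IsProbabilityMeasure μ] {S₁ S₂ : Set Ω} {r : ℝ} (hr : 0 ≤ r) (hr2 : 2 * r < 1)
    (h₁ : μ S₁ ≤ ENNReal.ofReal r) (h₂ : μ S₂ ≤ ENNReal.ofReal r) : ∃ ω, ω ∉ S₁ ∧ ω ∉ S₂ := by
  by_contra! h
  have h3 : S₁ ∪ S₂ = Set.univ := by
    ext ω
    simp only [Set.mem_union, Set.mem_univ, iff_true]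
    by_cases h4 : ω ∈ S₁
    · exact Or.inl h4
    · exact Or.inr (h ω h4)
  have h5 := (measure_union_le S₁ S₂).trans (add_le_add h₁ h₂)
  rw [h3, measure_univ, ← ENNReal.ofReal_add hr hr, ENNReal.one_le_ofReal] at h5
  linarith

/-- Corollary (consistency of τ̂): uniform control of |τ̂(λ) − τ⋆(λ)|. -/
theorem stmt5 (δ σ lmin lmax q : ℝ)
    (hδ : 0 < δ) (hσ : 0 < σ) (hl : 0 < lmin) (hll : lmin ≤ lmax)
    (Dfam : (M : ℕ) → Set (Fin M → ℝ))
    (hD : DFamSpec δ Dfam q) :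
    ∃ C c : ℝ, 0 < C ∧ 0 < c ∧
      ∀ (N n : ℕ), 0 < N → (n : ℝ) = δ * N →
      ∀ θstar ∈ Dfam N,
      ∀ βstar τstar : ℝ → ℝ,
      (∀ lam ∈ Set.Icc lmin lmax,
        StateEvo δ σ (empDist θstar) lam (βstar lam) (τstar lam)) →
      ∀ θhat : ℝ → (Fin n → Fin N → ℝ) → (Fin n → ℝ) → (Fin N → ℝ),
      (∀ lam ∈ Set.Icc lmin lmax, ∀ (X : Fin n → Fin N → ℝ) (z : Fin n → ℝ),
        IsMinOn (lassoCost X (yvec σ θstar X z) lam) Set.univ (θhat lam X z)) →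
      ∀ ε : ℝ, ε ∈ Set.Ioc (0 : ℝ) 1 →
      Pmodel n N
        {ω | ∃ lam ∈ Set.Icc lmin lmax,
          ε ≤ |tauHat ω.1 (yvec σ θstar ω.1 ω.2) (θhat lam ω.1 ω.2) - τstar lam|}
      ≤ ENNReal.ofReal (C / ε ^ 6 * (N : ℝ) ^ q * Real.exp (-c * N * ε ^ 6)) := by
  obtain ⟨C₀, c₀, η, hC₀, hc₀, hη, H⟩ := measure_window_le hδ hσ hl hll hD
  set L := (lmax - lmin) / η + 1 with hL
  have hLη : 0 ≤ (lmax - lmin) / η := div_nonneg (sub_nonneg.2 hll) hη.le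
  have hL0 : 0 < L := by positivity
  refine ⟨(L + 2) * C₀, c₀, by positivity, hc₀, ?_⟩
  intro N n hN hnN θ hθ β τ hse θhat hmin ε hε
  have hε0 := hε.1
  set ex := Real.exp (-(c₀ * N * ε ^ 6)) with hex
  have hex0 : 0 < ex := Real.exp_pos _
  have hexp : Real.exp (-c₀ * N * ε ^ 6) = ex := by rw [hex]; congr 1; ring
  have hNq : 1 ≤ (N : ℝ) ^ q := Real.one_le_rpow (by exact_mod_cast hN) hD.q_nonneg
  have hε6 : ε ^ 6 ≤ 1 := pow_le_one₀ hε0.le hε.2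
  have hbound : (L + 2) * C₀ / ε ^ 6 * ex ≤ (L + 2) * C₀ / ε ^ 6 * (N : ℝ) ^ q * ex := by
    gcongr
    exact le_mul_of_one_le_right (by positivity) hNq
  rw [hexp]
  by_cases hbig : 1 ≤ 2 * (C₀ * ex)
  · refine prob_le_one.trans (ENNReal.one_le_ofReal.2 (le_trans ?_ hbound))
    calc 1 ≤ 2 * (C₀ * ex) := hbig
      _ ≤ (L + 2) * C₀ * ex := by nlinarith [mul_pos hL0 (mul_pos hC₀ hex0)]
      _ ≤ (L + 2) * C₀ / ε ^ 6 * ex := by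
          gcongr
          rw [le_div_iff₀ (by positivity)]
          exact mul_le_of_le_one_right (by positivity) hε6
  push Not at hbig
  set h := η * ε ^ 3 with hh
  have hh0 : 0 < h := by positivity
  have hτ : ∀ lam ∈ Set.Icc lmin lmax, ∀ lam₀ ∈ Set.Icc lmin lmax, |lam - lam₀| ≤ h →
      |τ lam - τ lam₀| ≤ ε / 2 := by
    intro lam hlam lam₀ hlam₀ hd
    obtain ⟨ω, h₁, h₂⟩ := exists_notMem_of_measure_le _ (by positivity) hbig
      (H N n hN hnN θ hθ lam hlam _ _ (hse lam hlam) ε hε)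
      (H N n hN hnN θ hθ lam₀ hlam₀ _ _ (hse lam₀ hlam₀) ε hε)
    have a₁ : ¬ ε / 4 < |tauHat ω.1 (yvec σ θ ω.1 ω.2) (θhat lam ω.1 ω.2) - τ lam| := fun hlt =>
      h₁ ⟨lam, hlam, by rw [sub_self, abs_zero]; exact hh0.le, _, hmin lam hlam _ _, hlt⟩
    have a₂ : ¬ ε / 4 < |tauHat ω.1 (yvec σ θ ω.1 ω.2) (θhat lam ω.1 ω.2) - τ lam₀| := fun hlt =>
      h₂ ⟨lam, hlam, hd, _, hmin lam hlam _ _, hlt⟩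
    rw [not_lt, abs_le] at a₁ a₂
    rw [abs_le]
    constructor <;> linarith [a₁.1, a₁.2, a₂.1, a₂.2]
  set M := ⌊(lmax - lmin) / h⌋₊ with hM
  have hMh : (M : ℝ) * h ≤ lmax - lmin := by
    rw [← le_div_iff₀ hh0]
    exact Nat.floor_le (div_nonneg (sub_nonneg.2 hll) hh0.le)
  have hgrid : ∀ k ∈ Finset.range (M + 1), lmin + k * h ∈ Set.Icc lmin lmax := by
    intro k hk
    have hk' : (k : ℝ) ≤ M := by exact_mod_cast Finset.mem_range_succ_iff.1 hk
    have := mul_le_mul_of_nonneg_right hk' hh0.le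
    have : 0 ≤ (k : ℝ) * h := by positivity
    constructor <;> linarith
  have hcover : {ω : (Fin n → Fin N → ℝ) × (Fin n → ℝ) | ∃ lam ∈ Set.Icc lmin lmax,
      ε ≤ |tauHat ω.1 (yvec σ θ ω.1 ω.2) (θhat lam ω.1 ω.2) - τ lam|} ⊆
      ⋃ k ∈ Finset.range (M + 1), {ω | ∃ lam ∈ Set.Icc lmin lmax, |lam - (lmin + k * h)| ≤ h ∧
        ∃ x, IsMinOn (lassoCost ω.1 (yvec σ θ ω.1 ω.2) lam) Set.univ x ∧
          ε / 4 < |tauHat ω.1 (yvec σ θ ω.1 ω.2) x - τ (lmin + k * h)|} := by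
    rintro ω ⟨lam, hlam, hbad⟩
    have hq0 : 0 ≤ (lam - lmin) / h := div_nonneg (sub_nonneg.2 hlam.1) hh0.le
    set k := ⌊(lam - lmin) / h⌋₊ with hk
    have hkM : k ∈ Finset.range (M + 1) := by
      rw [Finset.mem_range_succ_iff]
      have := hlam.2
      exact Nat.floor_le_floor (by gcongr)
    have h1 := Nat.floor_le hq0
    have h2 := (Nat.lt_floor_add_one ((lam - lmin) / h)).le
    rw [← hk, le_div_iff₀ hh0] at h1
    rw [← hk, div_le_iff₀ hh0] at h2
    have hd : |lam - (lmin + k * h)| ≤ h := by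
      rw [abs_le]; constructor <;> linarith
    refine Set.mem_biUnion (Finset.mem_coe.2 hkM) ⟨lam, hlam, hd, _, hmin lam hlam _ _, ?_⟩
    have h3 := hτ lam hlam _ (hgrid k hkM) hd
    have h4 := abs_sub_le (tauHat ω.1 (yvec σ θ ω.1 ω.2) (θhat lam ω.1 ω.2)) (τ (lmin + k * h)) (τ lam)
    rw [abs_sub_comm (τ (lmin + k * h))] at h4
    linarith
  refine (measure_mono hcover).trans ((measure_biUnion_finset_le _ _).trans ?_)
  refine (Finset.sum_le_sum fun k hk => H N n hN hnN θ hθ _ (hgrid k hk) _ _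
    (hse _ (hgrid k hk)) ε hε).trans ?_
  rw [← ENNReal.ofReal_sum_of_nonneg fun _ _ => by positivity, Finset.sum_const, Finset.card_range,
    nsmul_eq_mul]
  refine ENNReal.ofReal_le_ofReal (le_trans ?_ hbound)
  have hM1 : ((M + 1 : ℕ) : ℝ) ≤ (L + 2) / ε ^ 6 := by
    rw [le_div_iff₀ (by positivity)]
    have h1 : (M : ℝ) * ε ^ 6 ≤ (lmax - lmin) / η := by
      rw [le_div_iff₀ hη]
      have h2 : ε ^ 3 ≤ 1 := pow_le_one₀ hε0.le hε.2
      calc (M : ℝ) * ε ^ 6 * η = M * h * ε ^ 3 := by rw [hh]; ring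
        _ ≤ M * h := mul_le_of_le_one_right (by positivity) h2
        _ ≤ _ := hMh
    push_cast
    linarith
  calc ((M + 1 : ℕ) : ℝ) * (C₀ * ex) ≤ (L + 2) / ε ^ 6 * (C₀ * ex) := by gcongr
    _ = _ := by ring
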